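/- There is a constant C such that for every n ≥ 1 and every polygonal domain P with n edges satisfying P ⊆ (0,1)², there is a finite sequence of at most C·n snip, reset and undo operations (with undo stack of size 1) in the disconnected two-tool snip model leading from the initial configuration to a configuration in which T₁ realizes P. -/

import Mathlib

open Set

/-- The plane. -/
abbrev Plane := ℝ × ℝ

/-- A rigid motion of the plane: `g x = R x + v` with `R ∈ SO(2)`. -/
def IsRigidMotion (g : Plane → Plane) : Prop :=
  ∃ θ : ℝ, ∃ v : Plane, ∀ p : Plane,
    g p = (Real.cos θ * p.1 - Real.sin θ * p.2 + v.1,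
           Real.sin θ * p.1 + Real.cos θ * p.2 + v.2)

/-- The open unit square `(0,1)²`. -/
def UnitSq : Set Plane := Ioo (0:ℝ) 1 ×ˢ Ioo (0:ℝ) 1

/-- A tool `T` realizes the shape `P` if `T` is the image of `P` under a rigid motion. -/
def Realizes (T P : Set Plane) : Prop := ∃ g, IsRigidMotion g ∧ T = g '' P

/-- A polygonal domain with `n` edges: a nonempty bounded regular-open set whose
frontier is contained in a union of `n` closed line segments. -/
def IsPolygonalDomain (P : Set Plane) (n : ℕ) : Prop :=
  P.Nonempty ∧ Bornology.IsBounded P ∧ P = interior (closure P) ∧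
  ∃ s : Fin n → Plane × Plane, frontier P ⊆ ⋃ i, segment ℝ (s i).1 (s i).2

/-- A configuration of the two-tool model with undo stacks: each tool has a current
shape and a stack (list) of its most recent previous shapes. -/
structure UConfig where
  T₁ : Set Plane
  S₁ : List (Set Plane)
  T₂ : Set Plane
  S₂ : List (Set Plane)

/-- One operation (snip, reset or undo) in the disconnected two-tool snip model
with undo stacks of size `k`: snips and resets push the replaced shape onto the
tool's stack (keeping at most `k` entries); an undo pops the stack. -/
inductive DUStep (k : ℕ) : UConfig → UConfig → Prop
  | snip1 (g : Plane → Plane) (hg : IsRigidMotion g) (c : UConfig) :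
      DUStep k c ⟨c.T₁ \ closure (g '' c.T₂), List.take k (c.T₁ :: c.S₁), c.T₂, c.S₂⟩
  | snip2 (g : Plane → Plane) (hg : IsRigidMotion g) (c : UConfig) :
      DUStep k c ⟨c.T₁, c.S₁, c.T₂ \ closure (g '' c.T₁), List.take k (c.T₂ :: c.S₂)⟩
  | reset1 (c : UConfig) : DUStep k c ⟨UnitSq, List.take k (c.T₁ :: c.S₁), c.T₂, c.S₂⟩
  | reset2 (c : UConfig) : DUStep k c ⟨c.T₁, c.S₁, UnitSq, List.take k (c.T₂ :: c.S₂)⟩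
  | undo1 (P : Set Plane) (rest : List (Set Plane)) (T₂ : Set Plane)
      (S₂ : List (Set Plane)) (T₁ : Set Plane) :
      DUStep k ⟨T₁, P :: rest, T₂, S₂⟩ ⟨P, rest, T₂, S₂⟩
  | undo2 (P : Set Plane) (rest : List (Set Plane)) (T₁ : Set Plane)
      (S₁ : List (Set Plane)) (T₂ : Set Plane) :
      DUStep k ⟨T₁, S₁, T₂, P :: rest⟩ ⟨T₁, S₁, P, rest⟩

/-- `DUReach k s c c'` : configuration `c'` is reachable from `c` by exactly `s`
operations (snip, reset or undo), with undo stacks of size `k`. -/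
inductive DUReach (k : ℕ) : ℕ → UConfig → UConfig → Prop
  | refl (c : UConfig) : DUReach k 0 c c
  | step {s : ℕ} {c c' c'' : UConfig} :
      DUStep k c c' → DUReach k s c' c'' → DUReach k (s + 1) c c''

/-! ### Regular open sets modulo meagre sets -/

/-- Equality of planar sets up to a meagre set. -/
def Meq (S T : Set Plane) : Prop := ∀ᶠ p in residual Plane, (p ∈ S ↔ p ∈ T)

/-- Regular open sets. -/
def RegOpen (S : Set Plane) : Prop := interior (closure S) = S

theorem Meq.refl (S : Set Plane) : Meq S S := Filter.Eventually.of_forall fun _ => Iff.rfl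

theorem Meq.trans {S T W : Set Plane} (h : Meq S T) (h' : Meq T W) : Meq S W := by
  filter_upwards [h, h'] with p h1 h2 using h1.trans h2

theorem RegOpen.isOpen {S : Set Plane} (h : RegOpen S) : IsOpen S := by
  rw [← h]; exact isOpen_interior

theorem meq_closure {S : Set Plane} (h : IsOpen S) : Meq (closure S) S := by
  have := closure_residualEq h.isLocallyClosed
  exact Filter.eventuallyEq_set.1 this

theorem eq_empty_of_isOpen_of_residual {V : Set Plane} (hV : IsOpen V)
    (h : ∀ᶠ p in residual Plane, p ∉ V) : V = ∅ := by
  by_contra hne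
  obtain ⟨p, hp, hp'⟩ :=
    (dense_of_mem_residual h).inter_open_nonempty V hV (Set.nonempty_iff_ne_empty.2 hne)
  exact hp' hp

theorem RegOpen.subset_of_meq {S T : Set Plane} (hS : IsOpen S) (hT : RegOpen T)
    (h : ∀ᶠ p in residual Plane, p ∈ S → p ∈ T) : S ⊆ T := by
  have h1 : S \ closure T = ∅ := by
    refine eq_empty_of_isOpen_of_residual (hS.sdiff isClosed_closure) ?_
    filter_upwards [h] with p hp hp'
    exact hp'.2 (subset_closure (hp hp'.1))
  have h2 : S ⊆ closure T := Set.sdiff_eq_empty.1 h1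
  rw [← hT]
  exact interior_maximal h2 hS

theorem RegOpen.eq_of_meq {S T : Set Plane} (hS : RegOpen S) (hT : RegOpen T) (h : Meq S T) :
    S = T :=
  Set.Subset.antisymm (RegOpen.subset_of_meq hS.isOpen hT (h.mono fun _ hp => hp.1))
    (RegOpen.subset_of_meq hT.isOpen hS (h.mono fun _ hp => hp.2))

theorem RegOpen.diff_closure {S T : Set Plane} (hS : RegOpen S) (hT : IsOpen T) :
    RegOpen (S \ closure T) := by
  have ho : IsOpen (S \ closure T) := hS.isOpen.sdiff isClosed_closure
  refine Set.Subset.antisymm (fun p hp => ⟨?_, ?_⟩) (ho.subset_interior_iff.2 subset_closure)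
  · rw [← hS]
    exact interior_mono (closure_mono Set.sdiff_subset) hp
  · intro hpT
    obtain ⟨q, hq, hqT⟩ := mem_closure_iff.1 hpT _ isOpen_interior hp
    have : closure (S \ closure T) ⊆ Tᶜ :=
      closure_minimal (fun x hx hxT => hx.2 (subset_closure hxT)) hT.isClosed_compl
    exact this (interior_subset hq) hqT

theorem meq_diff_closure (S : Set Plane) {T : Set Plane} (hT : IsOpen T) :
    Meq (S \ closure T) (S \ T) := by
  filter_upwards [meq_closure hT] with p hp
  simp only [Set.mem_sdiff, hp]

theorem regOpen_unitSq : RegOpen UnitSq := by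
  unfold RegOpen UnitSq
  rw [closure_prod_eq, interior_prod_eq, closure_Ioo (by norm_num), interior_Icc]

/-- The rigid motion with angle `θ` and translation `v`. -/
noncomputable def rig (θ : ℝ) (v : Plane) (p : Plane) : Plane :=
  (Real.cos θ * p.1 - Real.sin θ * p.2 + v.1, Real.sin θ * p.1 + Real.cos θ * p.2 + v.2)

theorem isRigidMotion_rig (θ : ℝ) (v : Plane) : IsRigidMotion (rig θ v) :=
  ⟨θ, v, fun _ => rfl⟩

/-- The inverse of `rig θ v`. -/
noncomputable def rigInv (θ : ℝ) (v : Plane) (p : Plane) : Plane :=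
  (Real.cos θ * (p.1 - v.1) + Real.sin θ * (p.2 - v.2),
    -Real.sin θ * (p.1 - v.1) + Real.cos θ * (p.2 - v.2))

/-- Rigid motions as homeomorphisms. -/
noncomputable def rigHomeo (θ : ℝ) (v : Plane) : Plane ≃ₜ Plane where
  toFun := rig θ v
  invFun := rigInv θ v
  left_inv p := by
    have h := Real.sin_sq_add_cos_sq θ
    ext
    · simp only [rig, rigInv]; linear_combination p.1 * h
    · simp only [rig, rigInv]; linear_combination p.2 * h
  right_inv p := by
    have h := Real.sin_sq_add_cos_sq θ
    ext
    · simp only [rig, rigInv]; linear_combination (p.1 - v.1) * h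
    · simp only [rig, rigInv]; linear_combination (p.2 - v.2) * h
  continuous_toFun := by unfold rig; fun_prop
  continuous_invFun := by unfold rigInv; fun_prop

theorem mem_image_rig {θ : ℝ} {v p : Plane} {S : Set Plane} :
    p ∈ rig θ v '' S ↔ rigInv θ v p ∈ S :=
  (rigHomeo θ v).toEquiv.image_eq_preimage_symm S ▸ Iff.rfl

theorem isOpen_image_rig {θ : ℝ} {v : Plane} {S : Set Plane} (hS : IsOpen S) :
    IsOpen (rig θ v '' S) :=
  (rigHomeo θ v).isOpenMap S hS

theorem residual_comp_homeo (e : Plane ≃ₜ Plane) {Q : Plane → Prop}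
    (h : ∀ᶠ p in residual Plane, Q p) : ∀ᶠ p in residual Plane, Q (e p) := by
  have := e.residual_map_eq
  rw [← this] at h
  exact h

theorem residual_line_ne {a b : ℝ} (c : ℝ) (h : a ≠ 0 ∨ b ≠ 0) :
    ∀ᶠ p : Plane in residual Plane, a * p.1 + b * p.2 + c ≠ 0 := by
  have hab : 0 < a ^ 2 + b ^ 2 := by
    rcases h with h | h
    · have := pow_pos (abs_pos.2 h) 2; rw [sq_abs] at this; positivity
    · have := pow_pos (abs_pos.2 h) 2; rw [sq_abs] at this; positivity
  refine residual_of_dense_open (s := {p : Plane | a * p.1 + b * p.2 + c ≠ 0}) ?_ ?_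
  · exact isOpen_ne_fun (by fun_prop) (by fun_prop)
  · intro p
    by_cases hp : a * p.1 + b * p.2 + c = 0
    · have ht : Filter.Tendsto (fun t : ℝ => ((p.1 + t * a, p.2 + t * b) : Plane))
          (nhdsWithin 0 {0}ᶜ) (nhds p) := by
        have : Continuous (fun t : ℝ => ((p.1 + t * a, p.2 + t * b) : Plane)) := by fun_prop
        have h0 := this.tendsto 0
        simp only [zero_mul, add_zero] at h0
        exact h0.mono_left nhdsWithin_le_nhds
      refine mem_closure_of_tendsto ht ?_
      filter_upwards [self_mem_nhdsWithin] with t ht0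
      have : a * (p.1 + t * a) + b * (p.2 + t * b) + c = t * (a ^ 2 + b ^ 2) := by
        linear_combination hp
      rw [this]
      exact mul_ne_zero ht0 hab.ne'
    · exact subset_closure hp

theorem exists_angle {a b : ℝ} (h : a ≠ 0 ∨ b ≠ 0) :
    ∃ r θ : ℝ, 0 < r ∧ a = r * Real.sin θ ∧ b = -(r * Real.cos θ) := by
  let z : ℂ := ⟨-b, a⟩
  have hz : z ≠ 0 := by
    intro h0
    have h1 := congrArg Complex.re h0
    have h2 := congrArg Complex.im h0
    simp only [z, Complex.zero_re, Complex.zero_im] at h1 h2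
    rcases h with h | h
    · exact h h2
    · exact h (by linarith)
  refine ⟨‖z‖, Complex.arg z, norm_pos_iff.2 hz, ?_, ?_⟩
  · exact (Complex.norm_mul_sin_arg z).symm
  · have : ‖z‖ * Real.cos (Complex.arg z) = -b := Complex.norm_mul_cos_arg z
    linarith

/-! ### Sequences of operations -/

theorem DUReach.trans {k m n : ℕ} {c c' c'' : UConfig} (h : DUReach k m c c')
    (h' : DUReach k n c' c'') : DUReach k (m + n) c c'' := by
  induction h with
  | refl => simpa using h'
  | @step s _ _ _ hs _ ih =>
    have : s + 1 + n = s + n + 1 := by ring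
    rw [this]
    exact .step hs (ih h')

theorem DUStep.reach {k : ℕ} {c c' : UConfig} (h : DUStep k c c') : DUReach k 1 c c' :=
  .step h (.refl _)

/-- Exchange of the two tools. -/
def UConfig.swap (c : UConfig) : UConfig := ⟨c.T₂, c.S₂, c.T₁, c.S₁⟩

theorem DUStep.swap {k : ℕ} {c c' : UConfig} (h : DUStep k c c') : DUStep k c.swap c'.swap := by
  cases h with
  | snip1 g hg c => exact .snip2 g hg c.swap
  | snip2 g hg c => exact .snip1 g hg c.swap
  | reset1 c => exact .reset2 c.swap
  | reset2 c => exact .reset1 c.swap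
  | undo1 P r T S T' => exact .undo2 P r T S T'
  | undo2 P r T S T' => exact .undo1 P r T S T'

theorem DUReach.swap {k m : ℕ} {c c' : UConfig} (h : DUReach k m c c') :
    DUReach k m c.swap c'.swap := by
  induction h with
  | refl => exact .refl _
  | step hs _ ih => exact .step hs.swap ih

/-- Oriented lines `a x + b y + c`. -/
abbrev Ln := ℝ × ℝ × ℝ

/-- The affine form of an oriented line. -/
def Ln.ev (l : Ln) (p : Plane) : ℝ := l.1 * p.1 + l.2.1 * p.2 + l.2.2

/-- The line is a genuine line. -/
def Ln.Nondeg (l : Ln) : Prop := l.1 ≠ 0 ∨ l.2.1 ≠ 0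

/-- Intersection of open half-planes. -/
def PolyCell (L : List Ln) : Set Plane := {p | ∀ l ∈ L, 0 < l.ev p}

theorem residual_ev_ne {l : Ln} (h : l.Nondeg) : ∀ᶠ p in residual Plane, l.ev p ≠ 0 :=
  residual_line_ne _ h

theorem snip1_rig {T T₂ : Set Plane} (hT : RegOpen T) (hT₂ : IsOpen T₂) (S S₂) (θ : ℝ)
    (v : Plane) : ∃ T' S', DUReach 1 1 ⟨T, S, T₂, S₂⟩ ⟨T', S', T₂, S₂⟩ ∧ RegOpen T' ∧
      Meq T' (T \ rig θ v '' T₂) :=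
  ⟨_, _, (DUStep.snip1 _ (isRigidMotion_rig θ v) ⟨T, S, T₂, S₂⟩).reach,
    hT.diff_closure (isOpen_image_rig hT₂), meq_diff_closure _ (isOpen_image_rig hT₂)⟩

theorem mem_unitSq {p : Plane} : p ∈ UnitSq ↔ (0 < p.1 ∧ p.1 < 1) ∧ 0 < p.2 ∧ p.2 < 1 := by
  simp [UnitSq]

theorem isOpen_unitSq : IsOpen UnitSq := regOpen_unitSq.isOpen

theorem abs_rot_lt {x y : ℝ} (θ : ℝ) (hx : |x| < 1 / 2) (hy : |y| < 1 / 2) :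
    |Real.cos θ * x + Real.sin θ * y| < 1 := by
  have h := Real.sin_sq_add_cos_sq θ
  obtain ⟨h1, h2⟩ := abs_lt.1 hx
  obtain ⟨h3, h4⟩ := abs_lt.1 hy
  rw [← sq_lt_one_iff_abs_lt_one]
  have hx2 : x ^ 2 < 1 / 4 := by nlinarith
  have hy2 : y ^ 2 < 1 / 4 := by nlinarith
  nlinarith [sq_nonneg (Real.cos θ * y - Real.sin θ * x)]

/-- Four snips by the unit square remove a closed half-plane from a subset of the square. -/
theorem clip_line {l : Ln} (hl : l.Nondeg) {T W : Set Plane} (hT : RegOpen T) (hTW : Meq T W)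
    (hW : W ⊆ UnitSq) (S S₂) : ∃ T' S', DUReach 1 4 ⟨T, S, UnitSq, S₂⟩ ⟨T', S', UnitSq, S₂⟩ ∧
      RegOpen T' ∧ Meq T' (W ∩ {p | 0 < l.ev p}) := by
  obtain ⟨r, θ, hr, ha, hb⟩ := exists_angle hl
  obtain ⟨τ, hτ⟩ : ∃ τ, l.2.2 = r * τ := ⟨l.2.2 / r, by field_simp⟩
  set σ₀ := Real.cos θ * (1 / 2) + Real.sin θ * (1 / 2) with hσ
  set τ₀ := -Real.sin θ * (1 / 2) + Real.cos θ * (1 / 2) with hτ₀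
  set β₀ := max τ (τ₀ - 1) with hβ
  let v : ℝ → ℝ → Plane := fun α β =>
    (Real.cos θ * α - Real.sin θ * β, Real.sin θ * α + Real.cos θ * β)
  have hv : ∀ α β (p : Plane), p ∈ rig θ (v α β) '' UnitSq ↔
      (α < Real.cos θ * p.1 + Real.sin θ * p.2 ∧ Real.cos θ * p.1 + Real.sin θ * p.2 < α + 1) ∧
      (β < -Real.sin θ * p.1 + Real.cos θ * p.2 ∧
        -Real.sin θ * p.1 + Real.cos θ * p.2 < β + 1) := by
    intro α β p
    have h := Real.sin_sq_add_cos_sq θ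
    rw [mem_image_rig, mem_unitSq]
    have e1 : (rigInv θ (v α β) p).1 = Real.cos θ * p.1 + Real.sin θ * p.2 - α := by
      simp only [rigInv, v]; linear_combination -α * h
    have e2 : (rigInv θ (v α β) p).2 = -Real.sin θ * p.1 + Real.cos θ * p.2 - β := by
      simp only [rigInv, v]; linear_combination -β * h
    rw [e1, e2, sub_pos, sub_pos, sub_lt_iff_lt_add', sub_lt_iff_lt_add']
  obtain ⟨T1, S1, r1, ro1, m1⟩ := snip1_rig hT isOpen_unitSq S S₂ θ (v (σ₀ - 1) β₀)
  obtain ⟨T2, S2, r2, ro2, m2⟩ := snip1_rig ro1 isOpen_unitSq S1 S₂ θ (v σ₀ β₀)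
  obtain ⟨T3, S3, r3, ro3, m3⟩ := snip1_rig ro2 isOpen_unitSq S2 S₂ θ (v (σ₀ - 1) (β₀ + 1))
  obtain ⟨T4, S4, r4, ro4, m4⟩ := snip1_rig ro3 isOpen_unitSq S3 S₂ θ (v σ₀ (β₀ + 1))
  refine ⟨T4, S4, ((r1.trans r2).trans r3).trans r4, ro4, ?_⟩
  have hsc := Real.sin_sq_add_cos_sq θ
  have g1 := residual_line_ne (a := Real.cos θ) (b := Real.sin θ) (-σ₀) (by
    by_contra! h; rw [h.1, h.2] at hsc; norm_num at hsc)
  have g2 := residual_line_ne (a := -Real.sin θ) (b := Real.cos θ) (-(β₀ + 1)) (by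
    by_contra! h; rw [neg_eq_zero] at h; rw [h.1, h.2] at hsc; norm_num at hsc)
  have g3 := residual_ev_ne hl
  filter_upwards [hTW, m1, m2, m3, m4, g1, g2, g3] with p hTW m1 m2 m3 m4 g1 g2 g3
  rw [m4, Set.mem_sdiff, m3, Set.mem_sdiff, m2, Set.mem_sdiff, m1, Set.mem_sdiff, hTW, hv, hv, hv,
    hv, Set.mem_inter_iff, Set.mem_ofPred_eq]
  have hev : l.ev p = r * (τ - (-Real.sin θ * p.1 + Real.cos θ * p.2)) := by
    rw [Ln.ev, ha, hb, hτ]; ring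
  rw [hev, mul_pos_iff_of_pos_left hr]
  rw [hev] at g3
  have g3' := right_ne_zero_of_mul g3
  have hb1 : τ ≤ β₀ := le_max_left _ _
  have hb2 : τ₀ - 1 ≤ β₀ := le_max_right _ _
  have hb3 : β₀ = τ ∨ β₀ = τ₀ - 1 := max_choice _ _
  by_cases hpW : p ∈ W
  swap
  · simp [hpW]
  obtain ⟨⟨u1, u2⟩, u3, u4⟩ := mem_unitSq.1 (hW hpW)
  have hx : |p.1 - 1 / 2| < 1 / 2 := by rw [abs_lt]; constructor <;> linarith
  have hy : |p.2 - 1 / 2| < 1 / 2 := by rw [abs_lt]; constructor <;> linarith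
  have b1 := abs_lt.1 (abs_rot_lt θ hx hy)
  have b2 := abs_lt.1 (abs_rot_lt θ hy (by rwa [abs_neg] : |-(p.1 - 1 / 2)| < 1 / 2))
  generalize hσp : Real.cos θ * p.1 + Real.sin θ * p.2 = σ at *
  generalize hτp : -Real.sin θ * p.1 + Real.cos θ * p.2 = t at *
  have c1 : σ - σ₀ < 1 := by rw [hσ, ← hσp]; linarith [b1.2]
  have c2 : -1 < σ - σ₀ := by rw [hσ, ← hσp]; linarith [b1.1]
  have c3 : t - τ₀ < 1 := by rw [hτ₀, ← hτp]; linarith [b2.2]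
  have c4 : -1 < t - τ₀ := by rw [hτ₀, ← hτp]; linarith [b2.1]
  have g1' : σ ≠ σ₀ := fun h => g1 (by linarith)
  have g2' : t ≠ β₀ + 1 := fun h => g2 (by linarith)
  simp only [hpW, true_and]
  constructor
  · rintro ⟨⟨⟨n1, n2⟩, n3⟩, n4⟩
    by_contra hneg
    have ht : τ < t := lt_of_le_of_ne (by linarith) (fun h => g3' (by linarith))
    have ht' : β₀ < t := by rcases hb3 with h | h <;> linarith
    rcases lt_or_gt_of_ne g1' with h1 | h1 <;> rcases lt_or_gt_of_ne g2' with h2 | h2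
    · exact n1 ⟨⟨by linarith, by linarith⟩, by linarith, by linarith⟩
    · exact n3 ⟨⟨by linarith, by linarith⟩, by linarith, by linarith⟩
    · exact n2 ⟨⟨by linarith, by linarith⟩, by linarith, by linarith⟩
    · exact n4 ⟨⟨by linarith, by linarith⟩, by linarith, by linarith⟩
  · intro h
    refine ⟨⟨⟨?_, ?_⟩, ?_⟩, ?_⟩ <;> (intro hh; linarith [hh.2.1])

theorem clip1 {L : List Ln} (hL : ∀ l ∈ L, l.Nondeg) {T W : Set Plane} (hT : RegOpen T)
    (hTW : Meq T W) (hW : W ⊆ UnitSq) (S S₂) :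
    ∃ T' S', DUReach 1 (4 * L.length) ⟨T, S, UnitSq, S₂⟩ ⟨T', S', UnitSq, S₂⟩ ∧
      RegOpen T' ∧ Meq T' (W ∩ PolyCell L) := by
  induction L generalizing T W S with
  | nil => exact ⟨T, S, .refl _, hT, by simpa [PolyCell] using hTW⟩
  | cons l L ih =>
    obtain ⟨T1, S1, r1, ro1, m1⟩ := clip_line (hL l (by simp)) hT hTW hW S S₂
    obtain ⟨T2, S2, r2, ro2, m2⟩ := ih (fun l' h => hL l' (by simp [h])) ro1 m1
      (Set.inter_subset_left.trans hW) S1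
    refine ⟨T2, S2, ?_, ro2, m2.trans ?_⟩
    · have := r1.trans r2
      rwa [List.length_cons, mul_add, mul_one, add_comm]
    · refine Filter.Eventually.of_forall fun p => ?_
      simp [PolyCell, and_assoc]

theorem clip2 {L : List Ln} (hL : ∀ l ∈ L, l.Nondeg) {T W : Set Plane} (hT : RegOpen T)
    (hTW : Meq T W) (hW : W ⊆ UnitSq) (S S₁) :
    ∃ T' S', DUReach 1 (4 * L.length) ⟨UnitSq, S₁, T, S⟩ ⟨UnitSq, S₁, T', S'⟩ ∧
      RegOpen T' ∧ Meq T' (W ∩ PolyCell L) := by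
  obtain ⟨T', S', r, h⟩ := clip1 hL hT hTW hW S S₁
  exact ⟨T', S', r.swap, h⟩

theorem snip2_rig {T T₁ : Set Plane} (hT : RegOpen T) (hT₁ : IsOpen T₁) (S S₁) (θ : ℝ)
    (v : Plane) : ∃ T' S', DUReach 1 1 ⟨T₁, S₁, T, S⟩ ⟨T₁, S₁, T', S'⟩ ∧ RegOpen T' ∧
      Meq T' (T \ rig θ v '' T₁) := by
  obtain ⟨T', S', r, h⟩ := snip1_rig hT hT₁ S S₁ θ v
  exact ⟨T', S', r.swap, h⟩

/-! ### Constant-cost operations on a single set -/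

/-- From any configuration whose first tool is `W` up to a meagre set, at most `m` operations
make the first tool equal to `W'` up to a meagre set. -/
def WReach (m : ℕ) (W W' : Set Plane) : Prop :=
  ∀ c : UConfig, RegOpen c.T₁ → Meq c.T₁ W →
    ∃ s ≤ m, ∃ c' : UConfig, DUReach 1 s c c' ∧ RegOpen c'.T₁ ∧ Meq c'.T₁ W'

theorem WReach.refl (W : Set Plane) : WReach 0 W W :=
  fun c h h' => ⟨0, le_rfl, c, .refl c, h, h'⟩

theorem WReach.trans {m n : ℕ} {W W' W'' : Set Plane} (h : WReach m W W')
    (h' : WReach n W' W'') : WReach (m + n) W W'' := by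
  intro c hc hW
  obtain ⟨s, hs, c', r, hc', hW'⟩ := h c hc hW
  obtain ⟨t, ht, c'', r', hc'', hW''⟩ := h' c' hc' hW'
  exact ⟨s + t, by omega, c'', r.trans r', hc'', hW''⟩

theorem WReach.mono {m n : ℕ} {W W' : Set Plane} (h : WReach m W W') (hmn : m ≤ n) :
    WReach n W W' := by
  intro c hc hW
  obtain ⟨s, hs, h⟩ := h c hc hW
  exact ⟨s, hs.trans hmn, h⟩

theorem WReach.congr {m : ℕ} {W W' W'' : Set Plane} (h : WReach m W W') (he : Meq W' W'') :
    WReach m W W'' := by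
  intro c hc hW
  obtain ⟨s, hs, c', r, hc', hW'⟩ := h c hc hW
  exact ⟨s, hs, c', r, hc', hW'.trans he⟩

theorem mem_image_trans {v p : Plane} {S : Set Plane} : p ∈ rig 0 v '' S ↔ p - v ∈ S := by
  rw [mem_image_rig]
  have : rigInv 0 v p = p - v := by ext <;> simp [rigInv]
  rw [this]

theorem residual_sub {Q : Plane → Prop} (h : ∀ᶠ p in residual Plane, Q p) (v : Plane) :
    ∀ᶠ p in residual Plane, Q (p - v) := by
  have := residual_comp_homeo (Homeomorph.addRight (-v)) h
  simpa [sub_eq_add_neg] using this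

theorem reach_reset1 (T S T₂ S₂) : DUReach 1 1 ⟨T, S, T₂, S₂⟩ ⟨UnitSq, [T], T₂, S₂⟩ :=
  (DUStep.reset1 ⟨T, S, T₂, S₂⟩).reach

theorem reach_reset2 (T S T₂ S₂) : DUReach 1 1 ⟨T, S, T₂, S₂⟩ ⟨T, S, UnitSq, [T₂]⟩ :=
  (DUStep.reset2 ⟨T, S, T₂, S₂⟩).reach

theorem reach_undo1 (T P T₂ S₂) : DUReach 1 1 ⟨T, [P], T₂, S₂⟩ ⟨P, [], T₂, S₂⟩ :=
  (DUStep.undo1 P [] T₂ S₂ T).reach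

theorem reach_undo2 (T S T₂ P) : DUReach 1 1 ⟨T, S, T₂, [P]⟩ ⟨T, S, P, []⟩ :=
  (DUStep.undo2 P [] T S T₂).reach

theorem wreach_diff_poly {W : Set Plane} {L : List Ln} (hL : ∀ l ∈ L, l.Nondeg)
    (hW : W ⊆ UnitSq) : WReach (4 * L.length + 4) W (W \ PolyCell L) := by
  rintro ⟨T, S, T₂, S₂⟩ (hT : RegOpen T) (hTW : Meq T W)
  obtain ⟨T2, S2, r, ro, m⟩ := clip2 hL regOpen_unitSq (.refl _) subset_rfl [T₂] [T]
  obtain ⟨T3, S3, r', ro', m'⟩ := snip1_rig hT ro.isOpen [] S2 0 0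
  refine ⟨_, ?_, _, (reach_reset2 T S T₂ S₂).trans <| (reach_reset1 _ _ _ _).trans <|
    r.trans <| (reach_undo1 _ _ _ _).trans r', ro', ?_⟩
  · omega
  · filter_upwards [m', m, hTW] with p m' m hTW
    rw [m', Set.mem_sdiff, mem_image_trans, sub_zero, m, hTW]
    have := @hW p
    simp only [Set.mem_inter_iff, Set.mem_sdiff]
    grind

theorem wreach_union_poly {W : Set Plane} {L : List Ln} (hL : ∀ l ∈ L, l.Nondeg)
    (hW : W ⊆ UnitSq) : WReach (4 * L.length + 8) W (W ∪ UnitSq ∩ PolyCell L) := by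
  rintro ⟨T, S, T₂, S₂⟩ (hT : RegOpen T) (hTW : Meq T W)
  obtain ⟨V, S2, r2, ro2, m2⟩ := snip2_rig regOpen_unitSq hT.isOpen [T₂] S 0 0
  obtain ⟨T3, S3, r3, ro3, m3⟩ := clip1 hL regOpen_unitSq (.refl _) subset_rfl [T] [V]
  obtain ⟨T4, S4, r4, ro4, m4⟩ := snip2_rig ro2 ro3.isOpen [] S3 0 0
  obtain ⟨T5, S5, r5, ro5, m5⟩ := snip1_rig regOpen_unitSq ro4.isOpen [T3] S4 0 0
  refine ⟨_, ?_, _, (reach_reset2 T S T₂ S₂).trans <| r2.trans <| (reach_reset2 _ _ _ _).trans <|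
    (reach_reset1 _ _ _ _).trans <| r3.trans <| (reach_undo2 _ _ _ _).trans <| r4.trans <|
    (reach_reset1 _ _ _ _).trans r5, ro5, ?_⟩
  · omega
  · filter_upwards [m2, m3, m4, m5, hTW] with p m2 m3 m4 m5 hTW
    rw [m5, Set.mem_sdiff, mem_image_trans, sub_zero, m4, Set.mem_sdiff, mem_image_trans, sub_zero,
      m2, m3, Set.mem_sdiff, mem_image_trans, sub_zero, hTW]
    have := @hW p
    simp only [Set.mem_inter_iff, Set.mem_union]
    grind

theorem wreach_union_shift {W : Set Plane} {L : List Ln} (hL : ∀ l ∈ L, l.Nondeg)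
    (hW : W ⊆ UnitSq) (v : Plane) :
    WReach (4 * L.length + 7) W (W ∪ {p | p ∈ UnitSq ∧ p - v ∈ W ∧ p - v ∈ PolyCell L}) := by
  rintro ⟨T, S, T₂, S₂⟩ (hT : RegOpen T) (hTW : Meq T W)
  obtain ⟨V, S2, r2, ro2, m2⟩ := snip2_rig regOpen_unitSq hT.isOpen [T₂] S 0 0
  obtain ⟨T3, S3, r3, ro3, m3⟩ := clip1 hL hT hTW hW S [V]
  obtain ⟨T4, S4, r4, ro4, m4⟩ := snip2_rig ro2 ro3.isOpen [] S3 0 v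
  obtain ⟨T5, S5, r5, ro5, m5⟩ := snip1_rig regOpen_unitSq ro4.isOpen [T3] S4 0 0
  refine ⟨_, ?_, _, (reach_reset2 T S T₂ S₂).trans <| r2.trans <| (reach_reset2 _ _ _ _).trans <|
    r3.trans <| (reach_undo2 _ _ _ _).trans <| r4.trans <|
    (reach_reset1 _ _ _ _).trans r5, ro5, ?_⟩
  · omega
  · filter_upwards [m2, residual_sub m3 v, m4, m5, hTW] with p m2 m3 m4 m5 hTW
    rw [m5, Set.mem_sdiff, mem_image_trans, sub_zero, m4, Set.mem_sdiff, mem_image_trans,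
      m2, m3, Set.mem_sdiff, mem_image_trans, sub_zero, hTW]
    have := @hW p
    change _ ↔ p ∈ W ∨ (p ∈ UnitSq ∧ p - v ∈ W ∧ p - v ∈ PolyCell L)
    simp only [Set.mem_inter_iff]
    grind

theorem wreach_diff_shift {W : Set Plane} {L : List Ln} (hL : ∀ l ∈ L, l.Nondeg)
    (v : Plane) : WReach (4 * L.length + 5) W
      (W \ {p | p - v ∈ UnitSq ∧ p - v ∈ PolyCell L ∧ p - v ∉ W}) := by
  rintro ⟨T, S, T₂, S₂⟩ (hT : RegOpen T) (hTW : Meq T W)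
  obtain ⟨V, S2, r2, ro2, m2⟩ := snip2_rig regOpen_unitSq hT.isOpen [T₂] S 0 0
  obtain ⟨T3, S3, r3, ro3, m3⟩ := clip2 hL ro2 m2 Set.sdiff_subset S2 [T]
  obtain ⟨T4, S4, r4, ro4, m4⟩ := snip1_rig hT ro3.isOpen [] S3 0 v
  refine ⟨_, ?_, _, (reach_reset2 T S T₂ S₂).trans <| r2.trans <| (reach_reset1 _ _ _ _).trans <|
    r3.trans <| (reach_undo1 _ _ _ _).trans r4, ro4, ?_⟩
  · omega
  · filter_upwards [residual_sub m3 v, m4, hTW, residual_sub hTW v] with p m3 m4 hTW hTW'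
    rw [m4, Set.mem_sdiff, mem_image_trans, m3, hTW]
    change _ ↔ p ∈ W ∧ ¬ (p - v ∈ UnitSq ∧ p - v ∈ PolyCell L ∧ p - v ∉ W)
    simp only [Set.mem_inter_iff, Set.mem_sdiff, mem_image_trans, sub_zero, hTW']
    grind

/-! ### Registers stored in a scratch square -/

/-- Translation of an oriented line. -/
def Ln.shift (l : Ln) (o : Plane) : Ln := (l.1, l.2.1, l.2.2 - l.1 * o.1 - l.2.1 * o.2)

theorem Ln.ev_shift (l : Ln) (o p : Plane) : (l.shift o).ev p = l.ev (p - o) := by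
  simp only [Ln.ev, Ln.shift, Prod.fst_sub, Prod.snd_sub]; ring

theorem mem_polyCell {L : List Ln} {p : Plane} : p ∈ PolyCell L ↔ ∀ l ∈ L, 0 < l.ev p := Iff.rfl

theorem mem_polyCell_shift {L : List Ln} {o p : Plane} :
    p ∈ PolyCell (L.map fun l => l.shift o) ↔ p - o ∈ PolyCell L := by
  simp only [mem_polyCell, List.forall_mem_map, Ln.ev_shift]

theorem mem_polyCell_append {L L' : List Ln} {p : Plane} :
    p ∈ PolyCell (L ++ L') ↔ p ∈ PolyCell L ∧ p ∈ PolyCell L' := by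
  simp only [mem_polyCell, List.mem_append]
  exact ⟨fun h => ⟨fun l hl => h l (Or.inl hl), fun l hl => h l (Or.inr hl)⟩,
    fun h l hl => hl.elim (h.1 l) (h.2 l)⟩

theorem nondeg_shift {L : List Ln} (hL : ∀ l ∈ L, l.Nondeg) (o : Plane) :
    ∀ l ∈ L.map fun l => l.shift o, l.Nondeg := by
  intro l hl
  obtain ⟨l', h, rfl⟩ := List.mem_map.1 hl
  exact hL l' h

/-- The four sides of an axis-parallel rectangle. -/
def rectLines (x₀ x₁ y₀ y₁ : ℝ) : List Ln :=
  [(1, 0, -x₀), (-1, 0, x₁), (0, 1, -y₀), (0, -1, y₁)]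

theorem nondeg_rectLines (x₀ x₁ y₀ y₁ : ℝ) : ∀ l ∈ rectLines x₀ x₁ y₀ y₁, l.Nondeg := by
  simp [rectLines, Ln.Nondeg]

theorem mem_rectLines {x₀ x₁ y₀ y₁ : ℝ} {p : Plane} :
    p ∈ PolyCell (rectLines x₀ x₁ y₀ y₁) ↔ (x₀ < p.1 ∧ p.1 < x₁) ∧ y₀ < p.2 ∧ p.2 < y₁ := by
  simp [mem_polyCell, rectLines, Ln.ev, and_assoc]

/-- A piece of side `s` with lower left corner `(px, py)` and a scratch square of side `16 s`
with lower left corner `(rx, ry)`. -/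
structure Layout where
  px : ℝ
  py : ℝ
  s : ℝ
  rx : ℝ
  ry : ℝ
  s_pos : 0 < s

namespace Layout

variable (D : Layout)

/-- The piece. -/
def piece : Set Plane := PolyCell (rectLines D.px (D.px + D.s) D.py (D.py + D.s))

/-- The piece together with its left and right neighbours. -/
def box : Set Plane := PolyCell (rectLines (D.px - D.s) (D.px + 2 * D.s) D.py (D.py + D.s))

/-- The scratch square. -/
def scratch : Set Plane := PolyCell (rectLines D.rx (D.rx + 16 * D.s) D.ry (D.ry + 16 * D.s))

/-- The layout lies in the unit square and its two squares are disjoint. -/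
structure Fits : Prop where
  piece_sub : D.piece ⊆ UnitSq
  scratch_sub : D.scratch ⊆ UnitSq
  disj : ∀ p ∈ D.piece, p ∉ D.scratch

/-- The row holding the literal `(a, α)`. -/
def row (a : Fin 8) (α : Bool) : ℕ := 2 * a + α.toNat

/-- The translation carrying the box to the cell of the literal `(a, α)`. -/
def off (a : Fin 8) (α : Bool) : Plane :=
  (D.rx + D.s - D.px, D.ry + row a α * D.s - D.py)

theorem row_lt (a : Fin 8) (α : Bool) : row a α + 1 ≤ 16 := by
  have := a.2
  cases α <;> simp [row] <;> omega

theorem row_inj {a b : Fin 8} {α β : Bool} (h : row a α = row b β) : a = b ∧ α = β := by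
  cases α <;> cases β <;> simp [row] at h ⊢ <;> omega

variable {D}

theorem mem_box {p : Plane} : p ∈ D.box ↔
    (D.px - D.s < p.1 ∧ p.1 < D.px + 2 * D.s) ∧ D.py < p.2 ∧ p.2 < D.py + D.s := mem_rectLines

theorem mem_piece {p : Plane} : p ∈ D.piece ↔
    (D.px < p.1 ∧ p.1 < D.px + D.s) ∧ D.py < p.2 ∧ p.2 < D.py + D.s := mem_rectLines

theorem mem_scratch {p : Plane} : p ∈ D.scratch ↔
    (D.rx < p.1 ∧ p.1 < D.rx + 16 * D.s) ∧ D.ry < p.2 ∧ p.2 < D.ry + 16 * D.s := mem_rectLines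

theorem piece_subset_box : D.piece ⊆ D.box := by
  intro p hp
  have := D.s_pos
  rw [mem_piece] at hp
  rw [mem_box]
  exact ⟨⟨by linarith [hp.1.1], by linarith [hp.1.2]⟩, hp.2⟩

theorem add_off_mem {x : Plane} (hx : x ∈ D.box) (a : Fin 8) (α : Bool) :
    x + D.off a α ∈ D.scratch := by
  have hs := D.s_pos
  rw [mem_box] at hx
  obtain ⟨⟨h1, h2⟩, h3, h4⟩ := hx
  have hr : (row a α : ℝ) + 1 ≤ 16 := by exact_mod_cast row_lt a α
  have hr0 : (0 : ℝ) ≤ row a α := by positivity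
  rw [mem_scratch]
  simp only [off, Prod.fst_add, Prod.snd_add]
  refine ⟨⟨by linarith, by linarith⟩, by nlinarith, by nlinarith⟩

theorem add_off_inj {x y : Plane} (hx : x ∈ D.box) (hy : y ∈ D.box) {a b : Fin 8} {α β : Bool}
    (h : x + D.off a α = y + D.off b β) : a = b ∧ α = β ∧ x = y := by
  have hs := D.s_pos
  have h2 := congrArg Prod.snd h
  simp only [off, Prod.snd_add] at h2
  rw [mem_box] at hx hy
  have hrow : row a α = row b β := by
    have hlt : ∀ m n : ℕ, m < n → (m : ℝ) * D.s + D.s ≤ n * D.s := by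
      intro m n hmn
      have : (m : ℝ) + 1 ≤ n := by exact_mod_cast hmn
      nlinarith
    rcases lt_trichotomy (row a α) (row b β) with hl | hl | hl
    · linarith [hlt _ _ hl, hx.2.2, hy.2.1]
    · exact hl
    · linarith [hlt _ _ hl, hy.2.2, hx.2.1]
  obtain ⟨rfl, rfl⟩ := row_inj hrow
  exact ⟨rfl, rfl, add_right_cancel h⟩

variable (D)

/-- The set `W` stores the registers `ρ` in dual-rail form in the scratch square. -/
def Enc (W : Set Plane) (ρ : Fin 8 → Set Plane) : Prop :=
  ∀ a α, ∀ x ∈ D.box, (x + D.off a α ∈ W ↔ (x ∈ ρ a ↔ α = true))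

/-- The registers `ρ` can be turned into `ρ'` by `m` register operations. -/
def RReach (m : ℕ) (ρ ρ' : Fin 8 → Set Plane) : Prop :=
  ∀ W : Set Plane, W ⊆ UnitSq → D.Enc W ρ → ∃ W', W' ⊆ UnitSq ∧ D.Enc W' ρ' ∧
    (∀ x ∉ D.scratch, (x ∈ W' ↔ x ∈ W)) ∧ WReach (100 * m) W W'

variable {D}

theorem RReach.refl (ρ) : D.RReach 0 ρ ρ :=
  fun W h h' => ⟨W, h, h', fun _ _ => Iff.rfl, .refl W⟩

theorem RReach.trans {m n : ℕ} {ρ ρ' ρ''} (h : D.RReach m ρ ρ') (h' : D.RReach n ρ' ρ'') :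
    D.RReach (m + n) ρ ρ'' := by
  intro W hW hE
  obtain ⟨W1, hW1, hE1, ho1, hr1⟩ := h W hW hE
  obtain ⟨W2, hW2, hE2, ho2, hr2⟩ := h' W1 hW1 hE1
  exact ⟨W2, hW2, hE2, fun x hx => (ho2 x hx).trans (ho1 x hx), by
    rw [mul_add]; exact hr1.trans hr2⟩

theorem RReach.mono {m n : ℕ} {ρ ρ'} (h : D.RReach m ρ ρ') (hmn : m ≤ n) : D.RReach n ρ ρ' := by
  intro W hW hE
  obtain ⟨W1, hW1, hE1, ho1, hr1⟩ := h W hW hE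
  exact ⟨W1, hW1, hE1, ho1, hr1.mono (by omega)⟩

/-- Add the set `S` to the literal with sign `α` of the set `R`. -/
def litAdd (α : Bool) (R S : Set Plane) : Set Plane := if α then R ∪ S else R \ S

/-- The lines of the cell of a literal. -/
def cellLines (D : Layout) (o : Plane) : List Ln :=
  (rectLines (D.px - D.s) (D.px + 2 * D.s) D.py (D.py + D.s)).map fun l => l.shift o

theorem mem_cellLines {o p : Plane} : p ∈ PolyCell (D.cellLines o) ↔ p - o ∈ D.box :=
  mem_polyCell_shift

theorem nondeg_cellLines (o : Plane) : ∀ l ∈ D.cellLines o, l.Nondeg :=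
  nondeg_shift (nondeg_rectLines _ _ _ _) o

theorem length_cellLines (o : Plane) : (D.cellLines o).length = 4 := by simp [cellLines, rectLines]

/-- Combine an update of the two rails of a literal into a register operation. -/
theorem rreach_of_rails {a : Fin 8} {α : Bool} {ρ : Fin 8 → Set Plane} {S : Set Plane} {m n : ℕ}
    (hmn : m + n ≤ 100)
    (h : ∀ W : Set Plane, W ⊆ UnitSq → D.Enc W ρ → ∃ W₁ W₂, W₁ ⊆ UnitSq ∧ W₂ ⊆ UnitSq ∧
      WReach m W W₁ ∧ WReach n W₁ W₂ ∧
      (∀ p, (p ∈ W₁ ↔ p ∈ W ∨ (p - D.off a α ∈ D.box ∧ p - D.off a α ∈ S))) ∧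
      ∀ p, (p ∈ W₂ ↔ p ∈ W₁ ∧ ¬ (p - D.off a (!α) ∈ D.box ∧ p - D.off a (!α) ∈ S))) :
    D.RReach 1 ρ (Function.update ρ a (litAdd α (ρ a) S)) := by
  intro W hW hE
  obtain ⟨W₁, W₂, h1, h2, r1, r2, e1, e2⟩ := h W hW hE
  refine ⟨W₂, h2, ?_, ?_, (r1.trans r2).mono (by omega)⟩
  · intro b β x hx
    rw [e2, e1, hE b β x hx]
    have key : ∀ γ, (x + D.off b β - D.off a γ ∈ D.box ∧ x + D.off b β - D.off a γ ∈ S) ↔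
        (b = a ∧ β = γ ∧ x ∈ S) := by
      intro γ
      constructor
      · rintro ⟨k1, k2⟩
        obtain ⟨k3, k4, k5⟩ := add_off_inj hx k1
          (show x + D.off b β = (x + D.off b β - D.off a γ) + D.off a γ by abel)
        exact ⟨k3, k4, by rw [← k5] at k2; exact k2⟩
      · rintro ⟨rfl, rfl, k⟩
        rw [add_sub_cancel_right]
        exact ⟨hx, k⟩
    rw [key, key]
    by_cases hba : b = a
    · subst hba
      simp only [Function.update_self, litAdd]
      cases α <;> cases β <;> (simp; try tauto)
    · simp [hba]
  · intro x hx
    have key : ∀ γ, x - D.off a γ ∉ D.box := by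
      intro γ hb
      have := add_off_mem hb a γ
      rw [sub_add_cancel] at this
      exact hx this
    rw [e2, e1]
    simp [key]

theorem rreach_const (hD : D.Fits) (ρ : Fin 8 → Set Plane) (a : Fin 8) (α : Bool) {L : List Ln}
    (hL : ∀ l ∈ L, l.Nondeg) (hlen : L.length ≤ 6) :
    D.RReach 1 ρ (Function.update ρ a (litAdd α (ρ a) (PolyCell L))) := by
  refine rreach_of_rails (m := 48) (n := 44) (by norm_num) fun W hW _ => ?_
  let M : Bool → List Ln := fun γ => D.cellLines (D.off a γ) ++ L.map fun l => l.shift (D.off a γ)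
  have hM : ∀ γ, ∀ l ∈ M γ, l.Nondeg := fun γ l hl =>
    (List.mem_append.1 hl).elim (nondeg_cellLines _ l) (nondeg_shift hL _ l)
  have hMl : ∀ γ, (M γ).length ≤ 10 := by
    intro γ
    simp only [M, List.length_append, length_cellLines, List.length_map]
    omega
  have hmem : ∀ γ p, p ∈ PolyCell (M γ) ↔ (p - D.off a γ ∈ D.box ∧ p - D.off a γ ∈ PolyCell L) := by
    intro γ p
    rw [mem_polyCell_append, mem_cellLines, mem_polyCell_shift]
  have h1 : W ∪ UnitSq ∩ PolyCell (M α) ⊆ UnitSq :=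
    Set.union_subset hW Set.inter_subset_left
  refine ⟨_, _, h1, Set.sdiff_subset.trans h1,
    (wreach_union_poly (hM α) hW).mono (by have := hMl α; omega),
    (wreach_diff_poly (hM (!α)) h1).mono (by have := hMl (!α); omega), fun p => ?_, fun p => ?_⟩
  · rw [Set.mem_union, Set.mem_inter_iff, hmem]
    refine or_congr_right ⟨And.right, fun h => ⟨?_, h⟩⟩
    have := hD.scratch_sub (add_off_mem h.1 a α)
    rwa [sub_add_cancel] at this
  · rw [Set.mem_sdiff, hmem]

theorem rreach_copy (hD : D.Fits) (ρ : Fin 8 → Set Plane) (a : Fin 8) (α : Bool) (b : Fin 8)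
    (β : Bool) (v : Plane) (hab : a ≠ b ∨ α = β) :
    D.RReach 1 ρ (Function.update ρ a
      (litAdd α (ρ a) {x | x - v ∈ D.box ∧ (x - v ∈ ρ b ↔ β = true)})) := by
  refine rreach_of_rails (m := 39) (n := 37) (by norm_num) fun W hW hE => ?_
  let d : Bool → Bool → Plane := fun γ δ => v + D.off a γ - D.off b δ
  let M : Bool → Bool → List Ln := fun γ δ =>
    D.cellLines (D.off b δ) ++ D.cellLines (D.off a γ - d γ δ)
  have hM : ∀ γ δ, ∀ l ∈ M γ δ, l.Nondeg := fun γ δ l hl =>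
    (List.mem_append.1 hl).elim (nondeg_cellLines _ l) (nondeg_cellLines _ l)
  have hMl : ∀ γ δ, (M γ δ).length = 8 := by
    intro γ δ
    simp only [M, List.length_append, length_cellLines]
  have hmem : ∀ γ δ p, p - d γ δ ∈ PolyCell (M γ δ) ↔
      (p - D.off a γ - v ∈ D.box ∧ p - D.off a γ ∈ D.box) := by
    intro γ δ p
    rw [mem_polyCell_append, mem_cellLines, mem_cellLines]
    have e1 : p - d γ δ - D.off b δ = p - D.off a γ - v := by simp only [d]; abel
    have e2 : p - d γ δ - (D.off a γ - d γ δ) = p - D.off a γ := by abel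
    rw [e1, e2]
  have hd : ∀ γ δ p, p - d γ δ = (p - D.off a γ - v) + D.off b δ := by
    intro γ δ p; simp only [d]; abel
  have h1 : W ∪ {p | p ∈ UnitSq ∧ p - d α β ∈ W ∧ p - d α β ∈ PolyCell (M α β)} ⊆ UnitSq :=
    Set.union_subset hW fun p hp => hp.1
  have hmemW : ∀ p, p ∈ W ∪ {p | p ∈ UnitSq ∧ p - d α β ∈ W ∧ p - d α β ∈ PolyCell (M α β)} ↔
      p ∈ W ∨ (p - D.off a α ∈ D.box ∧
        p - D.off a α ∈ {x | x - v ∈ D.box ∧ (x - v ∈ ρ b ↔ β = true)}) := by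
    intro p
    refine or_congr_right ?_
    change (p ∈ UnitSq ∧ p - d α β ∈ W ∧ p - d α β ∈ PolyCell (M α β)) ↔
      (_ ∧ (p - D.off a α - v ∈ D.box ∧ (p - D.off a α - v ∈ ρ b ↔ β = true)))
    rw [hmem, hd]
    constructor
    · rintro ⟨-, k1, k2, k3⟩
      exact ⟨k3, k2, (hE b β _ k2).1 k1⟩
    · rintro ⟨k1, k2, k3⟩
      refine ⟨?_, (hE b β _ k2).2 k3, k2, k1⟩
      have := hD.scratch_sub (add_off_mem k1 a α)
      rwa [sub_add_cancel] at this
  refine ⟨_, _, h1, Set.sdiff_subset.trans h1,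
    (wreach_union_shift (hM α β) hW (d α β)).mono (by rw [hMl]),
    (wreach_diff_shift (hM (!α) (!β)) (d (!α) (!β))).mono (by rw [hMl]), hmemW, fun p => ?_⟩
  refine and_congr_right fun _ => not_congr ?_
  change (p - d (!α) (!β) ∈ UnitSq ∧ p - d (!α) (!β) ∈ PolyCell (M (!α) (!β)) ∧
    p - d (!α) (!β) ∉ _) ↔
      (_ ∧ (p - D.off a (!α) - v ∈ D.box ∧ (p - D.off a (!α) - v ∈ ρ b ↔ β = true)))
  rw [hmem, hd, hmemW]
  set y := p - D.off a (!α) - v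
  have hnot : y ∈ D.box → ¬ (y + D.off b (!β) - D.off a α ∈ D.box) := by
    intro hy hh
    obtain ⟨k1, k2, -⟩ := add_off_inj hy hh
      (show y + D.off b (!β) = (y + D.off b (!β) - D.off a α) + D.off a α by abel)
    rcases hab with h | h
    · exact h k1.symm
    · subst h; cases α <;> simp at k2
  constructor
  · rintro ⟨-, ⟨k1, k2⟩, k3⟩
    refine ⟨k2, k1, ?_⟩
    rw [not_or, hE b (!β) y k1] at k3
    have := k3.1
    cases β <;> simpa using this
  · rintro ⟨k1, k2, k3⟩
    refine ⟨hD.scratch_sub (add_off_mem k2 _ _), ⟨k2, k1⟩, ?_⟩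
    rw [not_or, hE b (!β) y k2]
    refine ⟨?_, fun h => hnot k2 h.1⟩
    cases β <;> simpa using k3

theorem exists_enc_empty (hD : D.Fits) {W : Set Plane} (hW : W ⊆ UnitSq) :
    ∃ W', W' ⊆ UnitSq ∧ D.Enc W' (fun _ => ∅) ∧ (∀ x ∉ D.scratch, (x ∈ W' ↔ x ∈ W)) ∧
      WReach 212 W W' := by
  have fill : ∀ l : List (Fin 8), ∀ V : Set Plane, V ⊆ UnitSq → WReach (24 * l.length) V
      (V ∪ {p | ∃ a ∈ l, p - D.off a false ∈ D.box}) := by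
    intro l
    induction l with
    | nil => intro V _; simpa using WReach.refl V
    | cons a l ih =>
      intro V hV
      have h1 := wreach_union_poly (nondeg_cellLines (D := D) (D.off a false)) hV
      have h2 := ih _ (Set.union_subset hV
        (Set.inter_subset_left (t := PolyCell (D.cellLines (D.off a false)))))
      refine ((h1.trans h2).mono ?_).congr (Filter.Eventually.of_forall fun p => ?_)
      · rw [length_cellLines, List.length_cons]; omega
      · have hU : p - D.off a false ∈ D.box → p ∈ UnitSq := fun h => by
          have := hD.scratch_sub (add_off_mem h a false)
          rwa [sub_add_cancel] at this
        change ((p ∈ V ∨ (p ∈ UnitSq ∧ p ∈ PolyCell (D.cellLines (D.off a false)))) ∨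
          ∃ a ∈ l, p - D.off a false ∈ D.box) ↔
          (p ∈ V ∨ ∃ b ∈ a :: l, p - D.off b false ∈ D.box)
        rw [mem_cellLines]
        simp only [List.mem_cons, exists_eq_or_imp]
        tauto
  have h1 := wreach_diff_poly (nondeg_rectLines D.rx (D.rx + 16 * D.s) D.ry (D.ry + 16 * D.s)) hW
  have h2 := fill (List.finRange 8) _ ((Set.sdiff_subset (t := D.scratch)).trans hW)
  have hmem : ∀ p, p ∈ W \ D.scratch ∪ {p | ∃ a ∈ List.finRange 8, p - D.off a false ∈ D.box} ↔
      (p ∈ W ∧ p ∉ D.scratch) ∨ ∃ a, p - D.off a false ∈ D.box := by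
    intro p
    simp [List.mem_finRange]
  have hsc : ∀ p a, p - D.off a false ∈ D.box → p ∈ D.scratch := fun p a h => by
    have := add_off_mem h a false
    rwa [sub_add_cancel] at this
  refine ⟨_, ?_, ?_, ?_, (h1.trans h2).mono ?_⟩
  · intro p hp
    rcases (hmem p).1 hp with h | ⟨a, h⟩
    · exact hW h.1
    · exact hD.scratch_sub (hsc p a h)
  · intro a α x hx
    rw [hmem]
    have : x + D.off a α ∈ D.scratch := add_off_mem hx a α
    simp only [this, not_true_eq_false, and_false, false_or, Set.mem_empty_iff_false, false_iff]
    constructor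
    · rintro ⟨b, hb⟩
      obtain ⟨-, k, -⟩ := add_off_inj hx hb
        (show x + D.off a α = (x + D.off a α - D.off b false) + D.off b false by abel)
      simp [k]
    · intro h
      have : α = false := by simpa using h
      subst this
      exact ⟨a, by rwa [add_sub_cancel_right]⟩
  · intro x hx
    rw [hmem]
    constructor
    · rintro (h | ⟨a, h⟩)
      · exact h.1
      · exact absurd (hsc x a h) hx
    · exact fun h => Or.inl ⟨h, hx⟩
  · rw [List.length_finRange]; simp [rectLines]

/-- Run a register program and copy the last register to the piece. -/
theorem RReach.exec (hD : D.Fits) {m : ℕ} {ρ : Fin 8 → Set Plane}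
    (h : D.RReach m (fun _ => ∅) ρ) {W : Set Plane} (hW : W ⊆ UnitSq) :
    ∃ W', W' ⊆ UnitSq ∧ WReach (100 * m + 255) W W' ∧ (∀ x ∈ D.piece, (x ∈ W' ↔ x ∈ ρ 7)) ∧
      ∀ x ∉ D.piece, x ∉ D.scratch → (x ∈ W' ↔ x ∈ W) := by
  obtain ⟨W1, hW1, hE1, ho1, hr1⟩ := exists_enc_empty hD hW
  obtain ⟨W2, hW2, hE2, ho2, hr2⟩ := h W1 hW1 hE1
  have h3 := wreach_diff_poly (nondeg_rectLines D.px (D.px + D.s) D.py (D.py + D.s)) hW2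
  have hW3 : W2 \ D.piece ⊆ UnitSq := Set.sdiff_subset.trans hW2
  set o := D.off 7 true with ho
  have h4 := wreach_union_shift (nondeg_shift
    (nondeg_rectLines D.px (D.px + D.s) D.py (D.py + D.s)) o) hW3 (-o)
  have hmem : ∀ p, p ∈ W2 \ D.piece ∪ {p | p ∈ UnitSq ∧ p - -o ∈ W2 \ D.piece ∧ p - -o ∈ PolyCell
      ((rectLines D.px (D.px + D.s) D.py (D.py + D.s)).map fun l => l.shift o)} ↔
      (p ∈ W2 ∧ p ∉ D.piece) ∨ (p ∈ D.piece ∧ p ∈ ρ 7) := by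
    intro p
    refine or_congr_right ?_
    change (p ∈ UnitSq ∧ (p - -o ∈ W2 ∧ p - -o ∉ D.piece) ∧ p - -o ∈ PolyCell _) ↔ _
    rw [mem_polyCell_shift, sub_neg_eq_add, add_sub_cancel_right]
    change (p ∈ UnitSq ∧ (p + o ∈ W2 ∧ p + o ∉ D.piece) ∧ p ∈ D.piece) ↔ _
    constructor
    · rintro ⟨-, ⟨k1, -⟩, k2⟩
      exact ⟨k2, by simpa using (hE2 7 true p (piece_subset_box k2)).1 k1⟩
    · rintro ⟨k1, k2⟩
      exact ⟨hD.piece_sub k1, ⟨(hE2 7 true p (piece_subset_box k1)).2 (by simpa using k2),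
        fun hc => hD.disj _ hc (add_off_mem (piece_subset_box k1) 7 true)⟩, k1⟩
  refine ⟨_, ?_, (hr1.trans (hr2.trans (h3.trans h4))).mono ?_, ?_, ?_⟩
  · exact Set.union_subset hW3 fun p hp => hp.1
  · simp [rectLines]; omega
  · intro x hx
    rw [hmem]
    simp [hx]
  · intro x hx hxs
    rw [hmem]
    simp only [hx, not_false_eq_true, and_true, false_and, or_false]
    exact (ho2 x hxs).trans (ho1 x hxs)

end Layout

/-! ### Register programs -/

namespace Layout

variable {D : Layout}

theorem RReach.congr {m : ℕ} {ρ ρ' ρ'' : Fin 8 → Set Plane} (h : D.RReach m ρ ρ')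
    (he : ∀ a, ∀ x ∈ D.box, (x ∈ ρ' a ↔ x ∈ ρ'' a)) : D.RReach m ρ ρ'' := by
  intro W hW hE
  obtain ⟨W', hW', hE', ho, hr⟩ := h W hW hE
  exact ⟨W', hW', fun a α x hx => by rw [hE' a α x hx, he a x hx], ho, hr⟩

theorem RReach.congr_update {m : ℕ} {ρ ρ' : Fin 8 → Set Plane} {a : Fin 8} {S S' : Set Plane}
    (h : D.RReach m ρ (Function.update ρ' a S)) (he : ∀ x ∈ D.box, (x ∈ S ↔ x ∈ S')) :
    D.RReach m ρ (Function.update ρ' a S') := by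
  refine h.congr fun b x hx => ?_
  by_cases hb : b = a
  · subst hb; simpa using he x hx
  · simp [hb]

variable (D) in
/-- The translate of the part of `S` inside the box. -/
def sh (v : Plane) (S : Set Plane) : Set Plane := {x | x - v ∈ D.box ∧ x - v ∈ S}

theorem mem_sh {v x : Plane} {S : Set Plane} : x ∈ D.sh v S ↔ x - v ∈ D.box ∧ x - v ∈ S := Iff.rfl

theorem polyCell_nil : PolyCell [] = Set.univ := by
  ext; simp [mem_polyCell]

theorem rreach_zero (hD : D.Fits) (ρ) (a : Fin 8) : D.RReach 1 ρ (Function.update ρ a ∅) := by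
  have := rreach_const hD ρ a false (L := []) (by simp) (by simp)
  simpa [litAdd, polyCell_nil] using this

theorem rreach_or (hD : D.Fits) (ρ) (a b : Fin 8) (v : Plane) :
    D.RReach 1 ρ (Function.update ρ a (ρ a ∪ D.sh v (ρ b))) := by
  have := rreach_copy hD ρ a true b true v (Or.inr rfl)
  simpa [litAdd, sh] using this

theorem rreach_diff (hD : D.Fits) (ρ) (a b : Fin 8) (hab : a ≠ b) :
    D.RReach 1 ρ (Function.update ρ a (ρ a \ ρ b)) := by
  refine (rreach_copy hD ρ a false b true 0 (Or.inl hab)).congr_update fun x hx => ?_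
  rw [litAdd, if_neg (by simp), Set.mem_sdiff, Set.mem_sdiff]
  change _ ∧ ¬ (x - 0 ∈ D.box ∧ (x - 0 ∈ ρ b ↔ true = true)) ↔ _
  simp [hx]

theorem rreach_and (hD : D.Fits) (ρ) (a b : Fin 8) (hab : a ≠ b) :
    D.RReach 1 ρ (Function.update ρ a (ρ a ∩ ρ b)) := by
  refine (rreach_copy hD ρ a false b false 0 (Or.inl hab)).congr_update fun x hx => ?_
  rw [litAdd, if_neg (by simp), Set.mem_sdiff, Set.mem_inter_iff]
  change _ ∧ ¬ (x - 0 ∈ D.box ∧ (x - 0 ∈ ρ b ↔ false = true)) ↔ _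
  simp [hx]

theorem rreach_half (hD : D.Fits) (ρ) (a : Fin 8) (l : Ln) :
    D.RReach 2 ρ (Function.update ρ a {p | 0 < l.ev p}) := by
  have h0 := rreach_zero hD ρ a
  have hs : {p | 0 < l.ev p} = PolyCell [l] := by ext; simp [mem_polyCell]
  by_cases hl : l.Nondeg
  · have := h0.trans (rreach_const hD _ a true (L := [l]) (by simpa using hl) (by simp))
    simpa [litAdd, hs] using this
  · have hc : ∀ p, l.ev p = l.2.2 := by
      intro p
      rw [Ln.Nondeg, not_or, not_not, not_not] at hl
      simp [Ln.ev, hl.1, hl.2]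
    by_cases h2 : 0 < l.2.2
    · have := h0.trans (rreach_const hD _ a true (L := []) (by simp) (by simp))
      simpa [litAdd, polyCell_nil, hc, h2] using this
    · have := h0.mono (n := 2) (by norm_num)
      simpa [hc, h2] using this

/-- The register state with the given contents. -/
def st (X A E T Z Y G O : Set Plane) : Fin 8 → Set Plane := ![X, A, E, T, Z, Y, G, O]

section
variable (X A E T Z Y G O V : Set Plane)

theorem st_0 : st X A E T Z Y G O 0 = X := rfl
theorem st_1 : st X A E T Z Y G O 1 = A := rfl
theorem st_2 : st X A E T Z Y G O 2 = E := rfl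
theorem st_3 : st X A E T Z Y G O 3 = T := rfl
theorem st_4 : st X A E T Z Y G O 4 = Z := rfl
theorem st_5 : st X A E T Z Y G O 5 = Y := rfl
theorem st_6 : st X A E T Z Y G O 6 = G := rfl
theorem st_7 : st X A E T Z Y G O 7 = O := rfl

theorem update_st_0 : Function.update (st X A E T Z Y G O) 0 V = st V A E T Z Y G O := by
  funext i; fin_cases i <;> rfl
theorem update_st_1 : Function.update (st X A E T Z Y G O) 1 V = st X V E T Z Y G O := by
  funext i; fin_cases i <;> rfl
theorem update_st_2 : Function.update (st X A E T Z Y G O) 2 V = st X A V T Z Y G O := by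
  funext i; fin_cases i <;> rfl
theorem update_st_3 : Function.update (st X A E T Z Y G O) 3 V = st X A E V Z Y G O := by
  funext i; fin_cases i <;> rfl
theorem update_st_4 : Function.update (st X A E T Z Y G O) 4 V = st X A E T V Y G O := by
  funext i; fin_cases i <;> rfl
theorem update_st_5 : Function.update (st X A E T Z Y G O) 5 V = st X A E T Z V G O := by
  funext i; fin_cases i <;> rfl
theorem update_st_6 : Function.update (st X A E T Z Y G O) 6 V = st X A E T Z Y V O := by
  funext i; fin_cases i <;> rfl
theorem update_st_7 : Function.update (st X A E T Z Y G O) 7 V = st X A E T Z Y G V := by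
  funext i; fin_cases i <;> rfl
end

/-! ### Tapes -/

/-- The translate of `x` by `t` horizontal steps of length `ε`. -/
def pt (ε : ℝ) (x : Plane) (t : ℕ) : Plane := (x.1 + t * ε, x.2)

/-- The first `K` translates of `X` stay in the box and are pairwise disjoint. -/
structure TapeOk (D : Layout) (ε : ℝ) (K : ℕ) (X : Set Plane) : Prop where
  mem_box : ∀ x ∈ X, ∀ t < K, pt ε x t ∈ D.box
  inj : ∀ x ∈ X, ∀ y ∈ X, ∀ t < K, ∀ u < K, pt ε x t = pt ε y u → t = u

/-- The tape over `X` whose slot `t` holds the truth value of `φ x t`. -/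
def tape (ε : ℝ) (K : ℕ) (X : Set Plane) (φ : Plane → ℕ → Prop) : Set Plane :=
  {p | ∃ x ∈ X, ∃ t < K, φ x t ∧ p = pt ε x t}

section tape
variable {ε : ℝ} {K : ℕ} {X : Set Plane} {φ ψ : Plane → ℕ → Prop}

theorem pt_inj_left {x y : Plane} {t : ℕ} (h : pt ε x t = pt ε y t) : x = y := by
  simp only [pt, Prod.mk.injEq] at h
  ext
  · linarith [h.1]
  · exact h.2

theorem TapeOk.pt_mem (h : TapeOk D ε K X) {x : Plane} (hx : x ∈ X) {t : ℕ} (ht : t < K) :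
    pt ε x t ∈ tape ε K X φ ↔ φ x t := by
  constructor
  · rintro ⟨y, hy, u, hu, hφ, he⟩
    obtain rfl := h.inj x hx y hy t ht u hu he
    obtain rfl := pt_inj_left he
    exact hφ
  · exact fun hφ => ⟨x, hx, t, ht, hφ, rfl⟩

theorem tape_congr (h : ∀ x ∈ X, ∀ t < K, (φ x t ↔ ψ x t)) : tape ε K X φ = tape ε K X ψ := by
  ext p
  constructor
  · rintro ⟨x, hx, t, ht, h1, h2⟩
    exact ⟨x, hx, t, ht, (h x hx t ht).1 h1, h2⟩
  · rintro ⟨x, hx, t, ht, h1, h2⟩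
    exact ⟨x, hx, t, ht, (h x hx t ht).2 h1, h2⟩

theorem tape_union : tape ε K X φ ∪ tape ε K X ψ = tape ε K X fun x t => φ x t ∨ ψ x t := by
  ext p
  constructor
  · rintro (⟨x, hx, t, ht, h1, h2⟩ | ⟨x, hx, t, ht, h1, h2⟩)
    · exact ⟨x, hx, t, ht, Or.inl h1, h2⟩
    · exact ⟨x, hx, t, ht, Or.inr h1, h2⟩
  · rintro ⟨x, hx, t, ht, h1 | h1, h2⟩
    · exact Or.inl ⟨x, hx, t, ht, h1, h2⟩
    · exact Or.inr ⟨x, hx, t, ht, h1, h2⟩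

theorem TapeOk.inter (h : TapeOk D ε K X) :
    tape ε K X φ ∩ tape ε K X ψ = tape ε K X fun x t => φ x t ∧ ψ x t := by
  ext p
  constructor
  · rintro ⟨⟨x, hx, t, ht, h1, rfl⟩, h2⟩
    exact ⟨x, hx, t, ht, ⟨h1, (h.pt_mem hx ht).1 h2⟩, rfl⟩
  · rintro ⟨x, hx, t, ht, h1, h2⟩
    exact ⟨⟨x, hx, t, ht, h1.1, h2⟩, ⟨x, hx, t, ht, h1.2, h2⟩⟩

theorem TapeOk.diff (h : TapeOk D ε K X) :
    tape ε K X φ \ tape ε K X ψ = tape ε K X fun x t => φ x t ∧ ¬ ψ x t := by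
  ext p
  constructor
  · rintro ⟨⟨x, hx, t, ht, h1, rfl⟩, h2⟩
    exact ⟨x, hx, t, ht, ⟨h1, fun hc => h2 ((h.pt_mem hx ht).2 hc)⟩, rfl⟩
  · rintro ⟨x, hx, t, ht, h1, rfl⟩
    exact ⟨⟨x, hx, t, ht, h1.1, rfl⟩, fun hc => h1.2 ((h.pt_mem hx ht).1 hc)⟩

theorem pt_sub (x : Plane) {t d : ℕ} (hd : d ≤ t) : pt ε x t - (d * ε, 0) = pt ε x (t - d) := by
  simp only [pt]
  ext
  · simp only [Prod.fst_sub]; push_cast [hd]; ring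
  · simp

theorem pt_add (x : Plane) (t d : ℕ) : pt ε x (t + d) - (d * ε, 0) = pt ε x t := by
  rw [pt_sub x (Nat.le_add_left d t), Nat.add_sub_cancel]

theorem TapeOk.sh (h : TapeOk D ε K X) {d : ℕ} (hφ : ∀ x t, φ x t → t + d < K) :
    D.sh (d * ε, 0) (tape ε K X φ) = tape ε K X fun x t => d ≤ t ∧ φ x (t - d) := by
  ext p
  rw [mem_sh]
  constructor
  · rintro ⟨-, x, hx, t, ht, h1, h2⟩
    refine ⟨x, hx, t + d, hφ x t h1, ⟨Nat.le_add_left _ _, by rwa [Nat.add_sub_cancel]⟩, ?_⟩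
    rw [← pt_add x t d] at h2
    exact sub_left_injective h2
  · rintro ⟨x, hx, t, ht, ⟨hd, h1⟩, rfl⟩
    have : t - d < K := by omega
    rw [pt_sub x hd]
    exact ⟨h.mem_box x hx _ this, x, hx, _, this, h1, rfl⟩

theorem tape_zero (hK : 0 < K) (R : Plane → Prop) :
    {x | x ∈ X ∧ R x} = tape ε K X fun x t => t = 0 ∧ R x := by
  ext p
  constructor
  · exact fun hp => ⟨p, hp.1, 0, hK, ⟨rfl, hp.2⟩, by simp [pt]⟩
  · rintro ⟨x, hx, t, ht, ⟨rfl, h1⟩, rfl⟩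
    have : pt ε x 0 = x := by simp [pt]
    rw [this]
    exact ⟨hx, h1⟩

theorem TapeOk.sh_neg_inter (h : TapeOk D ε K X) {d : ℕ} (hd : d < K) :
    D.sh (-(d * ε), 0) (tape ε K X φ) ∩ X = {x | x ∈ X ∧ φ x d} := by
  ext x
  rw [Set.mem_inter_iff, mem_sh]
  have e : x - (-(d * ε), 0) = pt ε x d := by
    ext <;> simp [pt]
  rw [e]
  constructor
  · rintro ⟨⟨-, h1⟩, hx⟩
    exact ⟨hx, (h.pt_mem hx hd).1 h1⟩
  · rintro ⟨hx, h1⟩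
    exact ⟨⟨h.mem_box x hx d hd, (h.pt_mem hx hd).2 h1⟩, hx⟩

end tape

/-- Parity of the number of indices below `n` satisfying `p`. -/
def par : ℕ → (ℕ → Prop) → Prop
  | 0, _ => False
  | n + 1, p => Xor (par n p) (p n)

theorem par_congr {n : ℕ} {p q : ℕ → Prop} (h : ∀ i < n, (p i ↔ q i)) : par n p ↔ par n q := by
  induction n with
  | zero => rfl
  | succ n ih =>
    rw [par, par, ih fun i hi => h i (by omega), h n (by omega)]

/-- The quadratic form over `𝔽₂` with coefficients `C` in the indicators of the half-planes `H`. -/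
def pform (N : ℕ) (H : ℕ → Ln) (C : ℕ → ℕ → Bool) (x : Plane) : Prop :=
  par N fun i => 0 < (H i).ev x ∧ par N fun m => C i m = true ∧ 0 < (H m).ev x

theorem sh_zero {S : Set Plane} (hS : S ⊆ D.box) : D.sh 0 S = S := by
  ext x
  rw [mem_sh, sub_zero]
  exact ⟨And.right, fun h => ⟨hS h, h⟩⟩

theorem tape_subset {ε : ℝ} {K : ℕ} {X : Set Plane} {φ : Plane → ℕ → Prop}
    (h : TapeOk D ε K X) : tape ε K X φ ⊆ D.box := by
  rintro _ ⟨x, hx, t, ht, -, rfl⟩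
  exact h.mem_box x hx t ht

/-- The contents of the tape after all subsets of the first `j` half-planes are tabulated. -/
def tabulated (N : ℕ) (H : ℕ → Ln) (j : ℕ) (x : Plane) (t : ℕ) : Prop :=
  t / 2 ^ N < 2 ^ j ∧ ((t % 2 ^ N < N ∧ 0 < (H (t % 2 ^ N)).ev x) ∨
    (t % 2 ^ N = N ∧ par j fun m => (t / 2 ^ N).testBit m = true ∧ 0 < (H m).ev x))

theorem tabulated_bound {N j t : ℕ} {H : ℕ → Ln} {x : Plane} (h : tabulated N H j x t) :
    t + N < 2 ^ j * 2 ^ N + 2 ^ N := by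
  have hS : N < 2 ^ N := Nat.lt_two_pow_self
  have h1 := Nat.div_add_mod t (2 ^ N)
  have h2 : (t / 2 ^ N + 1) * 2 ^ N ≤ 2 ^ j * 2 ^ N := Nat.mul_le_mul_right _ h.1
  have h3 : t % 2 ^ N < 2 ^ N := Nat.mod_lt _ (by positivity)
  have h4 : (t / 2 ^ N + 1) * 2 ^ N = 2 ^ N * (t / 2 ^ N) + 2 ^ N := by ring
  omega

theorem sub_block {S k m j : ℕ} : (2 ^ j * S ≤ S * k + m ∧ m < S → 2 ^ j ≤ k) := by
  rintro ⟨h1, h2⟩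
  by_contra h
  have : S * (k + 1) ≤ S * 2 ^ j := Nat.mul_le_mul_left _ (by omega)
  nlinarith

theorem block_div {S k m : ℕ} (hm : m < S) : (S * k + m) / S = k := by
  rw [Nat.mul_add_div (by omega), Nat.div_eq_of_lt hm, add_zero]

theorem block_mod {S k m : ℕ} (hm : m < S) : (S * k + m) % S = m := by
  rw [Nat.mul_add_mod, Nat.mod_eq_of_lt hm]

theorem marks_succ (N j t : ℕ) :
    ((t % 2 ^ N = 0 ∧ t / 2 ^ N < 2 ^ j) ∨ (2 ^ j * 2 ^ N ≤ t ∧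
      (t - 2 ^ j * 2 ^ N) % 2 ^ N = 0 ∧ (t - 2 ^ j * 2 ^ N) / 2 ^ N < 2 ^ j)) ↔
    (t % 2 ^ N = 0 ∧ t / 2 ^ N < 2 ^ (j + 1)) := by
  have hS : 0 < 2 ^ N := by positivity
  generalize 2 ^ N = S at *
  obtain ⟨k, m, hm, rfl⟩ : ∃ k m, m < S ∧ t = S * k + m :=
    ⟨t / S, t % S, Nat.mod_lt _ hS, (Nat.div_add_mod t S).symm⟩
  rw [block_div hm, block_mod hm, pow_succ]
  by_cases hk : 2 ^ j ≤ k
  · obtain ⟨k', rfl⟩ := Nat.exists_eq_add_of_le hk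
    have e : S * (2 ^ j + k') + m - 2 ^ j * S = S * k' + m := by
      rw [mul_add, mul_comm]; omega
    have e' : 2 ^ j * S ≤ S * (2 ^ j + k') + m := by nlinarith
    rw [e, block_div hm, block_mod hm]
    simp only [e', true_and]
    omega
  · have : ¬ (2 ^ j * S ≤ S * k + m) := fun h => hk (sub_block ⟨h, hm⟩)
    simp only [this, false_and, or_false]
    omega

theorem tabulated_shift {N j : ℕ} (H : ℕ → Ln) (x : Plane) {k m : ℕ} (hm : m < 2 ^ N) :
    (tabulated N H j x (2 ^ N * k + m) ∨
      (2 ^ j * 2 ^ N ≤ 2 ^ N * k + m ∧ tabulated N H j x (2 ^ N * k + m - 2 ^ j * 2 ^ N))) ↔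
    k < 2 ^ (j + 1) ∧ ((m < N ∧ 0 < (H m).ev x) ∨
      (m = N ∧ par j fun i => k.testBit i = true ∧ 0 < (H i).ev x)) := by
  unfold tabulated
  generalize 2 ^ N = S at *
  rw [block_div hm, block_mod hm, pow_succ]
  by_cases hk : 2 ^ j ≤ k
  · obtain ⟨k', rfl⟩ := Nat.exists_eq_add_of_le hk
    have e : S * (2 ^ j + k') + m - 2 ^ j * S = S * k' + m := by
      rw [mul_add, mul_comm]; omega
    have e' : 2 ^ j * S ≤ S * (2 ^ j + k') + m := by nlinarith
    rw [e, block_div hm, block_mod hm]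
    have hp : (par j fun i => k'.testBit i = true ∧ 0 < (H i).ev x) ↔
        par j fun i => (2 ^ j + k').testBit i = true ∧ 0 < (H i).ev x :=
      par_congr fun i hi => by rw [Nat.testBit_two_pow_add_gt hi]
    rw [hp]
    have h1 : ¬ (2 ^ j + k' < 2 ^ j) := by omega
    have h2 : 2 ^ j + k' < 2 ^ j * 2 ↔ k' < 2 ^ j := by omega
    simp only [e', true_and, h1, false_and, false_or, h2]
  · have : ¬ (2 ^ j * S ≤ S * k + m) := fun h => hk (sub_block ⟨h, hm⟩)
    have h1 : k < 2 ^ j := by omega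
    have h2 : k < 2 ^ j * 2 := by omega
    simp only [this, false_and, or_false, h1, h2]

theorem tabulated_succ {N j : ℕ} (H : ℕ → Ln) (hj : j < N) (x : Plane) (t : ℕ) :
    let φ : ℕ → Prop := fun t => tabulated N H j x t ∨
      (2 ^ j * 2 ^ N ≤ t ∧ tabulated N H j x (t - 2 ^ j * 2 ^ N))
    let ψ : Prop := (N - j ≤ t ∧ φ (t - (N - j))) ∧ (2 ^ j * 2 ^ N + N ≤ t ∧
      (t - (2 ^ j * 2 ^ N + N)) % 2 ^ N = 0 ∧ (t - (2 ^ j * 2 ^ N + N)) / 2 ^ N < 2 ^ j)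
    ((φ t ∨ ψ) ∧ ¬ (φ t ∧ ψ)) ↔ tabulated N H (j + 1) x t := by
  intro φ ψ
  have hNS : N < 2 ^ N := Nat.lt_two_pow_self
  obtain ⟨k, m, hm, rfl⟩ : ∃ k m, m < 2 ^ N ∧ t = 2 ^ N * k + m :=
    ⟨t / 2 ^ N, t % 2 ^ N, Nat.mod_lt _ (by positivity), (Nat.div_add_mod t _).symm⟩
  have hφ : ∀ m' < 2 ^ N, (φ (2 ^ N * k + m') ↔ k < 2 ^ (j + 1) ∧ ((m' < N ∧ 0 < (H m').ev x) ∨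
      (m' = N ∧ par j fun i => k.testBit i = true ∧ 0 < (H i).ev x))) :=
    fun m' hm' => tabulated_shift H x hm'
  have hψ : ψ ↔ (m = N ∧ 2 ^ j ≤ k ∧ k < 2 ^ (j + 1) ∧ 0 < (H j).ev x) := by
    constructor
    · rintro ⟨⟨h1, h2⟩, h3, h4, h5⟩
      have hk : 2 ^ j ≤ k := sub_block ⟨by omega, hm⟩
      obtain ⟨k', rfl⟩ := Nat.exists_eq_add_of_le hk
      have e0 : 2 ^ N * (2 ^ j + k') = 2 ^ j * 2 ^ N + 2 ^ N * k' := by ring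
      have hmN : m = N := by
        rcases lt_trichotomy m N with hlt | heq | hgt
        · exfalso
          rcases Nat.eq_zero_or_pos k' with rfl | hk'
          · omega
          · obtain ⟨k'', rfl⟩ : ∃ k'', k' = 1 + k'' := ⟨k' - 1, by omega⟩
            have e1 : 2 ^ N * (2 ^ j + (1 + k'')) + m - (2 ^ j * 2 ^ N + N) =
                2 ^ N * k'' + (2 ^ N + m - N) := by
              have : 2 ^ N * (1 + k'') = 2 ^ N + 2 ^ N * k'' := by ring
              omega
            rw [e1, block_mod (by omega)] at h4
            omega
        · exact heq
        · exfalso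
          have e1 : 2 ^ N * (2 ^ j + k') + m - (2 ^ j * 2 ^ N + N) = 2 ^ N * k' + (m - N) := by
            omega
          rw [e1, block_mod (by omega)] at h4
          omega
      subst hmN
      have e1 : 2 ^ m * (2 ^ j + k') + m - (m - j) = 2 ^ m * (2 ^ j + k') + j := by omega
      rw [e1, hφ j (by omega)] at h2
      refine ⟨rfl, hk, h2.1, ?_⟩
      rcases h2.2 with h | h
      · exact h.2
      · omega
    · rintro ⟨rfl, hk, h1, h2⟩
      obtain ⟨k', rfl⟩ := Nat.exists_eq_add_of_le hk
      have e0 : 2 ^ m * (2 ^ j + k') = 2 ^ j * 2 ^ m + 2 ^ m * k' := by ring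
      refine ⟨⟨by omega, ?_⟩, by omega, ?_⟩
      · have e1 : 2 ^ m * (2 ^ j + k') + m - (m - j) = 2 ^ m * (2 ^ j + k') + j := by omega
        rw [e1, hφ j (by omega)]
        exact ⟨h1, Or.inl ⟨hj, h2⟩⟩
      · have e1 : 2 ^ m * (2 ^ j + k') + m - (2 ^ j * 2 ^ m + m) = 2 ^ m * k' + 0 := by omega
        rw [e1, block_mod (by omega), block_div (by omega)]
        rw [pow_succ] at h1
        omega
  rw [hψ, hφ m hm, tabulated, block_div hm, block_mod hm, par]
  by_cases hk : k < 2 ^ (j + 1)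
  · have hb : k.testBit j = true ↔ 2 ^ j ≤ k := by
      constructor
      · exact fun h => Nat.ge_two_pow_of_testBit h
      · intro h
        obtain ⟨k', rfl⟩ := Nat.exists_eq_add_of_le h
        rw [pow_succ] at hk
        rw [Nat.testBit_two_pow_add_eq, Nat.testBit_lt_two_pow (by omega)]
        rfl
    rw [hb]
    simp only [hk, true_and]
    rcases lt_trichotomy m N with h | rfl | h
    · have : m ≠ N := by omega
      simp [h, this]
    · simp only [lt_irrefl, false_and, false_or, true_and, Xor]
      tauto
    · have h1 : m ≠ N := by omega
      have h2 : ¬ m < N := by omega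
      simp [h1, h2]
  · simp [hk]

theorem exists_code (N : ℕ) (c : ℕ → Bool) :
    ∃ k < 2 ^ N, ∀ m < N, (k.testBit m = true ↔ c m = true) := by
  refine ⟨Nat.ofBits fun m : Fin N => c m, Nat.ofBits_lt_two_pow _, fun m hm => ?_⟩
  rw [Nat.testBit_ofBits_lt _ _ hm]

section
variable {X A E T Z Y G O : Set Plane}

/-- Store `A ∩ {l > 0}` in the register `3`. -/
theorem rreach_half_inter_X (hD : D.Fits) (l : Ln) : D.RReach 3 (st X A E T Z Y G O)
    (st X A E {x | x ∈ X ∧ 0 < l.ev x} Z Y G O) := by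
  have h1 := rreach_half hD (st X A E T Z Y G O) 3 l
  have h2 := h1.trans (rreach_and hD _ 3 0 (by decide))
  simp only [st_0, st_3, update_st_3] at h2
  have : {p | 0 < l.ev p} ∩ X = {x | x ∈ X ∧ 0 < l.ev x} := by
    ext; exact and_comm
  rwa [this] at h2

theorem rreach_xor_A (hD : D.Fits) (hA : A ⊆ D.box) (hT : T ⊆ D.box) :
    D.RReach 5 (st X A E T Z Y G O)
      (st X ((A ∪ T) \ (A ∩ T)) E T Z (A ∩ T) G O) := by
  have h1 := rreach_zero hD (st X A E T Z Y G O) 5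
  have h2 := h1.trans (rreach_or hD _ 5 1 0)
  simp only [st_1, st_5, update_st_5, sh_zero hA, Set.empty_union] at h2
  have h3 := h2.trans (rreach_and hD _ 5 3 (by decide))
  have h4 := h3.trans (rreach_or hD _ 1 3 0)
  simp only [st_1, st_3, st_5, update_st_1, update_st_5, sh_zero hT] at h4
  have h5 := h4.trans (rreach_diff hD _ 1 5 (by decide))
  simpa only [st_1, st_5, update_st_1] using h5

theorem rreach_xor_Z (hD : D.Fits) (hZ : Z ⊆ D.box) (hT : T ⊆ D.box) :
    D.RReach 5 (st X A E T Z Y G O)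
      (st X A E T ((Z ∪ T) \ (Z ∩ T)) (Z ∩ T) G O) := by
  have h1 := rreach_zero hD (st X A E T Z Y G O) 5
  have h2 := h1.trans (rreach_or hD _ 5 4 0)
  simp only [st_4, st_5, update_st_5, sh_zero hZ, Set.empty_union] at h2
  have h3 := h2.trans (rreach_and hD _ 5 3 (by decide))
  have h4 := h3.trans (rreach_or hD _ 4 3 0)
  simp only [st_3, st_4, st_5, update_st_4, update_st_5, sh_zero hT] at h4
  have h5 := h4.trans (rreach_diff hD _ 4 5 (by decide))
  simpa only [st_4, st_5, update_st_4] using h5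

variable {ε : ℝ} {N : ℕ}

theorem rreach_loop_half (hD : D.Fits) (H : ℕ → Ln)
    (hX : TapeOk D ε (4 * (2 ^ N * 2 ^ N)) X) (n : ℕ) (hn : n ≤ N) :
    ∃ T', D.RReach (4 * n) (st X ∅ E T Z Y G O)
      (st X (tape ε (4 * (2 ^ N * 2 ^ N)) X fun x t => t < n ∧ 0 < (H t).ev x) E T' Z Y G O) := by
  have hS : N < 2 ^ N := Nat.lt_two_pow_self
  have hSS : 2 ^ N ≤ 2 ^ N * 2 ^ N := Nat.le_mul_self _
  set K := 4 * (2 ^ N * 2 ^ N) with hK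
  induction n with
  | zero =>
    refine ⟨T, ?_⟩
    have : (tape ε K X fun x t => t < 0 ∧ 0 < (H t).ev x) = ∅ := by
      ext p; simp [tape]
    rw [this]
    exact .refl _
  | succ n ih =>
    obtain ⟨T', h⟩ := ih (by omega)
    have h1 := h.trans (rreach_half_inter_X hD (H n))
    have h2 := h1.trans (rreach_or hD _ 1 3 (n * ε, 0))
    simp only [st_1, st_3, update_st_1] at h2
    rw [tape_zero (ε := ε) (K := K) (by omega) fun x => 0 < (H n).ev x,
      hX.sh (by rintro x t ⟨rfl, -⟩; omega), tape_union] at h2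
    rw [tape_congr (ψ := fun x t => t < n + 1 ∧ 0 < (H t).ev x) fun x _ t _ => ?_] at h2
    · exact ⟨_, h2⟩
    constructor
    · rintro (⟨h1, h2⟩ | ⟨h1, h2, h3⟩)
      · exact ⟨by omega, h2⟩
      · obtain rfl : t = n := by omega
        exact ⟨by omega, h3⟩
    · rintro ⟨k1, k2⟩
      rcases Nat.lt_succ_iff_lt_or_eq.1 k1 with k3 | k3
      · exact Or.inl ⟨k3, k2⟩
      · exact Or.inr ⟨k3.ge, by omega, k3 ▸ k2⟩

theorem rreach_loop_double (hD : D.Fits) (H : ℕ → Ln)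
    (hX : TapeOk D ε (4 * (2 ^ N * 2 ^ N)) X) (j : ℕ) (hj : j ≤ N) : ∃ T' Y', D.RReach (12 * j)
    (st X (tape ε (4 * (2 ^ N * 2 ^ N)) X (tabulated N H 0)) X T Z Y G O)
    (st X (tape ε (4 * (2 ^ N * 2 ^ N)) X (tabulated N H j))
      (tape ε (4 * (2 ^ N * 2 ^ N)) X fun _ t => t % 2 ^ N = 0 ∧ t / 2 ^ N < 2 ^ j)
      T' Z Y' G O) := by
  have hS : N < 2 ^ N := Nat.lt_two_pow_self
  have hSS : 2 ^ N ≤ 2 ^ N * 2 ^ N := Nat.le_mul_self _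
  set K := 4 * (2 ^ N * 2 ^ N) with hK
  induction j with
  | zero =>
    refine ⟨T, Y, ?_⟩
    have : (tape ε K X fun _ t => t % 2 ^ N = 0 ∧ t / 2 ^ N < 2 ^ 0) = X := by
      have := tape_zero (ε := ε) (K := K) (X := X) (by omega) fun _ => True
      simp only [and_true] at this
      refine Eq.trans (tape_congr fun x _ t _ => ?_) this.symm
      rw [pow_zero, Nat.lt_one_iff, Nat.div_eq_zero_iff]
      constructor
      · rintro ⟨h1, h2 | h2⟩
        · omega
        · rwa [Nat.mod_eq_of_lt h2] at h1
      · rintro rfl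
        simp
    rw [this]
    exact .refl _
  | succ j ih =>
    obtain ⟨T', Y', h⟩ := ih (by omega)
    set S := 2 ^ N with hSdef
    have hjN : 2 ^ j * 2 ≤ S := by
      rw [← pow_succ]; exact Nat.pow_le_pow_right (by norm_num) hj
    have hd : 2 ^ j * S * 2 ≤ S * S := by nlinarith
    have hEb : ∀ t : ℕ, t % S = 0 ∧ t / S < 2 ^ j → t + S ≤ 2 ^ j * S := by
      rintro t ⟨e1, e2⟩
      have h1 := Nat.div_add_mod t S
      have h2 : (t / S + 1) * S ≤ 2 ^ j * S := Nat.mul_le_mul_right _ e2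
      have h4 : (t / S + 1) * S = S * (t / S) + S := by ring
      omega
    have hAb : ∀ x t, tabulated N H j x t → t + N < 2 ^ j * S + S :=
      fun x t => tabulated_bound
    have h1 := h.trans (rreach_or hD _ 1 1 (((2 ^ j * S : ℕ) : ℝ) * ε, 0))
    simp only [st_1, update_st_1] at h1
    rw [hX.sh (by intro x t ht; have := hAb x t ht; omega), tape_union] at h1
    have h2 := (h1.trans (rreach_zero hD _ 5)).trans
      (rreach_or hD _ 5 2 (((2 ^ j * S + N : ℕ) : ℝ) * ε, 0))
    simp only [st_2, st_5, update_st_5] at h2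
    rw [hX.sh (by intro x t ht; have := hEb t ht; omega), Set.empty_union] at h2
    have h3 := (h2.trans (rreach_zero hD _ 3)).trans
      (rreach_or hD _ 3 1 (((N - j : ℕ) : ℝ) * ε, 0))
    simp only [st_1, st_3, update_st_3] at h3
    rw [hX.sh (by
      rintro x t (ht | ⟨ht0, ht⟩)
      · have := hAb x t ht; omega
      · have := hAb x _ ht; omega), Set.empty_union] at h3
    have h4 := h3.trans (rreach_and hD _ 3 5 (by decide))
    simp only [st_3, st_5, update_st_3] at h4
    rw [hX.inter] at h4
    have h5 := h4.trans (rreach_xor_A hD (tape_subset hX) (tape_subset hX))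
    rw [tape_union, hX.inter, hX.diff] at h5
    have h6 := h5.trans (rreach_or hD _ 2 2 (((2 ^ j * S : ℕ) : ℝ) * ε, 0))
    simp only [st_2, update_st_2] at h6
    rw [hX.sh (by intro x t ht; have := hEb t ht; omega), tape_union] at h6
    rw [tape_congr (ψ := tabulated N H (j + 1)) fun x _ t _ => tabulated_succ H (by omega) x t,
      tape_congr (ψ := fun _ t => t % 2 ^ N = 0 ∧ t / 2 ^ N < 2 ^ (j + 1))
        fun x _ t _ => marks_succ N j t] at h6
    exact ⟨_, _, h6⟩

theorem rreach_loop_collect (hD : D.Fits) (H : ℕ → Ln) (C : ℕ → ℕ → Bool)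
    (hX : TapeOk D ε (4 * (2 ^ N * 2 ^ N)) X) (n : ℕ) (hn : n ≤ N) : ∃ T' Y', D.RReach (11 * n)
    (st X (tape ε (4 * (2 ^ N * 2 ^ N)) X (tabulated N H N)) E T ∅ Y G O)
    (st X (tape ε (4 * (2 ^ N * 2 ^ N)) X (tabulated N H N)) E T'
      {x | x ∈ X ∧ par n fun i => 0 < (H i).ev x ∧ par N fun m => C i m = true ∧ 0 < (H m).ev x}
      Y' G O) := by
  have hS : N < 2 ^ N := Nat.lt_two_pow_self
  have hSS : 2 ^ N ≤ 2 ^ N * 2 ^ N := Nat.le_mul_self _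
  set K := 4 * (2 ^ N * 2 ^ N) with hK
  have hXb : X ⊆ D.box := by
    intro x hx
    have := hX.mem_box x hx 0 (by omega)
    simpa [pt] using this
  induction n with
  | zero =>
    refine ⟨T, Y, ?_⟩
    simp only [par, and_false, Set.ofPred_false]
    exact .refl _
  | succ n ih =>
    obtain ⟨T', Y', h⟩ := ih (by omega)
    obtain ⟨k, hk, hkC⟩ := exists_code N (C n)
    have hkS : (k + 1) * 2 ^ N ≤ 2 ^ N * 2 ^ N := Nat.mul_le_mul_right _ hk
    have h1 := (h.trans (rreach_zero hD _ 3)).trans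
      (rreach_or hD _ 3 1 (-(((2 ^ N * k + N : ℕ) : ℝ) * ε), 0))
    have h2 := h1.trans (rreach_and hD _ 3 0 (by decide))
    simp only [st_0, st_1, st_3, update_st_3, Set.empty_union] at h2
    rw [hX.sh_neg_inter (by nlinarith)] at h2
    have h3 := (h2.trans (rreach_half hD _ 5 (H n))).trans (rreach_and hD _ 3 5 (by decide))
    simp only [st_3, st_5, update_st_3, update_st_5] at h3
    have h4 := h3.trans (rreach_xor_Z hD (fun x hx => hXb hx.1) (fun x hx => hXb hx.1.1))
    have hQ : ∀ x, x ∈ {x | x ∈ X ∧ tabulated N H N x (2 ^ N * k + N)} ∩ {p | 0 < (H n).ev p} ↔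
        x ∈ X ∧ 0 < (H n).ev x ∧ par N fun m => C n m = true ∧ 0 < (H m).ev x := by
      intro x
      change (x ∈ X ∧ tabulated N H N x (2 ^ N * k + N)) ∧ 0 < (H n).ev x ↔ _
      rw [tabulated, block_div hS, block_mod hS,
        par_congr (q := fun m => C n m = true ∧ 0 < (H m).ev x) fun m hm => by rw [hkC m hm]]
      simp only [hk, lt_irrefl, false_and, false_or, true_and]
      tauto
    generalize {x | x ∈ X ∧ tabulated N H N x (2 ^ N * k + N)} ∩ {p | 0 < (H n).ev p} = Q at h4 hQ
    set R := {x | x ∈ X ∧ par n fun i => 0 < (H i).ev x ∧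
      par N fun m => C i m = true ∧ 0 < (H m).ev x} with hR
    have e : (R ∪ Q) \ (R ∩ Q) = {x | x ∈ X ∧ par (n + 1) fun i => 0 < (H i).ev x ∧
        par N fun m => C i m = true ∧ 0 < (H m).ev x} := by
      ext x
      have hRx : x ∈ R ↔ x ∈ X ∧ par n fun i => 0 < (H i).ev x ∧
        par N fun m => C i m = true ∧ 0 < (H m).ev x := Iff.rfl
      change (x ∈ R ∨ x ∈ Q) ∧ ¬ (x ∈ R ∧ x ∈ Q) ↔ x ∈ X ∧ Xor _ _
      rw [hQ, hRx, Xor]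
      tauto
    rw [e] at h4
    exact ⟨_, _, h4⟩

/-- Evaluate a quadratic form on a set with enough disjoint translates. -/
theorem rreach_routine (hD : D.Fits) (H : ℕ → Ln) (C : ℕ → ℕ → Bool)
    (hX : TapeOk D ε (4 * (2 ^ N * 2 ^ N)) X) :
    ∃ A' E' T' Y', D.RReach (27 * N + 4) (st X A E T Z Y G O)
      (st X A' E' T' {x | x ∈ X ∧ pform N H C x} Y' G O) := by
  have hS : N < 2 ^ N := Nat.lt_two_pow_self
  have hSS : 2 ^ N ≤ 2 ^ N * 2 ^ N := Nat.le_mul_self _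
  have hXb : X ⊆ D.box := by
    intro x hx
    have := hX.mem_box x hx 0 (by omega)
    simpa [pt] using this
  have h1 := ((rreach_zero hD (st X A E T Z Y G O) 1).trans (rreach_zero hD _ 4)).trans
    (rreach_zero hD _ 2)
  have h2 := h1.trans (rreach_or hD _ 2 0 0)
  simp only [st_0, st_2, update_st_1, update_st_4, update_st_2, sh_zero hXb, Set.empty_union] at h2
  obtain ⟨T', h3⟩ := rreach_loop_half hD (E := X) (T := T) (Z := ∅) (Y := Y) (G := G) (O := O)
    H hX N le_rfl
  rw [tape_congr (ψ := tabulated N H 0) fun x _ t _ => ?_] at h3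
  swap
  · rw [tabulated, pow_zero, Nat.lt_one_iff, Nat.div_eq_zero_iff]
    simp only [par, and_false, or_false]
    constructor
    · rintro ⟨k1, k2⟩
      have : t < 2 ^ N := by omega
      rw [Nat.mod_eq_of_lt this]
      exact ⟨Or.inr this, k1, k2⟩
    · rintro ⟨k1, k2⟩
      have : t < 2 ^ N := by omega
      rwa [Nat.mod_eq_of_lt this] at k2
  obtain ⟨T'', Y'', h4⟩ := rreach_loop_double hD (T := T') (Z := ∅) (Y := Y) (G := G) (O := O)
    H hX N le_rfl
  obtain ⟨T₃, Y₃, h5⟩ := rreach_loop_collect hD (E := tape ε (4 * (2 ^ N * 2 ^ N)) X fun _ t =>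
    t % 2 ^ N = 0 ∧ t / 2 ^ N < 2 ^ N) (T := T'') (Y := Y'') (G := G) (O := O) H C hX N le_rfl
  exact ⟨_, _, _, _, (h2.trans (h3.trans (h4.trans h5))).mono (by omega)⟩
end
end Layout

/-! ### Generic pairs of step lengths -/

theorem eq_of_events_overlap {α β α' β' κ κ' w : ℝ} {e : ℕ → ℝ} (hκ : 1 ≤ |κ|)
    (he : ∀ m n, m ≠ n → 8 * w ≤ |e m - e n|) (hα : |α| ≤ |α'|) {m n p : ℕ} {η ζ : ℝ}
    (h1 : |κ * e m - (α * η + β)| < 2 * w) (h2 : |κ' * e p - (α' * η + β')| < 2 * w)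
    (h3 : |κ * e n - (α * ζ + β)| < 2 * w) (h4 : |κ' * e p - (α' * ζ + β')| < 2 * w) :
    m = n := by
  by_contra hmn
  have hA : |α' * (η - ζ)| < 4 * w := by
    have : α' * (η - ζ) = (κ' * e p - (α' * ζ + β')) - (κ' * e p - (α' * η + β')) := by ring
    rw [this]
    exact (abs_sub _ _).trans_lt (by linarith)
  have hB : |α * (η - ζ)| < 4 * w := by
    rw [abs_mul] at hA ⊢
    exact (mul_le_mul_of_nonneg_right hα (abs_nonneg _)).trans_lt hA
  have hC : |κ * (e m - e n)| < 8 * w := by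
    have : κ * (e m - e n) = (κ * e m - (α * η + β)) - (κ * e n - (α * ζ + β)) + α * (η - ζ) := by
      ring
    rw [this]
    refine (abs_add_le _ _).trans_lt ?_
    have := abs_sub (κ * e m - (α * η + β)) (κ * e n - (α * ζ + β))
    linarith
  rw [abs_mul] at hC
  have := he m n hmn
  nlinarith [abs_nonneg (e m - e n)]

/-- If each bad event pins down one coordinate in terms of the other, some pair of coordinates
avoids all of them. -/
theorem exists_pair_avoiding {ι : Type*} [Fintype ι] {M : ℕ} (B : ι → ℕ → ℕ → Prop)
    (hB : ∀ i, (∀ m n p, B i m p → B i n p → m = n) ∨ ∀ m n p, B i p m → B i p n → m = n)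
    (hM : Fintype.card ι < M) : ∃ m n, m < M ∧ n < M ∧ ∀ i, ¬ B i m n := by
  classical
  by_contra! hc
  have hsub : Finset.range M ×ˢ Finset.range M ⊆ Finset.univ.biUnion fun i : ι =>
      (Finset.range M ×ˢ Finset.range M).filter fun p => B i p.1 p.2 := by
    rintro ⟨m, n⟩ h
    simp only [Finset.mem_product, Finset.mem_range] at h
    obtain ⟨i, hi⟩ := hc m n h.1 h.2
    simp only [Finset.mem_biUnion, Finset.mem_univ, true_and, Finset.mem_filter,
      Finset.mem_product, Finset.mem_range]
    exact ⟨i, h, hi⟩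
  have hcard : ∀ i : ι, ((Finset.range M ×ˢ Finset.range M).filter
      fun p => B i p.1 p.2).card ≤ M := by
    intro i
    rcases hB i with h | h
    · calc _ ≤ (Finset.range M).card := by
            refine Finset.card_le_card_of_injOn Prod.snd ?_ ?_
            · intro p hp; simp at hp ⊢; exact hp.1.2
            · rintro ⟨a, b⟩ hp ⟨c, d⟩ hq (rfl : b = d)
              simp at hp hq
              rw [h a c b hp.2 hq.2]
        _ = M := Finset.card_range M
    · calc _ ≤ (Finset.range M).card := by
            refine Finset.card_le_card_of_injOn Prod.fst ?_ ?_
            · intro p hp; simp at hp ⊢; exact hp.1.1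
            · rintro ⟨a, b⟩ hp ⟨c, d⟩ hq (rfl : a = c)
              simp at hp hq
              rw [h b d a hp.2 hq.2]
        _ = M := Finset.card_range M
  have h1 := (Finset.card_le_card hsub).trans Finset.card_biUnion_le
  have h2 := h1.trans (Finset.sum_le_card_nsmul _ _ M fun i _ => hcard i)
  simp only [Finset.card_product, Finset.card_range, Finset.card_univ, smul_eq_mul] at h2
  nlinarith

theorem exists_steps {J : Type*} [Fintype J] {N M : ℕ} (α β : Fin N → ℝ) (κ : J → ℝ)
    (hκ : ∀ k, 1 ≤ |κ k|) {w : ℝ} (e : ℕ → ℝ) (he : ∀ m n, m ≠ n → 8 * w ≤ |e m - e n|)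
    (hM : N ^ 3 * Fintype.card J ^ 2 < M) : ∃ m n, m < M ∧ n < M ∧ ∀ j i i' k k' η,
      |κ k * e m - ((α i * η + β i) - (α j * η + β j))| < 2 * w →
      ¬ |κ k' * e n - ((α i' * η + β i') - (α j * η + β j))| < 2 * w := by
  let B : (Fin N × Fin N × Fin N) × J × J → ℕ → ℕ → Prop := fun v m n => ∃ η,
    |κ v.2.1 * e m - ((α v.1.2.1 - α v.1.1) * η + (β v.1.2.1 - β v.1.1))| < 2 * w ∧
    |κ v.2.2 * e n - ((α v.1.2.2 - α v.1.1) * η + (β v.1.2.2 - β v.1.1))| < 2 * w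
  have hB : ∀ v, (∀ m n p, B v m p → B v n p → m = n) ∨ ∀ m n p, B v p m → B v p n → m = n := by
    intro v
    rcases le_total |α v.1.2.1 - α v.1.1| |α v.1.2.2 - α v.1.1| with hl | hl
    · left
      rintro m n p ⟨η, h1, h2⟩ ⟨ζ, h3, h4⟩
      exact eq_of_events_overlap (hκ v.2.1) he hl h1 h2 h3 h4
    · right
      rintro m n p ⟨η, h1, h2⟩ ⟨ζ, h3, h4⟩
      exact eq_of_events_overlap (hκ v.2.2) he hl h2 h1 h4 h3
  obtain ⟨m, n, hm, hn, h⟩ := exists_pair_avoiding B hB (M := M) (by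
    simp only [Fintype.card_prod, Fintype.card_fin]
    calc _ = N ^ 3 * Fintype.card J ^ 2 := by ring
      _ < M := hM)
  refine ⟨m, n, hm, hn, fun j i i' k k' η h1 h2 => h ((j, i, i'), k, k') ⟨η, ?_, ?_⟩⟩
  · convert h1 using 2; ring
  · convert h2 using 2; ring

namespace Layout

variable {D : Layout}

/-! ### Spreading a set along translates -/

/-- The union of `2 ^ n` consecutive translates of `E`. -/
def spread (ε : ℝ) (n : ℕ) (E : Set Plane) : Set Plane := {p | ∃ x ∈ E, ∃ t < 2 ^ n, p = pt ε x t}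

theorem rreach_spread (hD : D.Fits) (ρ : Fin 8 → Set Plane) (a : Fin 8) (ε : ℝ) (n : ℕ)
    (h : ∀ x ∈ ρ a, ∀ t < 2 ^ n, pt ε x t ∈ D.box) :
    D.RReach n ρ (Function.update ρ a (spread ε n (ρ a))) := by
  induction n with
  | zero =>
    have : spread ε 0 (ρ a) = ρ a := by
      ext p
      simp [spread, pt]
    rw [this, Function.update_eq_self]
    exact .refl _
  | succ n ih =>
    have h1 := (ih fun x hx t ht => h x hx t (by rw [pow_succ]; omega)).trans
      (rreach_or hD _ a a (((2 ^ n : ℕ) : ℝ) * ε, 0))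
    rw [Function.update_self, Function.update_idem] at h1
    convert h1 using 2
    ext p
    rw [Set.mem_union, mem_sh]
    constructor
    · rintro ⟨x, hx, t, ht, rfl⟩
      by_cases htn : t < 2 ^ n
      · exact Or.inl ⟨x, hx, t, htn, rfl⟩
      · rw [not_lt] at htn
        rw [pt_sub x htn]
        refine Or.inr ⟨h x hx _ (by omega), x, hx, _, ?_, rfl⟩
        rw [pow_succ] at ht; omega
    · rintro (⟨x, hx, t, ht, rfl⟩ | ⟨-, x, hx, t, ht, he⟩)
      · exact ⟨x, hx, t, by rw [pow_succ]; omega, rfl⟩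
      · refine ⟨x, hx, t + 2 ^ n, by rw [pow_succ]; omega, ?_⟩
        rw [← pt_add x t (2 ^ n)] at he
        exact sub_left_injective he

/-! ### Isolated points -/

/-- The points of `G` that are not within `K` steps of another point of `G`. -/
def iso (ε : ℝ) (K : ℕ) (G : Set Plane) : Set Plane :=
  {x | x ∈ G ∧ ∀ y ∈ G, ∀ t < K, x ≠ pt ε y (t + 1) ∧ y ≠ pt ε x (t + 1)}

theorem pt_mem_box {ε : ℝ} {K : ℕ} (hε : 0 ≤ ε) (hK : K * ε ≤ D.s) {x : Plane} (hx : x ∈ D.piece)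
    {t : ℕ} (ht : t ≤ K) : pt ε x t ∈ D.box := by
  rw [mem_piece] at hx
  rw [mem_box]
  have : (t : ℝ) * ε ≤ K * ε := by gcongr
  have : 0 ≤ (t : ℝ) * ε := by positivity
  have := D.s_pos
  refine ⟨⟨?_, ?_⟩, hx.2⟩ <;> simp only [pt] <;> linarith

theorem tapeOk_iso {ε : ℝ} {K : ℕ} {G : Set Plane} (hε : 0 ≤ ε) (hK : K * ε ≤ D.s)
    (hG : G ⊆ D.piece) : TapeOk D ε K (iso ε K G) where
  mem_box x hx t ht := pt_mem_box hε hK (hG hx.1) ht.le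
  inj := by
    have key : ∀ x ∈ iso ε K G, ∀ y ∈ iso ε K G, ∀ t < K, ∀ u < K, pt ε x t = pt ε y u →
        ¬ t < u := by
      intro x hx y hy t ht u hu h htu
      refine (hx.2 y hy.1 (u - t - 1) (by omega)).1 ?_
      rw [show u - t - 1 + 1 = u - t by omega, ← pt_sub y htu.le, ← h, pt_sub x le_rfl]
      simp [pt]
    intro x hx y hy t ht u hu h
    have := key x hx y hy t ht u hu h
    have := key y hy x hx u hu t ht h.symm
    omega

theorem rreach_iso (hD : D.Fits) {ε : ℝ} {n : ℕ} {X A E T Z Y G O : Set Plane} (hε : 0 ≤ ε)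
    (hK : (2 ^ n : ℕ) * ε ≤ D.s) (hG : G ⊆ D.piece) : ∃ T' Y', D.RReach (n + 10)
      (st X A E T Z Y G O) (st (iso ε (2 ^ n) G) A E T' Z Y' G O) := by
  have hGb := hG.trans D.piece_subset_box
  have h1 := (rreach_zero hD (st X A E T Z Y G O) 3).trans (rreach_or hD _ 3 6 0)
  simp only [st_6, st_3, update_st_3, sh_zero hGb, Set.empty_union] at h1
  have h2 := h1.trans (rreach_spread hD _ 3 ε n fun x hx t ht => by
    simp only [st_3] at hx
    exact pt_mem_box hε hK (hG hx) ht.le)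
  have h3 := ((h2.trans (rreach_zero hD _ 0)).trans (rreach_or hD _ 0 6 0)).trans
    ((rreach_zero hD _ 5).trans (rreach_or hD _ 5 3 (ε, 0)))
  have h4 := h3.trans ((rreach_diff hD _ 0 5 (by decide)).trans ((rreach_zero hD _ 5).trans
    (rreach_or hD _ 5 3 (-((2 ^ n : ℕ) * ε), 0))))
  have h5 := h4.trans (rreach_diff hD _ 0 5 (by decide))
  simp only [st_0, st_6, st_3, st_5, update_st_0, update_st_5, update_st_3, sh_zero hGb,
    Set.empty_union] at h5
  have e : (G \ D.sh (ε, 0) (spread ε n G)) \ D.sh (-((2 ^ n : ℕ) * ε), 0) (spread ε n G) =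
      iso ε (2 ^ n) G := by
    ext x
    rw [Set.mem_sdiff, Set.mem_sdiff, mem_sh, mem_sh, and_assoc]
    refine and_congr_right fun hx => ?_
    constructor
    · rintro ⟨n1, n2⟩ y hy t ht
      constructor
      · rintro rfl
        have e := pt_add (ε := ε) y t 1
        rw [Nat.cast_one, one_mul] at e
        rw [e] at n1
        exact n1 ⟨pt_mem_box hε hK (hG hy) ht.le, y, hy, t, ht, rfl⟩
      · rintro rfl
        have e : x - (-((2 ^ n : ℕ) * ε), 0) = pt ε (pt ε x (t + 1)) (2 ^ n - 1 - t) := by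
          have : ((2 ^ n - 1 - t : ℕ) : ℝ) = (2 ^ n : ℕ) - 1 - t := by
            rw [Nat.cast_sub (by omega), Nat.cast_sub (by omega)]; simp
          ext
          · simp only [pt, this, Prod.fst_sub]; push_cast; ring
          · simp [pt]
        rw [e] at n2
        exact n2 ⟨pt_mem_box hε hK (hG hy) (by omega), _, hy, _, by omega, rfl⟩
    · intro h
      constructor
      · rintro ⟨-, y, hy, t, ht, he⟩
        refine (h y hy t ht).1 ?_
        have e := pt_add (ε := ε) y t 1
        rw [Nat.cast_one, one_mul, ← he] at e
        exact (sub_left_injective e).symm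
      · rintro ⟨-, y, hy, t, ht, he⟩
        refine (h y hy (2 ^ n - 1 - t) (by omega)).2 ?_
        have : ((2 ^ n - 1 - t : ℕ) : ℝ) = (2 ^ n : ℕ) - 1 - t := by
          rw [Nat.cast_sub (by omega), Nat.cast_sub (by omega)]; simp
        have e1 := congrArg Prod.fst he
        have e2 := congrArg Prod.snd he
        simp only [pt, Prod.fst_sub, Prod.snd_sub, sub_zero] at e1 e2
        ext
        · simp only [pt]
          push_cast [this] at e1 ⊢
          linarith
        · exact e2.symm
  rw [e] at h5
  exact ⟨_, _, h5.mono (by omega)⟩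

/-! ### Evaluating a quadratic form on a piece -/

variable (D) in
/-- The points of the piece at horizontal distance less than `w` from one of the lines. -/
def strips (N : ℕ) (H : ℕ → Ln) (w : ℝ) : Set Plane :=
  {x | x ∈ D.piece ∧ ∃ i < N, |(H i).ev x| < w * |(H i).1|}

theorem strips_subset (N : ℕ) (H : ℕ → Ln) (w : ℝ) : D.strips N H w ⊆ D.piece := fun _ h => h.1

theorem rreach_strips (hD : D.Fits) (ρ : Fin 8 → Set Plane) (a : Fin 8) (N : ℕ) (H : ℕ → Ln)
    (w : ℝ) : D.RReach N ρ (Function.update ρ a (ρ a ∪ D.strips N H w)) := by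
  induction N with
  | zero => simpa [strips] using RReach.refl ρ
  | succ N ih =>
    have e : D.strips (N + 1) H w =
        D.strips N H w ∪ {x | x ∈ D.piece ∧ |(H N).ev x| < w * |(H N).1|} := by
      ext x
      constructor
      · rintro ⟨hx, i, hi, h⟩
        rcases Nat.lt_succ_iff_lt_or_eq.1 hi with h' | rfl
        · exact Or.inl ⟨hx, i, h', h⟩
        · exact Or.inr ⟨hx, h⟩
      · rintro (⟨hx, i, hi, h⟩ | ⟨hx, h⟩)
        · exact ⟨hx, i, by omega, h⟩
        · exact ⟨hx, N, by omega, h⟩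
    by_cases h0 : (H N).1 = 0
    · have : {x | x ∈ D.piece ∧ |(H N).ev x| < w * |(H N).1|} = ∅ := by
        ext x
        change _ ∧ _ ↔ False
        rw [h0, abs_zero, mul_zero]
        exact ⟨fun h => absurd h.2 (abs_nonneg _).not_gt, False.elim⟩
      rw [e, this, Set.union_empty]
      exact ih.mono (by omega)
    · set l := H N
      have h1 := ih.trans (rreach_const hD _ a true
        (L := (l.1, l.2.1, l.2.2 + w * |l.1|) :: (-l.1, -l.2.1, -l.2.2 + w * |l.1|) ::
          rectLines D.px (D.px + D.s) D.py (D.py + D.s)) ?_ (by simp [rectLines]))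
      swap
      · intro l' hl'
        rw [List.mem_cons, List.mem_cons] at hl'
        rcases hl' with rfl | rfl | hl'
        · exact Or.inl h0
        · exact Or.inl (neg_ne_zero.2 h0)
        · exact nondeg_rectLines _ _ _ _ l' hl'
      rw [litAdd, if_pos rfl, Function.update_self, Function.update_idem, Set.union_assoc] at h1
      convert h1 using 3
      rw [e]
      congr 1
      ext x
      change _ ↔ ∀ l' ∈ _, _
      rw [List.forall_mem_cons, List.forall_mem_cons]
      change x ∈ D.piece ∧ _ ↔ _ ∧ _ ∧ x ∈ D.piece
      have e1 : Ln.ev (l.1, l.2.1, l.2.2 + w * |l.1|) x = l.ev x + w * |l.1| := by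
        simp only [Ln.ev]; ring
      have e2 : Ln.ev (-l.1, -l.2.1, -l.2.2 + w * |l.1|) x = - l.ev x + w * |l.1| := by
        simp only [Ln.ev]; ring
      rw [e1, e2, abs_lt]
      constructor
      · rintro ⟨hx, h2, h3⟩; exact ⟨by linarith, by linarith, hx⟩
      · rintro ⟨h2, h3, hx⟩; exact ⟨hx, by linarith, by linarith⟩

theorem exists_shift_of_not_iso {ε : ℝ} {K : ℕ} {G : Set Plane} {x : Plane} (hx : x ∈ G)
    (h : x ∉ iso ε K G) : ∃ k : Fin K × Bool,
      (x.1 + (if k.2 then ((k.1 : ℕ) : ℝ) + 1 else -(((k.1 : ℕ) : ℝ) + 1)) * ε, x.2) ∈ G := by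
  have : ∃ y ∈ G, ∃ t < K, x = pt ε y (t + 1) ∨ y = pt ε x (t + 1) := by
    by_contra! hc
    exact h ⟨hx, hc⟩
  obtain ⟨y, hy, t, ht, rfl | rfl⟩ := this
  · refine ⟨(⟨t, ht⟩, false), ?_⟩
    convert hy using 1
    ext
    · simp [pt]; ring
    · simp [pt]
  · refine ⟨(⟨t, ht⟩, true), ?_⟩
    convert hy using 1
    ext
    · simp [pt]
    · simp [pt]

theorem abs_sub_root_lt {l : Ln} {x : Plane} {w : ℝ} (h : |l.ev x| < w * |l.1|) :
    |x.1 - (-l.2.1 / l.1 * x.2 + -l.2.2 / l.1)| < w := by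
  have h0 : l.1 ≠ 0 := by
    intro h0
    rw [h0, abs_zero, mul_zero] at h
    exact (abs_nonneg _).not_gt h
  have e : l.ev x = (x.1 - (-l.2.1 / l.1 * x.2 + -l.2.2 / l.1)) * l.1 := by
    simp only [Ln.ev]; field_simp; ring
  rw [e, abs_mul] at h
  exact lt_of_mul_lt_mul_right h (abs_nonneg _)

theorem exists_iso_cover (N : ℕ) (H : ℕ → Ln) {w : ℝ} (hw : 2 ^ (9 * N + 14) * w ≤ D.s) :
    ∃ ε ε' : ℝ, (0 ≤ ε ∧ (2 ^ (2 * N + 2) : ℕ) * ε ≤ D.s) ∧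
      (0 ≤ ε' ∧ (2 ^ (2 * N + 2) : ℕ) * ε' ≤ D.s) ∧
      D.strips N H w ⊆ iso ε (2 ^ (2 * N + 2)) (D.strips N H w) ∪
        iso ε' (2 ^ (2 * N + 2)) (D.strips N H w) := by
  set K := 2 ^ (2 * N + 2) with hK
  have hs := D.s_pos
  set M := 2 ^ (7 * N + 8) with hM
  have hMpos : (0 : ℝ) < M := by positivity
  have hKpos : (0 : ℝ) < K := by positivity
  set e : ℕ → ℝ := fun m => D.s / (2 * K) * (1 + m / M) with he
  have he0 : ∀ m, 0 ≤ e m := fun m => by positivity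
  have heK : ∀ m < M, K * e m ≤ D.s := by
    intro m hm
    have : (m : ℝ) / M ≤ 1 := by
      rw [div_le_one hMpos]
      exact_mod_cast hm.le
    have e1 : K * e m = D.s * ((1 + m / M) / 2) := by simp only [he]; field_simp
    rw [e1]
    nlinarith
  set κ : Fin K × Bool → ℝ := fun k => if k.2 then ((k.1 : ℕ) : ℝ) + 1 else -(((k.1 : ℕ) : ℝ) + 1)
    with hκ
  obtain ⟨m, n, hm, hn, h⟩ := exists_steps (N := N) (M := M)
    (fun i => -(H i).2.1 / (H i).1) (fun i => -(H i).2.2 / (H i).1) κ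
    (fun k => by
      have : (0 : ℝ) ≤ (k.1 : ℕ) := by positivity
      simp only [hκ]
      split_ifs
      · rw [abs_of_nonneg] <;> linarith
      · rw [abs_neg, abs_of_nonneg] <;> linarith) (w := w) e
    (fun m n hmn => by
      have e1 : e m - e n = D.s / (2 * K * M) * (m - n) := by simp only [he]; field_simp; ring
      have h1 : (1 : ℝ) ≤ |(m : ℝ) - n| := by
        have : (m : ℤ) - n ≠ 0 := sub_ne_zero.2 (by exact_mod_cast hmn)
        exact_mod_cast Int.one_le_abs this
      rw [e1, abs_mul, abs_of_nonneg (by positivity)]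
      have h2 : 8 * w ≤ D.s / (2 * K * M) := by
        rw [le_div_iff₀ (by positivity)]
        have : (2 : ℝ) * K * M * 8 = 2 ^ (9 * N + 14) := by
          rw [hK, hM]; push_cast; ring
        calc _ = (2 : ℝ) * K * M * 8 * w := by ring
          _ ≤ D.s := by rw [this]; exact hw
      have : 0 ≤ D.s / (2 * K * M) := by positivity
      nlinarith)
    (by
      have h1 : N ^ 3 ≤ (2 ^ N) ^ 3 := Nat.pow_le_pow_left Nat.lt_two_pow_self.le 3
      have h2 : Fintype.card (Fin K × Bool) = 2 ^ (2 * N + 3) := by simp [hK]; ring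
      rw [h2, hM]
      calc N ^ 3 * (2 ^ (2 * N + 3)) ^ 2 ≤ (2 ^ N) ^ 3 * (2 ^ (2 * N + 3)) ^ 2 :=
            Nat.mul_le_mul_right _ h1
        _ = 2 ^ (7 * N + 6) := by ring
        _ < _ := Nat.pow_lt_pow_right (by norm_num) (by omega))
  refine ⟨e m, e n, ⟨he0 m, heK m hm⟩, ⟨he0 n, heK n hn⟩, fun x hx => ?_⟩
  by_contra hc
  rw [Set.mem_union, not_or] at hc
  obtain ⟨k, -, i, hi, h1⟩ := exists_shift_of_not_iso hx hc.1
  obtain ⟨k', -, i', hi', h2⟩ := exists_shift_of_not_iso hx hc.2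
  obtain ⟨-, j, hj, h3⟩ := hx
  have h1 := abs_sub_root_lt h1
  have h2 := abs_sub_root_lt h2
  have h3 := abs_sub_root_lt h3
  change |x.1 + κ k * e m - _| < w at h1
  change |x.1 + κ k' * e n - _| < w at h2
  have key : ∀ a b c : ℝ, |x.1 + a - b| < w → |x.1 - c| < w → |a - (b - c)| < 2 * w := by
    intro a b c ha hc
    have : a - (b - c) = (x.1 + a - b) - (x.1 - c) := by ring
    rw [this]
    exact (abs_sub _ _).trans_lt (by linarith)
  exact h ⟨j, hj⟩ ⟨i, hi⟩ ⟨i', hi'⟩ k k' x.2 (key _ _ _ h1 h3) (key _ _ _ h2 h3)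

theorem rreach_collect_iso (hD : D.Fits) (N : ℕ) (H : ℕ → Ln) (C : ℕ → ℕ → Bool) {ε : ℝ}
    {X A E T Z Y G O : Set Plane} (hε : 0 ≤ ε) (hK : (2 ^ (2 * N + 2) : ℕ) * ε ≤ D.s)
    (hG : G ⊆ D.piece) : ∃ X' A' E' T' Z' Y', D.RReach (29 * N + 17) (st X A E T Z Y G O)
      (st X' A' E' T' Z' Y' G (O ∪ {x | x ∈ iso ε (2 ^ (2 * N + 2)) G ∧ pform N H C x})) := by
  obtain ⟨T₁, Y₁, h1⟩ := rreach_iso hD (X := X) (A := A) (E := E) (T := T) (Z := Z) (Y := Y)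
    (O := O) hε hK hG
  have hX := tapeOk_iso hε hK hG
  have e4 : 4 * (2 ^ N * 2 ^ N) = 2 ^ (2 * N + 2) := by ring
  obtain ⟨A', E', T', Y', h2⟩ := rreach_routine hD (A := A) (E := E) (T := T₁) (Z := Z) (Y := Y₁)
    (G := G) (O := O) H C (X := iso ε (2 ^ (2 * N + 2)) G) (by rw [e4]; exact hX)
  have h3 := (h1.trans h2).trans (rreach_or hD _ 7 4 0)
  simp only [st_7, st_4, update_st_7] at h3
  rw [sh_zero fun x hx => D.piece_subset_box (hG hx.1.1)] at h3
  exact ⟨_, _, _, _, _, _, h3.mono (by omega)⟩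

variable (D) in
/-- A half-open cell of width `d` starting at abscissa `b`. -/
def tooth (b d : ℝ) : Set Plane :=
  {x | (b ≤ x.1 ∧ x.1 < b + d) ∧ D.py < x.2 ∧ x.2 < D.py + D.s}

theorem rreach_tooth (hD : D.Fits) (ρ : Fin 8 → Set Plane) (a : Fin 8) (b : ℝ) {d : ℝ}
    (hd : 0 < d) : D.RReach 3 ρ (Function.update ρ a (D.tooth b d)) := by
  have h1 := (rreach_zero hD ρ a).trans (rreach_const hD _ a true
    (L := rectLines (b - d) (b + d) D.py (D.py + D.s)) (nondeg_rectLines _ _ _ _)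
    (by simp [rectLines]))
  have h2 := h1.trans (rreach_const hD _ a false (L := [(-1, 0, b)])
    (by simp [Ln.Nondeg]) (by simp))
  simp only [litAdd, if_true, Function.update_self, Function.update_idem, Set.empty_union] at h2
  convert h2 using 2
  ext x
  rw [if_neg (by simp), Set.mem_sdiff, mem_rectLines]
  have : x ∈ PolyCell [(-1, 0, b)] ↔ x.1 < b := by
    simp [mem_polyCell, Ln.ev]
  rw [this, not_lt]
  change (_ ∧ _) ∧ _ ↔ _
  constructor
  · rintro ⟨⟨k1, k2⟩, k3⟩; exact ⟨⟨⟨by linarith, k2⟩, k3⟩, k1⟩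
  · rintro ⟨⟨⟨-, k2⟩, k3⟩, k1⟩; exact ⟨⟨k1, k2⟩, k3⟩

/-- Positions along a comb of teeth are determined by the period index. -/
theorem comb_index {b d w a u v : ℝ} {K m t m' t' : ℕ} (hd : 0 < d) (hw : w = K * d)
    (hu : b ≤ u) (hu' : u < b + d) (hv : b ≤ v) (hv' : v < b + d) (ht : t < K) (ht' : t' < K)
    (h : u + m * w + t * d = a) (h' : v + m' * w + t' * d = a) : t = t' := by
  have e : (u - v) = ((m' * K + t' : ℕ) - (m * K + t : ℕ) : ℝ) * d := by
    push_cast; rw [hw] at h h'; linarith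
  have hlt : |u - v| < d := by rw [abs_lt]; constructor <;> linarith
  rw [e, abs_mul, abs_of_pos hd] at hlt
  have h1 : |((m' * K + t' : ℕ) - (m * K + t : ℕ) : ℝ)| < 1 := by
    by_contra! hc
    nlinarith
  have h2 : ((m' * K + t' : ℕ) : ℤ) - (m * K + t : ℕ) = 0 := by
    rw [← Int.abs_lt_one_iff]
    exact_mod_cast h1
  have h3 : m' * K + t' = m * K + t := by omega
  have h4 := congrArg (· % K) h3
  simp only [Nat.mod_eq_of_lt ht, Nat.mod_eq_of_lt ht',
    Nat.mul_add_mod_self_right] at h4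
  exact h4.symm

theorem comb_mem {x : Plane} {b d w : ℝ} {K L : ℕ} (hd : 0 < d) (hw : w = K * d)
    (hL : (2 ^ L : ℕ) * w = D.s + w) (hx : x ∈ D.piece) (hb : b = D.px - w) (hK : 0 < K) :
    ∃ y ∈ spread w L (D.tooth b d), ∃ t < K, x = pt d y t := by
  rw [mem_piece] at hx
  have hx0 : 0 ≤ (x.1 - b) / d := by
    have : (0 : ℝ) < K := by exact_mod_cast hK
    have : 0 < w := by rw [hw]; positivity
    exact div_nonneg (by linarith) hd.le
  set q := ⌊(x.1 - b) / d⌋₊ with hq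
  have h1 : (q : ℝ) * d ≤ x.1 - b := by
    rw [← le_div_iff₀ hd]; exact Nat.floor_le hx0
  have h2 : x.1 - b < (q + 1) * d := by
    rw [← div_lt_iff₀ hd]; exact Nat.lt_floor_add_one _
  have hqe : (q : ℝ) = K * (q / K : ℕ) + (q % K : ℕ) := by
    exact_mod_cast (Nat.div_add_mod q K).symm
  set m := q / K
  set t := q % K
  have ht : t < K := Nat.mod_lt _ hK
  have hm : m < 2 ^ L := by
    have h3 : (m : ℝ) * w < (2 ^ L : ℕ) * w := by
      have : (0 : ℝ) ≤ t * d := by positivity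
      have e : (m : ℝ) * w = q * d - t * d := by rw [hqe, hw]; ring
      rw [hL, e]
      linarith
    have hw0 : 0 < w := by
      have : (0 : ℝ) < K := by exact_mod_cast hK
      rw [hw]; positivity
    exact_mod_cast lt_of_mul_lt_mul_right h3 hw0.le
  have e : (q : ℝ) * d = m * w + t * d := by rw [hqe, hw]; ring
  refine ⟨(x.1 - t * d, x.2), ⟨(x.1 - t * d - m * w, x.2), ⟨⟨?_, ?_⟩, hx.2⟩, m, hm, ?_⟩, t, ht, ?_⟩
  · change b ≤ x.1 - t * d - m * w; linarith
  · change x.1 - t * d - m * w < b + d; linarith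
  · simp [pt]
  · simp [pt]

theorem tapeOk_comb {b d w : ℝ} {K L : ℕ} (hd : 0 < d) (hw : w = K * d)
    (hL : (2 ^ L : ℕ) * w = D.s + w) (hws : w < D.s) (hb : b = D.px - w) :
    TapeOk D d K (spread w L (D.tooth b d)) where
  mem_box := by
    rintro x ⟨y, hy, m, hm, rfl⟩ t ht
    have hw0 : 0 ≤ w := by rw [hw]; positivity
    have h1 : ((m : ℝ) + 1) * w ≤ (2 ^ L : ℕ) * w := by
      refine mul_le_mul_of_nonneg_right ?_ hw0
      exact_mod_cast hm
    have h2 : ((t : ℝ) + 1) * d ≤ w := by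
      rw [hw]
      refine mul_le_mul_of_nonneg_right ?_ hd.le
      exact_mod_cast ht
    have h3 : 0 ≤ (m : ℝ) * w := by positivity
    have h4 : 0 ≤ (t : ℝ) * d := by positivity
    obtain ⟨⟨k1, k2⟩, k3⟩ := hy
    have := D.s_pos
    rw [mem_box]
    refine ⟨⟨?_, ?_⟩, k3⟩ <;> simp only [pt] <;> linarith
  inj := by
    rintro x ⟨y, hy, m, hm, rfl⟩ x' ⟨y', hy', m', hm', rfl⟩ t ht u hu h
    exact comb_index hd hw hy.1.1 hy.1.2 hy'.1.1 hy'.1.2 ht hu rfl (congrArg Prod.fst h).symm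

theorem ev_pos_iff_of_not_strips {N : ℕ} {H : ℕ → Ln} {w : ℝ} {x y : Plane} (hx : x ∈ D.piece)
    (hs : x ∉ D.strips N H w) (h2 : y.2 = x.2) (h1 : y.1 ≤ x.1) (hw : x.1 - y.1 < w) {i : ℕ}
    (hi : i < N) : 0 < (H i).ev y ↔ 0 < (H i).ev x := by
  have hx' : w * |(H i).1| ≤ |(H i).ev x| := by
    by_contra! hc
    exact hs ⟨hx, i, hi, hc⟩
  have e : (H i).ev y = (H i).ev x - (H i).1 * (x.1 - y.1) := by
    simp only [Ln.ev, h2]; ring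
  by_cases h0 : (H i).1 = 0
  · rw [e, h0]; simp
  · have hlt : |(H i).1 * (x.1 - y.1)| < |(H i).ev x| := by
      rw [abs_mul, abs_of_nonneg (sub_nonneg.2 h1)]
      have := abs_pos.2 h0
      nlinarith
    rw [e]
    rcases abs_cases ((H i).ev x) with ⟨k1, k2⟩ | ⟨k1, k2⟩ <;> rw [k1, abs_lt] at hlt <;>
      constructor <;> intro <;> linarith [hlt.1, hlt.2]

theorem pform_congr {N : ℕ} {H : ℕ → Ln} {C : ℕ → ℕ → Bool} {x y : Plane}
    (h : ∀ i < N, (0 < (H i).ev x ↔ 0 < (H i).ev y)) : pform N H C x ↔ pform N H C y :=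
  par_congr fun i hi => by rw [h i hi, par_congr fun m hm => by rw [h m hm]]

/-- Any quadratic form in `N` half-plane indicators can be written into the last register in
linear time. -/
theorem exists_rreach_pform (hD : D.Fits) (N : ℕ) (H : ℕ → Ln) (C : ℕ → ℕ → Bool) :
    ∃ ρ : Fin 8 → Set Plane, D.RReach (97 * N + 62) (fun _ => ∅) ρ ∧
      ∀ x ∈ D.piece, (x ∈ ρ 7 ↔ pform N H C x) := by
  have hs := D.s_pos
  set L := 9 * N + 15 with hL
  set K := 2 ^ (2 * N + 2) with hK
  have hKpos : (0 : ℝ) < K := by positivity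
  have h2L : (2 : ℝ) ≤ 2 ^ (9 * N + 14) := by
    calc (2 : ℝ) = 2 ^ 1 := by norm_num
      _ ≤ _ := pow_le_pow_right₀ (by norm_num) (by omega)
  have h2L' : (2 : ℝ) ^ L = 2 * 2 ^ (9 * N + 14) := by rw [hL]; ring
  have hden : (0 : ℝ) < 2 ^ L - 1 := by linarith
  set w := D.s / (2 ^ L - 1) with hwdef
  have hws : (2 ^ L : ℕ) * w = D.s + w := by
    rw [hwdef]; push_cast; field_simp; ring
  have hw0 : 0 < w := by positivity
  have hw14 : 2 ^ (9 * N + 14) * w ≤ D.s := by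
    push_cast at hws; rw [h2L'] at hws; nlinarith
  have hwlt : w < D.s := by nlinarith
  set d := w / K with hd
  have hd0 : 0 < d := by positivity
  have hwK : w = K * d := by rw [hd]; field_simp
  set F := D.strips N H w with hF
  have hFp : F ⊆ D.piece := strips_subset N H w
  have hst : (fun _ : Fin 8 => (∅ : Set Plane)) = st ∅ ∅ ∅ ∅ ∅ ∅ ∅ ∅ := by
    funext i; fin_cases i <;> rfl
  have h1 := rreach_strips hD (st ∅ ∅ ∅ ∅ ∅ ∅ ∅ ∅) 6 N H w
  rw [st_6, update_st_6, Set.empty_union, ← hF] at h1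
  obtain ⟨ε, ε', ⟨hε, hεK⟩, ⟨hε', hεK'⟩, hcov⟩ := exists_iso_cover N H hw14
  obtain ⟨X₁, A₁, E₁, T₁, Z₁, Y₁, h2⟩ := rreach_collect_iso hD N H C (X := ∅) (A := ∅) (E := ∅)
    (T := ∅) (Z := ∅) (Y := ∅) (O := ∅) hε hεK hFp
  obtain ⟨X₂, A₂, E₂, T₂, Z₂, Y₂, h3⟩ := rreach_collect_iso hD N H C (X := X₁) (A := A₁) (E := E₁)
    (T := T₁) (Z := Z₁) (Y := Y₁) (O := ∅ ∪ {x | x ∈ iso ε (2 ^ (2 * N + 2)) F ∧ pform N H C x})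
    hε' hεK' hFp
  rw [Set.empty_union, ← hK] at h2 h3
  have h4 := ((h1.trans (h2.trans h3)).trans
    (rreach_tooth hD _ 0 (D.px - w) hd0))
  have hX : TapeOk D d K (spread w L (D.tooth (D.px - w) d)) := tapeOk_comb hd0 hwK hws hwlt rfl
  have h5 := h4.trans (rreach_spread hD _ 0 w L fun x hx t ht => by
    rw [update_st_0, st_0] at hx
    have := hX.mem_box _ ⟨x, hx, t, ht, rfl⟩ 0 (by positivity)
    simpa [pt] using this)
  simp only [update_st_0, st_0] at h5
  have e4 : 4 * (2 ^ N * 2 ^ N) = K := by rw [hK]; ring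
  obtain ⟨A₃, E₃, T₃, Y₃, h6⟩ := rreach_routine hD (A := A₂) (E := E₂) (T := T₂) (Z := Z₂) (Y := Y₂)
    (G := F) (O := {x | x ∈ iso ε K F ∧ pform N H C x} ∪ {x | x ∈ iso ε' K F ∧ pform N H C x})
    H C (e4 ▸ hX)
  have h7 := (h5.trans h6).trans (rreach_spread hD _ 4 d (2 * N + 2) fun x hx t ht =>
    hX.mem_box x hx.1 t ht)
  have h8 := (h7.trans (rreach_diff hD _ 4 6 (by decide))).trans (rreach_or hD _ 7 4 0)
  simp only [st_4, st_6, st_7, update_st_4, update_st_7] at h8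
  rw [sh_zero (by
    rintro x ⟨⟨y, hy, t, ht, rfl⟩, -⟩
    exact hX.mem_box y hy.1 t ht)] at h8
  refine ⟨_, hst ▸ h8.mono (by omega), fun x hx => ?_⟩
  rw [st_7]
  constructor
  · rintro ((⟨-, h⟩ | ⟨-, h⟩) | ⟨⟨y, ⟨-, hy⟩, t, ht, rfl⟩, hxF⟩)
    · exact h
    · exact h
    · refine (pform_congr (H := H) fun i hi =>
        ev_pos_iff_of_not_strips (y := y) hx hxF rfl ?_ ?_ hi).1 hy
      · simp only [pt]; nlinarith
      · have : (t : ℝ) * d < w := by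
          rw [hwK]
          refine mul_lt_mul_of_pos_right ?_ hd0
          exact_mod_cast ht
        simp only [pt]; linarith
  · intro h
    by_cases hxF : x ∈ F
    · rcases hcov hxF with h' | h'
      · exact Or.inl (Or.inl ⟨h', h⟩)
      · exact Or.inl (Or.inr ⟨h', h⟩)
    · obtain ⟨y, hy, t, ht, rfl⟩ := comb_mem hd0 hwK hws hx rfl (by positivity)
      refine Or.inr ⟨⟨y, ⟨hy, ?_⟩, t, ht, rfl⟩, hxF⟩
      refine (pform_congr (H := H) fun i hi =>
        ev_pos_iff_of_not_strips (y := y) hx hxF rfl ?_ ?_ hi).2 h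
      · simp only [pt]; nlinarith
      · have : (t : ℝ) * d < w := by
          rw [hwK]
          refine mul_lt_mul_of_pos_right ?_ hd0
          exact_mod_cast ht
        simp only [pt]; linarith

end Layout

/-! ### Sign-determined functions are quadratic forms -/

open Classical in
/-- The indicator of a proposition, as an element of `𝔽₂`. -/
noncomputable def ind (p : Prop) : ZMod 2 := if p then 1 else 0

theorem ind_true {p : Prop} (h : p) : ind p = 1 := if_pos h
theorem ind_false {p : Prop} (h : ¬ p) : ind p = 0 := if_neg h
theorem ind_congr {p q : Prop} (h : p ↔ q) : ind p = ind q := by rw [propext h]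

theorem ind_eq_one {p : Prop} : ind p = 1 ↔ p := by
  by_cases h : p
  · exact iff_of_true (ind_true h) h
  · exact iff_of_false (by rw [ind_false h]; exact zero_ne_one) h

theorem ind_inj {p q : Prop} (h : ind p = ind q) : p ↔ q := by
  rw [← ind_eq_one (p := p), h, ind_eq_one]

theorem ind_and (p q : Prop) : ind (p ∧ q) = ind p * ind q := by
  by_cases hp : p <;> by_cases hq : q <;> simp [ind, hp, hq]

theorem ind_xor (p q : Prop) : ind (Xor p q) = ind p + ind q := by
  by_cases hp : p <;> by_cases hq : q <;> simp [ind, hp, hq, Xor, CharTwo.add_self_eq_zero]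

theorem Layout.ind_par (n : ℕ) (p : ℕ → Prop) :
    ind (Layout.par n p) = ∑ i ∈ Finset.range n, ind (p i) := by
  induction n with
  | zero => simp [Layout.par, ind]
  | succ n ih => rw [Layout.par, ind_xor, ih, Finset.sum_range_succ]

theorem Ln.exists_crossing {l : Ln} {x y : Plane} (hx : l.ev x < 0) (hy : 0 < l.ev y) :
    ∃ z, l.ev z = 0 ∧ ∃ θ : ℝ, 0 < θ ∧ θ < 1 ∧
      ∀ l' : Ln, l'.ev z = (1 - θ) * l'.ev x + θ * l'.ev y := by
  set θ := -l.ev x / (l.ev y - l.ev x) with hθ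
  have hd : 0 < l.ev y - l.ev x := by linarith
  have key : ∀ l' : Ln, l'.ev ((1 - θ) * x.1 + θ * y.1, (1 - θ) * x.2 + θ * y.2) =
      (1 - θ) * l'.ev x + θ * l'.ev y := by
    intro l'; simp only [Ln.ev]; ring
  refine ⟨_, ?_, θ, div_pos (by linarith) hd, (div_lt_one hd).2 (by linarith), key⟩
  rw [key, hθ]
  field_simp
  ring

/-- Two nonparallel lines meet in at most one point. -/
theorem Ln.eq_of_crossing {l m : Ln} (hl : l.Nondeg) {x y z z' : Plane} (hx : l.ev x = 0)
    (hy : l.ev y = 0) (hz : l.ev z = 0) (hz' : l.ev z' = 0) (hxy : m.ev x < m.ev y)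
    (h : m.ev z = 0) (h' : m.ev z' = 0) : z = z' := by
  obtain ⟨a, b, c⟩ := l
  obtain ⟨a', b', c'⟩ := m
  simp only [Ln.ev, Ln.Nondeg] at *
  have hd : a * (z.1 - z'.1) + b * (z.2 - z'.2) = 0 := by linarith
  have he : a * (y.1 - x.1) + b * (y.2 - x.2) = 0 := by linarith
  have hd' : a' * (z.1 - z'.1) + b' * (z.2 - z'.2) = 0 := by linarith
  have he' : a' * (y.1 - x.1) + b' * (y.2 - x.2) ≠ 0 := by
    intro hc; linarith
  set dx := z.1 - z'.1
  set dy := z.2 - z'.2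
  set ex := y.1 - x.1
  set ey := y.2 - x.2
  have hcr : ex * dy = ey * dx := by
    rcases hl with ha | hb
    · apply mul_left_cancel₀ ha; linear_combination dy * he - ey * hd
    · apply mul_left_cancel₀ hb; linear_combination ex * hd - dx * he
  have h1 : dx = 0 := by
    refine (mul_eq_zero.1 (?_ : (a' * ex + b' * ey) * dx = 0)).resolve_left he'
    linear_combination ex * hd' - b' * hcr
  have h2 : dy = 0 := by
    refine (mul_eq_zero.1 (?_ : (a' * ex + b' * ey) * dy = 0)).resolve_left he'
    linear_combination ey * hd' + a' * hcr
  ext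
  · exact sub_eq_zero.1 h1
  · exact sub_eq_zero.1 h2

/-- The points `x` and `y` lie on the same sides of the first `n` lines. -/
def SameSigns (H : ℕ → Ln) (n : ℕ) (x y : Plane) : Prop :=
  ∀ i < n, (0 < (H i).ev x ↔ 0 < (H i).ev y)

theorem SameSigns.symm {H : ℕ → Ln} {n : ℕ} {x y : Plane} (h : SameSigns H n x y) :
    SameSigns H n y x := fun i hi => (h i hi).symm

theorem SameSigns.trans {H : ℕ → Ln} {n : ℕ} {x y z : Plane} (h : SameSigns H n x y)
    (h' : SameSigns H n y z) : SameSigns H n x z := fun i hi => (h i hi).trans (h' i hi)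

theorem SameSigns.succ {H : ℕ → Ln} {n : ℕ} {x y : Plane} (h : SameSigns H n x y)
    (h' : 0 < (H n).ev x ↔ 0 < (H n).ev y) : SameSigns H (n + 1) x y := by
  intro i hi
  rcases Nat.lt_succ_iff_lt_or_eq.1 hi with hi | rfl
  · exact h i hi
  · exact h'

/-- A function determined by the sides of the lines. -/
def SignDet (H : ℕ → Ln) (n : ℕ) (A : Set Plane) (g : Plane → ZMod 2) : Prop :=
  ∀ x ∈ A, ∀ y ∈ A, SameSigns H n x y → g x = g y

theorem exists_crossing_sameSigns {H : ℕ → Ln} {n : ℕ} {l : Ln} {x y : Plane} (hx : l.ev x < 0)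
    (hy : 0 < l.ev y) (hxy : SameSigns H n x y) (gx : ∀ i < n, (H i).ev x ≠ 0)
    (gy : ∀ i < n, (H i).ev y ≠ 0) : ∃ z, l.ev z = 0 ∧ SameSigns H n x z ∧
      (∀ i < n, (H i).ev z ≠ 0) ∧ ∀ m : Ln, m.ev x = 0 → m.ev y = 0 → m.ev z = 0 := by
  obtain ⟨z, hz, θ, h0, h1, h⟩ := Ln.exists_crossing hx hy
  have key : ∀ i < n, (0 < (H i).ev x ∧ 0 < (H i).ev z) ∨ ((H i).ev x < 0 ∧ (H i).ev z < 0) := by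
    intro i hi
    rw [h (H i)]
    rcases lt_or_gt_of_ne (gx i hi) with k | k
    · have k' : (H i).ev y < 0 :=
        lt_of_le_of_ne (not_lt.1 fun hc => k.not_gt ((hxy i hi).2 hc)) (gy i hi)
      right; constructor <;> nlinarith
    · have k' := (hxy i hi).1 k
      left; constructor <;> nlinarith
  refine ⟨z, hz, fun i hi => ?_, fun i hi => ?_, fun m hx hy => ?_⟩
  · rcases key i hi with k | k
    · exact iff_of_true k.1 k.2
    · exact iff_of_false k.1.not_gt k.2.not_gt
  · rcases key i hi with k | k
    · exact k.2.ne'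
    · exact k.2.ne
  · rw [h, hx, hy]; ring

theorem signDet_of_correction {H : ℕ → Ln} {n : ℕ} {A : Set Plane} {g δ : Plane → ZMod 2}
    (gen : ∀ x ∈ A, (H n).ev x ≠ 0) (hg : SignDet H (n + 1) A g)
    (hδ : ∀ x y, SameSigns H n x y → δ x = δ y)
    (hc : ∀ x ∈ A, ∀ y ∈ A, SameSigns H n x y → (H n).ev x < 0 → 0 < (H n).ev y →
      δ x = g x + g y) : SignDet H n A fun x => g x + ind (0 < (H n).ev x) * δ x := by
  have key : ∀ x ∈ A, ∀ y ∈ A, SameSigns H n x y → (H n).ev x < 0 → 0 < (H n).ev y →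
      g x + ind (0 < (H n).ev x) * δ x = g y + ind (0 < (H n).ev y) * δ y := by
    intro x hx y hy hxy kx ky
    rw [ind_false kx.not_gt, ind_true ky, ← hδ x y hxy, hc x hx y hy hxy kx ky]
    have := CharTwo.add_self_eq_zero (g y)
    linear_combination -this
  intro x hx y hy hxy
  rcases lt_or_gt_of_ne (gen x hx) with kx | kx <;> rcases lt_or_gt_of_ne (gen y hy) with ky | ky
  · have e := hg x hx y hy (hxy.succ (iff_of_false kx.not_gt ky.not_gt))
    simp only [e, ind_false kx.not_gt, ind_false ky.not_gt, zero_mul]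
  · exact key x hx y hy hxy kx ky
  · exact (key y hy x hx hxy.symm ky kx).symm
  · have e := hg x hx y hy (hxy.succ (iff_of_true kx ky))
    simp only [e, ind_true kx, ind_true ky, hδ x y hxy]

theorem SignDet.exists_linear {H : ℕ → Ln} {l : Ln} (hl : l.Nondeg) (n : ℕ) {A : Set Plane}
    (hA : ∀ x ∈ A, l.ev x = 0) (gen : ∀ x ∈ A, ∀ i < n + 1, (H i).ev x ≠ 0)
    (h0 : ∀ x ∈ A, 0 < (H 0).ev x) {g : Plane → ZMod 2} (hg : SignDet H (n + 1) A g) :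
    ∃ c : ℕ → ZMod 2, ∀ x ∈ A, g x = ∑ i ∈ Finset.range (n + 1), c i * ind (0 < (H i).ev x) := by
  classical
  induction n generalizing g with
  | zero =>
    rcases A.eq_empty_or_nonempty with rfl | ⟨a, ha⟩
    · simp
    · refine ⟨fun _ => g a, fun x hx => ?_⟩
      simp only [zero_add, Finset.range_one, Finset.sum_singleton, ind_true (h0 x hx), mul_one]
      refine hg x hx a ha fun i hi => ?_
      obtain rfl : i = 0 := by omega
      exact iff_of_true (h0 x hx) (h0 a ha)
  | succ n ih =>
    have gen' : ∀ x ∈ A, ∀ i < n + 1, (H i).ev x ≠ 0 := fun x hx i hi => gen x hx i (by omega)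
    obtain ⟨d, hd⟩ : ∃ d : ZMod 2, ∀ x ∈ A, ∀ y ∈ A, SameSigns H (n + 1) x y →
        (H (n + 1)).ev x < 0 → 0 < (H (n + 1)).ev y → d = g x + g y := by
      by_cases hc : ∃ x ∈ A, ∃ y ∈ A, SameSigns H (n + 1) x y ∧ (H (n + 1)).ev x < 0 ∧
        0 < (H (n + 1)).ev y
      · obtain ⟨x, hx, y, hy, hxy, kx, ky⟩ := hc
        refine ⟨g x + g y, fun x' hx' y' hy' hxy' kx' ky' => ?_⟩
        obtain ⟨z, z1, z2, -, z3⟩ :=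
          exists_crossing_sameSigns kx ky hxy (gen' x hx) (gen' y hy)
        obtain ⟨z', z1', z2', -, z3'⟩ :=
          exists_crossing_sameSigns kx' ky' hxy' (gen' x' hx') (gen' y' hy')
        obtain rfl : z = z' := Ln.eq_of_crossing hl (hA x hx) (hA y hy)
          (z3 l (hA x hx) (hA y hy)) (z3' l (hA x' hx') (hA y' hy')) (kx.trans ky) z1 z1'
        have e := z2.trans z2'.symm
        rw [hg x hx x' hx' (e.succ (iff_of_false kx.not_gt kx'.not_gt)),
          hg y hy y' hy' (((hxy.symm.trans e).trans hxy').succ (iff_of_true ky ky'))]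
      · exact ⟨0, fun x hx y hy hxy kx ky => (hc ⟨x, hx, y, hy, hxy, kx, ky⟩).elim⟩
    obtain ⟨c, hc⟩ := ih gen' (signDet_of_correction (δ := fun _ => d)
      (fun x hx => gen x hx _ (by omega)) hg (fun _ _ _ => rfl) hd)
    refine ⟨Function.update c (n + 1) d, fun x hx => ?_⟩
    rw [Finset.sum_range_succ, Function.update_self, Finset.sum_congr rfl fun i hi => by
      rw [Function.update_of_ne (by have := Finset.mem_range.1 hi; omega)], ← hc x hx]
    have := CharTwo.add_self_eq_zero (ind (0 < (H (n + 1)).ev x) * d)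
    linear_combination -this

theorem SignDet.exists_quadratic {H : ℕ → Ln} (n : ℕ)
    (hH : ∀ i, 0 < i → i < n + 1 → (H i).Nondeg) {A : Set Plane}
    (gen : ∀ x ∈ A, ∀ i < n + 1, (H i).ev x ≠ 0)
    (h0 : ∀ x ∈ A, 0 < (H 0).ev x) {g : Plane → ZMod 2} (hg : SignDet H (n + 1) A g) :
    ∃ C : ℕ → ℕ → ZMod 2, ∀ x ∈ A, g x = ∑ i ∈ Finset.range (n + 1), ind (0 < (H i).ev x) *
      ∑ m ∈ Finset.range (n + 1), C i m * ind (0 < (H m).ev x) := by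
  classical
  induction n generalizing g with
  | zero =>
    rcases A.eq_empty_or_nonempty with rfl | ⟨a, ha⟩
    · simp
    · refine ⟨fun _ _ => g a, fun x hx => ?_⟩
      simp only [zero_add, Finset.range_one, Finset.sum_singleton, ind_true (h0 x hx), mul_one,
        one_mul]
      refine hg x hx a ha fun i hi => ?_
      obtain rfl : i = 0 := by omega
      exact iff_of_true (h0 x hx) (h0 a ha)
  | succ n ih =>
    have gen' : ∀ x ∈ A, ∀ i < n + 1, (H i).ev x ≠ 0 := fun x hx i hi => gen x hx i (by omega)
    set R : Plane → Plane → Plane → Prop := fun z x y => x ∈ A ∧ y ∈ A ∧ SameSigns H (n + 1) x y ∧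
      (H (n + 1)).ev x < 0 ∧ 0 < (H (n + 1)).ev y ∧ SameSigns H (n + 1) x z with hR
    set B : Set Plane := {z | (H (n + 1)).ev z = 0 ∧ (∀ i < n + 1, (H i).ev z ≠ 0) ∧
      ∃ x y, R z x y} with hB
    have huniq : ∀ z z' x y x' y', SameSigns H (n + 1) z z' → R z x y → R z' x' y' →
        g x + g y = g x' + g y' := by
      rintro z z' x y x' y' hz ⟨hx, hy, hxy, kx, ky, e⟩ ⟨hx', hy', hxy', kx', ky', e'⟩
      have e := (e.trans hz).trans e'.symm
      rw [hg x hx x' hx' (e.succ (iff_of_false kx.not_gt kx'.not_gt)),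
        hg y hy y' hy' (((hxy.symm.trans e).trans hxy').succ (iff_of_true ky ky'))]
    obtain ⟨δ, hδ⟩ : ∃ δ : Plane → ZMod 2, ∀ z x y, R z x y → δ z = g x + g y := by
      have : ∀ z, ∃ d : ZMod 2, ∀ x y, R z x y → d = g x + g y := by
        intro z
        by_cases hc : ∃ x y, R z x y
        · obtain ⟨x, y, h⟩ := hc
          exact ⟨g x + g y, fun x' y' h' => huniq z z x y x' y' (fun _ _ => Iff.rfl) h h'⟩
        · exact ⟨0, fun x y h => (hc ⟨x, y, h⟩).elim⟩
      choose δ hδ using this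
      exact ⟨δ, hδ⟩
    obtain ⟨c, hc⟩ := SignDet.exists_linear (H := H) (hH (n + 1) (by omega) (by omega)) n (A := B)
      (fun z hz => hz.1) (fun z hz => hz.2.1)
      (fun z ⟨_, _, x, y, h⟩ => (h.2.2.2.2.2 0 (by omega)).1 (h0 x h.1)) (g := δ)
      (by
        rintro z ⟨_, _, x, y, h⟩ z' ⟨_, _, x', y', h'⟩ hz
        rw [hδ z x y h, hδ z' x' y' h', huniq z z' x y x' y' hz h h'])
    obtain ⟨C, hC⟩ := ih (fun i hi hi' => hH i hi (by omega)) gen'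
      (signDet_of_correction (H := H) (n := n + 1)
      (δ := fun x => ∑ i ∈ Finset.range (n + 1), c i * ind (0 < (H i).ev x))
      (fun x hx => gen x hx _ (by omega)) hg
      (fun x y hxy => Finset.sum_congr rfl fun i hi => by
        rw [ind_congr (hxy i (Finset.mem_range.1 hi))])
      (fun x hx y hy hxy kx ky => by
        obtain ⟨z, z1, z2, z3, -⟩ :=
          exists_crossing_sameSigns kx ky hxy (gen' x hx) (gen' y hy)
        have hRz : R z x y := ⟨hx, hy, hxy, kx, ky, z2⟩
        rw [← hδ z x y hRz, hc z ⟨z1, z3, x, y, hRz⟩]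
        exact Finset.sum_congr rfl fun i hi => by
          rw [ind_congr (z2 i (Finset.mem_range.1 hi))]))
    refine ⟨fun i m => if m = n + 1 then 0 else if i = n + 1 then c m else C i m, fun x hx => ?_⟩
    have e1 : ∀ i, ∑ m ∈ Finset.range (n + 1 + 1),
        (if m = n + 1 then 0 else if i = n + 1 then c m else C i m) * ind (0 < (H m).ev x) =
        ∑ m ∈ Finset.range (n + 1), (if i = n + 1 then c m else C i m) * ind (0 < (H m).ev x) := by
      intro i
      rw [Finset.sum_range_succ, if_pos rfl, zero_mul, add_zero]
      refine Finset.sum_congr rfl fun m hm => ?_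
      rw [if_neg (by have := Finset.mem_range.1 hm; omega)]
    have e2 := hC x hx
    simp only [e1]
    have e3 : ∀ i ∈ Finset.range (n + 1), ind (0 < (H i).ev x) * ∑ m ∈ Finset.range (n + 1),
        (if i = n + 1 then c m else C i m) * ind (0 < (H m).ev x) =
        ind (0 < (H i).ev x) * ∑ m ∈ Finset.range (n + 1), C i m * ind (0 < (H m).ev x) := by
      intro i hi
      simp only [if_neg (show i ≠ n + 1 by have := Finset.mem_range.1 hi; omega)]
    rw [Finset.sum_range_succ, Finset.sum_congr rfl e3, ← e2]
    simp only [if_true]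
    set t := ind (0 < (H (n + 1)).ev x) *
      ∑ i ∈ Finset.range (n + 1), c i * ind (0 < (H i).ev x)
    have := CharTwo.add_self_eq_zero t
    linear_combination -this

/-- A set determined by the sides of the lines is given by a quadratic form. -/
theorem exists_pform {H : ℕ → Ln} (n : ℕ) (hH : ∀ i, 0 < i → i < n + 1 → (H i).Nondeg)
    {A P : Set Plane} (gen : ∀ x ∈ A, ∀ i < n + 1, (H i).ev x ≠ 0)
    (h0 : ∀ x ∈ A, 0 < (H 0).ev x)
    (hP : ∀ x ∈ A, ∀ y ∈ A, SameSigns H (n + 1) x y → (x ∈ P ↔ y ∈ P)) :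
    ∃ C : ℕ → ℕ → Bool, ∀ x ∈ A, (Layout.pform (n + 1) H C x ↔ x ∈ P) := by
  classical
  obtain ⟨C, hC⟩ := SignDet.exists_quadratic n hH gen h0 (g := fun x => ind (x ∈ P))
    fun x hx y hy h => ind_congr (hP x hx y hy h)
  refine ⟨fun i m => decide (C i m = 1), fun x hx => ind_inj ?_⟩
  rw [hC x hx, Layout.pform, Layout.ind_par]
  refine Finset.sum_congr rfl fun i _ => ?_
  rw [ind_and, Layout.ind_par]
  congr 1
  refine Finset.sum_congr rfl fun m _ => ?_
  rw [ind_and, decide_eq_true_iff]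
  congr 1
  have : ∀ a : ZMod 2, a = 0 ∨ a = 1 := by decide
  rcases this (C i m) with h | h <;> rw [h] <;> simp [ind]

/-! ### Cells of a grid -/

/-- The open axis-parallel square with lower left corner `(x, y)` and side `d`. -/
def cell (x y d : ℝ) : Set Plane := PolyCell (rectLines x (x + d) y (y + d))

theorem mem_cell {x y d : ℝ} {p : Plane} :
    p ∈ cell x y d ↔ (x < p.1 ∧ p.1 < x + d) ∧ y < p.2 ∧ p.2 < y + d := mem_rectLines

theorem cell_subset {x y d h : ℝ} {a b N c : ℕ} (hh : 0 ≤ h) (hd : d = N * h) (ha : a + c ≤ N)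
    (hb : b + c ≤ N) : cell (x + a * h) (y + b * h) (c * h) ⊆ cell x y d := by
  intro p hp
  rw [mem_cell] at hp ⊢
  have ha' : ((a : ℝ) + c) * h ≤ N * h := mul_le_mul_of_nonneg_right (by exact_mod_cast ha) hh
  have hb' : ((b : ℝ) + c) * h ≤ N * h := mul_le_mul_of_nonneg_right (by exact_mod_cast hb) hh
  have h1 : 0 ≤ a * h := by positivity
  have h2 : 0 ≤ b * h := by positivity
  exact ⟨⟨by linarith, by linarith⟩, by linarith, by linarith⟩

theorem lt_of_mul_cells {u h t : ℝ} {a b c : ℕ} (hh : 0 < h) (h1 : u + a * h < t)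
    (h2 : t < u + b * h + c * h) : a < b + c := by
  have : (a : ℝ) * h < (b + c : ℕ) * h := by push_cast; linarith
  exact_mod_cast lt_of_mul_lt_mul_right this hh.le

theorem exists_cell {t u h : ℝ} {N : ℕ} (hh : 0 < h) (h1 : u < t) (h2 : t < u + N * h)
    (hne : ∀ k : ℕ, t ≠ u + k * h) : ∃ a < N, u + a * h < t ∧ t < u + a * h + h := by
  have h0 : 0 ≤ (t - u) / h := div_nonneg (by linarith) hh.le
  have e1 : (⌊(t - u) / h⌋₊ : ℝ) * h ≤ t - u := by rw [← le_div_iff₀ hh]; exact Nat.floor_le h0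
  have e2 : t - u < (⌊(t - u) / h⌋₊ + 1) * h := by
    rw [← div_lt_iff₀ hh]; exact Nat.lt_floor_add_one _
  refine ⟨⌊(t - u) / h⌋₊, ?_, lt_of_le_of_ne (by linarith) (hne _).symm, by linarith⟩
  have : (⌊(t - u) / h⌋₊ : ℝ) * h < N * h := by linarith
  exact_mod_cast lt_of_mul_lt_mul_right this hh.le

theorem residual_not_grid (x y h : ℝ) :
    ∀ᶠ p : Plane in residual Plane, ∀ k : ℕ, p.1 ≠ x + k * h ∧ p.2 ≠ y + k * h := by
  rw [eventually_countable_forall]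
  intro k
  filter_upwards [residual_line_ne (a := 1) (b := 0) (-(x + k * h)) (Or.inl one_ne_zero),
    residual_line_ne (a := 0) (b := 1) (-(y + k * h)) (Or.inr one_ne_zero)] with p h1 h2
  exact ⟨fun h => h1 (by rw [h]; ring), fun h => h2 (by rw [h]; ring)⟩

theorem card_le_two_of_close {S : Finset ℕ} (h : ∀ a ∈ S, ∀ b ∈ S, a < b + 2) : S.card ≤ 2 := by
  rcases S.eq_empty_or_nonempty with rfl | hS
  · simp
  · have : S ⊆ {S.min' hS, S.min' hS + 1} := by
      intro a ha
      have h1 := h a ha _ (S.min'_mem hS)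
      have h2 := S.min'_le a ha
      simp only [Finset.mem_insert, Finset.mem_singleton]
      omega
    exact (Finset.card_le_card this).trans Finset.card_le_two

/-- A line with bounded slope meets at most two consecutive cells of a row. -/
theorem cells_close {u v h p1 p2 q1 q2 m n : ℝ} {a b : ℕ} (hh : 0 < h) (hmn : |n| ≤ |m|)
    (hm : m ≠ 0) (e : m * (p1 - q1) + n * (p2 - q2) = 0) (hp : u + a * h < p1)
    (hq : q1 < u + b * h + h) (hp2 : v < p2 ∧ p2 < v + h) (hq2 : v < q2 ∧ q2 < v + h) :
    a < b + 2 := by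
  by_contra! hc
  have h1 : ((b : ℝ) + 2) * h ≤ a * h := mul_le_mul_of_nonneg_right (by exact_mod_cast hc) hh.le
  have h2 : h < p1 - q1 := by linarith
  have h3 : |p2 - q2| < h := by rw [abs_lt]; constructor <;> linarith [hp2.1, hp2.2, hq2.1, hq2.2]
  have h4 : |m| * |p1 - q1| = |n| * |p2 - q2| := by
    rw [← abs_mul, ← abs_mul, eq_neg_of_add_eq_zero_left e, abs_neg]
  have h5 := abs_pos.2 hm
  rw [abs_of_pos (hh.trans h2)] at h4
  nlinarith [abs_nonneg (p2 - q2), abs_nonneg n]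

/-- The line `l` meets the set `S`. -/
def Ln.Meets (l : Ln) (S : Set Plane) : Prop := ∃ p ∈ S, l.ev p = 0

open Classical in
/-- A line meets at most half of the cells of a `4 × 4` grid. -/
theorem Ln.card_cells_le {l : Ln} (hl : l.Nondeg) {x y h : ℝ} (hh : 0 < h) :
    ((Finset.range 4 ×ˢ Finset.range 4).filter fun c : ℕ × ℕ =>
      l.Meets (cell (x + c.1 * h) (y + c.2 * h) h)).card ≤ 8 := by
  rcases le_total |l.2.1| |l.1| with hs | hs
  · have h0 : l.1 ≠ 0 := by
      intro h0
      rw [h0, abs_zero] at hs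
      have := abs_eq_zero.1 (le_antisymm hs (abs_nonneg _))
      exact hl.elim (fun h => h h0) (fun h => h this)
    refine (Finset.card_le_mul_card_image_of_maps_to (f := Prod.snd) (t := Finset.range 4)
      ?_ 2 ?_).trans (by simp)
    · intro c hc; simp only [Finset.mem_filter, Finset.mem_product] at hc; exact hc.1.2
    · intro b _
      rw [← Finset.card_image_of_injOn (f := Prod.fst)]
      · refine card_le_two_of_close fun a ha a' ha' => ?_
        simp only [Finset.mem_image, Finset.mem_filter] at ha ha'
        obtain ⟨c, ⟨⟨-, p, hp, ep⟩, rfl⟩, rfl⟩ := ha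
        obtain ⟨c', ⟨⟨-, q, hq, eq⟩, hb⟩, rfl⟩ := ha'
        rw [mem_cell] at hp hq
        rw [hb] at hq
        refine cells_close hh hs h0 (p2 := p.2) (q2 := q.2) ?_ hp.1.1 hq.1.2 hp.2 hq.2
        simp only [Ln.ev] at ep eq
        linear_combination ep - eq
      · rintro c hc c' hc' e
        simp only [Finset.coe_filter, Set.mem_ofPred_eq, Finset.mem_filter] at hc hc'
        exact Prod.ext e (hc.2.trans hc'.2.symm)
  · have h0 : l.2.1 ≠ 0 := by
      intro h0
      rw [h0, abs_zero] at hs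
      have := abs_eq_zero.1 (le_antisymm hs (abs_nonneg _))
      exact hl.elim (fun h => h this) (fun h => h h0)
    refine (Finset.card_le_mul_card_image_of_maps_to (f := Prod.fst) (t := Finset.range 4)
      ?_ 2 ?_).trans (by simp)
    · intro c hc; simp only [Finset.mem_filter, Finset.mem_product] at hc; exact hc.1.1
    · intro b _
      rw [← Finset.card_image_of_injOn (f := Prod.snd)]
      · refine card_le_two_of_close fun a ha a' ha' => ?_
        simp only [Finset.mem_image, Finset.mem_filter] at ha ha'
        obtain ⟨c, ⟨⟨-, p, hp, ep⟩, rfl⟩, rfl⟩ := ha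
        obtain ⟨c', ⟨⟨-, q, hq, eq⟩, hb⟩, rfl⟩ := ha'
        rw [mem_cell] at hp hq
        rw [hb] at hq
        refine cells_close hh hs h0 (p2 := p.1) (q2 := q.1) ?_ hp.2.1 hq.2.2 hp.1 hq.1
        simp only [Ln.ev] at ep eq
        linear_combination ep - eq
      · rintro c hc c' hc' e
        simp only [Finset.coe_filter, Set.mem_ofPred_eq, Finset.mem_filter] at hc hc'
        exact Prod.ext (hc.2.trans hc'.2.symm) e

open Classical in
/-- Some cell of a `4 × 4` grid is met by at most half of the lines. -/
theorem exists_sparse_cell {ι : Type*} {l : ι → Ln} (hl : ∀ i, (l i).Nondeg) (s : Finset ι)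
    (x y : ℝ) {h : ℝ} (hh : 0 < h) : ∃ a < 4, ∃ b < 4,
      2 * (s.filter fun i => (l i).Meets (cell (x + (a : ℕ) * h) (y + (b : ℕ) * h) h)).card ≤
        s.card := by
  by_contra! hc
  have h1 := Finset.sum_card_bipartiteAbove_eq_sum_card_bipartiteBelow (s := s)
    (t := Finset.range 4 ×ˢ Finset.range 4)
    (fun i c => (l i).Meets (cell (x + (c.1 : ℕ) * h) (y + (c.2 : ℕ) * h) h))
  have h2 : ∑ i ∈ s, (Finset.bipartiteAbove (fun i c => (l i).Meets
      (cell (x + (c.1 : ℕ) * h) (y + (c.2 : ℕ) * h) h)) (Finset.range 4 ×ˢ Finset.range 4) i).card ≤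
      s.card • 8 := Finset.sum_le_card_nsmul _ _ _ fun i _ => (l i).card_cells_le (hl i) hh
  have h3 : (Finset.range 4 ×ˢ Finset.range 4).card • (s.card + 1) ≤
      ∑ c ∈ Finset.range 4 ×ˢ Finset.range 4, 2 * (Finset.bipartiteBelow (fun i c => (l i).Meets
      (cell (x + (c.1 : ℕ) * h) (y + (c.2 : ℕ) * h) h)) s c).card := by
    refine Finset.card_nsmul_le_sum _ _ _ fun c hcm => ?_
    simp only [Finset.mem_product, Finset.mem_range] at hcm
    exact hc c.1 hcm.1 c.2 hcm.2
  rw [← Finset.mul_sum, ← h1] at h3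
  simp only [Finset.card_product, Finset.card_range, smul_eq_mul] at h2 h3
  omega

/-! ### Determined sets -/

/-- Inside `Q`, membership in `P` only depends on the sides of the lines in `s`. -/
def DetOn {ι : Type*} (l : ι → Ln) (P : Set Plane) (s : Finset ι) (Q : Set Plane) : Prop :=
  ∀ x ∈ Q, ∀ y ∈ Q, (∀ i ∈ s, (l i).ev x ≠ 0) → (∀ i ∈ s, (l i).ev y ≠ 0) →
    (∀ i ∈ s, (0 < (l i).ev x ↔ 0 < (l i).ev y)) → (x ∈ P ↔ y ∈ P)

theorem DetOn.mono {ι : Type*} {l : ι → Ln} {P : Set Plane} {s : Finset ι} {Q Q' : Set Plane}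
    (h : DetOn l P s Q) (hQ : Q' ⊆ Q) : DetOn l P s Q' :=
  fun x hx y hy => h x (hQ hx) y (hQ hy)

open Classical in
/-- Lines that miss a convex cell can be dropped. -/
theorem DetOn.filter_meets {ι : Type*} {l : ι → Ln} {P : Set Plane} {s : Finset ι} {L : List Ln}
    (h : DetOn l P s (PolyCell L)) :
    DetOn l P (s.filter fun i => (l i).Meets (PolyCell L)) (PolyCell L) := by
  intro x hx y hy gx gy hxy
  have key : ∀ x ∈ PolyCell L, ∀ y ∈ PolyCell L, ∀ i, ¬ (l i).Meets (PolyCell L) →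
      0 < (l i).ev y → 0 < (l i).ev x := by
    intro x hx y hy i hi ky
    by_contra! hc
    rcases hc.lt_or_eq with hc | hc
    · obtain ⟨z, hz, θ, h0, h1, hzl⟩ := Ln.exists_crossing hc ky
      refine hi ⟨z, fun m hm => ?_, hz⟩
      rw [hzl]
      have := hx m hm
      have := hy m hm
      have : 0 < 1 - θ := by linarith
      positivity
    · exact hi ⟨x, hx, hc⟩
  refine h x hx y hy (fun i hi => ?_) (fun i hi => ?_) fun i hi => ?_
  · by_cases hm : (l i).Meets (PolyCell L)
    · exact gx i (Finset.mem_filter.2 ⟨hi, hm⟩)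
    · exact fun hc => hm ⟨x, hx, hc⟩
  · by_cases hm : (l i).Meets (PolyCell L)
    · exact gy i (Finset.mem_filter.2 ⟨hi, hm⟩)
    · exact fun hc => hm ⟨y, hy, hc⟩
  · by_cases hm : (l i).Meets (PolyCell L)
    · exact hxy i (Finset.mem_filter.2 ⟨hi, hm⟩)
    · exact ⟨key y hy x hx i hm, key x hx y hy i hm⟩

/-! ### Filling the unit square -/

theorem residual_gen {ι : Type*} {l : ι → Ln} (hl : ∀ i, (l i).Nondeg) (s : Finset ι) :
    ∀ᶠ x : Plane in residual Plane, ∀ i ∈ s, (l i).ev x ≠ 0 :=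
  (Filter.eventually_all_finset s).2 fun i _ => residual_ev_ne (hl i)

theorem exists_fill_piece {ι : Type*} {l : ι → Ln} (hl : ∀ i, (l i).Nondeg) {P : Set Plane}
    {s : Finset ι} {D : Layout} (hD : D.Fits) (hP : DetOn l P s D.piece) {W : Set Plane}
    (hW : W ⊆ UnitSq) : ∃ W' ⊆ UnitSq, WReach (16155 * (s.card + 1)) W W' ∧
      (∀ᶠ x : Plane in residual Plane, x ∈ D.piece → (x ∈ W' ↔ x ∈ P)) ∧
      ∀ x ∉ D.piece, x ∉ D.scratch → (x ∈ W' ↔ x ∈ W) := by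
  let e := s.equivFin
  let H : ℕ → Ln := fun k => if h : 0 < k ∧ k - 1 < s.card then l (e.symm ⟨k - 1, h.2⟩)
    else (0, 0, 1)
  have hH : ∀ i, 0 < i → i < s.card + 1 → ∃ j ∈ s, H i = l j := by
    intro i h0 h1
    have h : 0 < i ∧ i - 1 < s.card := ⟨h0, by omega⟩
    exact ⟨_, (e.symm ⟨i - 1, h.2⟩).2, by simp only [H]; rw [dif_pos h]⟩
  have hH' : ∀ j ∈ s, ∃ i < s.card + 1, H i = l j := by
    intro j hj
    have h : 0 < (e ⟨j, hj⟩ : ℕ) + 1 ∧ (e ⟨j, hj⟩ : ℕ) + 1 - 1 < s.card :=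
      ⟨by omega, by have := (e ⟨j, hj⟩).2; omega⟩
    refine ⟨(e ⟨j, hj⟩ : ℕ) + 1, by have := h.2; omega, ?_⟩
    simp only [H]
    rw [dif_pos h]
    simp
  have hH0 : ∀ x, (H 0).ev x = 1 := by
    intro x; simp [H, Ln.ev]
  obtain ⟨C, hC⟩ := exists_pform s.card (H := H) (A := {x ∈ D.piece | ∀ i ∈ s, (l i).ev x ≠ 0})
    (P := P) (fun i h0 h1 => by obtain ⟨j, -, hj⟩ := hH i h0 h1; rw [hj]; exact hl j)
    (fun x hx i hi => by
      rcases Nat.eq_zero_or_pos i with rfl | h0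
      · rw [hH0]; exact one_ne_zero
      · obtain ⟨j, hjs, hj⟩ := hH i h0 hi; rw [hj]; exact hx.2 j hjs)
    (fun x _ => by rw [hH0]; exact one_pos)
    (fun x hx y hy hxy => hP x hx.1 y hy.1 hx.2 hy.2 fun j hj => by
      obtain ⟨i, hi, e⟩ := hH' j hj; rw [← e]; exact hxy i hi)
  obtain ⟨ρ, hρ, hρ'⟩ := Layout.exists_rreach_pform hD (s.card + 1) H C
  obtain ⟨W', h1, h2, h3, h4⟩ := Layout.RReach.exec hD hρ hW
  refine ⟨W', h1, h2.mono (by omega), ?_, h4⟩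
  filter_upwards [residual_gen hl s] with x gx hx
  rw [h3 x hx, hρ' x hx, hC x ⟨hx, gx⟩]

/-- The layout whose piece is the cell `p` of a `64 × 64` grid in `cell x y d`, and whose scratch
area is the cell `(A, B)` of the `4 × 4` grid. -/
noncomputable def gridLayout (x y : ℝ) {d : ℝ} (hd : 0 < d) (A B : ℕ) (p : ℕ × ℕ) : Layout where
  px := x + p.1 * (d / 64)
  py := y + p.2 * (d / 64)
  s := d / 64
  rx := x + A * (d / 4)
  ry := y + B * (d / 4)
  s_pos := by positivity

theorem gridLayout_piece (x y : ℝ) {d : ℝ} (hd : 0 < d) (A B : ℕ) (p : ℕ × ℕ) :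
    (gridLayout x y hd A B p).piece = cell (x + p.1 * (d / 64)) (y + p.2 * (d / 64)) (d / 64) :=
  rfl

theorem gridLayout_scratch (x y : ℝ) {d : ℝ} (hd : 0 < d) (A B : ℕ) (p : ℕ × ℕ) :
    (gridLayout x y hd A B p).scratch = cell (x + A * (d / 4)) (y + B * (d / 4)) (d / 4) := by
  have : 16 * (d / 64) = d / 4 := by ring
  simp only [Layout.scratch, gridLayout, cell, this]

theorem cell_disjoint {x y h : ℝ} (hh : 0 < h) {p q : ℕ × ℕ} (hpq : p ≠ q) {z : Plane}
    (h1 : z ∈ cell (x + p.1 * h) (y + p.2 * h) h) : z ∉ cell (x + q.1 * h) (y + q.2 * h) h := by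
  intro h2
  rw [mem_cell] at h1 h2
  have a1 := lt_of_mul_cells (b := q.1) (c := 1) hh h1.1.1 (by push_cast; linarith [h2.1.2])
  have a2 := lt_of_mul_cells (b := p.1) (c := 1) hh h2.1.1 (by push_cast; linarith [h1.1.2])
  have a3 := lt_of_mul_cells (b := q.2) (c := 1) hh h1.2.1 (by push_cast; linarith [h2.2.2])
  have a4 := lt_of_mul_cells (b := p.2) (c := 1) hh h2.2.1 (by push_cast; linarith [h1.2.2])
  exact hpq (Prod.ext (by omega) (by omega))

theorem cell_div_subset {x y d : ℝ} (hd : 0 < d) {p : ℕ × ℕ} {z : Plane}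
    (hz : z ∈ cell (x + p.1 * (d / 64)) (y + p.2 * (d / 64)) (d / 64)) :
    z ∈ cell (x + (p.1 / 16 : ℕ) * (d / 4)) (y + (p.2 / 16 : ℕ) * (d / 4)) (d / 4) := by
  have key : ∀ n : ℕ, ((n / 16 : ℕ) : ℝ) * (d / 4) ≤ n * (d / 64) ∧
      n * (d / 64) + d / 64 ≤ ((n / 16 : ℕ) : ℝ) * (d / 4) + d / 4 := by
    intro n
    have h1 : ((16 * (n / 16) : ℕ) : ℝ) * (d / 64) ≤ n * (d / 64) :=
      mul_le_mul_of_nonneg_right (by exact_mod_cast Nat.mul_div_le n 16) (by positivity)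
    have h2 : ((n + 1 : ℕ) : ℝ) * (d / 64) ≤ ((16 * (n / 16) + 16 : ℕ) : ℝ) * (d / 64) :=
      mul_le_mul_of_nonneg_right (by exact_mod_cast (by omega)) (by positivity)
    push_cast at h1 h2 ⊢
    constructor <;> linarith
  rw [mem_cell] at hz ⊢
  have := key p.1
  have := key p.2
  exact ⟨⟨by linarith, by linarith⟩, by linarith, by linarith⟩

theorem subcell_subset {x y d : ℝ} (hd : 0 < d) {N a b : ℕ} (hN : 0 < N) (ha : a < N)
    (hb : b < N) : cell (x + a * (d / N)) (y + b * (d / N)) (d / N) ⊆ cell x y d := by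
  simpa using cell_subset (x := x) (y := y) (d := d) (h := d / N) (N := N) (c := 1)
    (by positivity) (by field_simp) ha hb

theorem gridLayout_fits {x y d : ℝ} (hd : 0 < d) (hQ : cell x y d ⊆ UnitSq) {A B : ℕ}
    (hA : A < 4) (hB : B < 4) {p : ℕ × ℕ} (h1 : p.1 < 64) (h2 : p.2 < 64)
    (hp : (p.1 / 16, p.2 / 16) ≠ (A, B)) : (gridLayout x y hd A B p).Fits where
  piece_sub := by
    rw [gridLayout_piece]
    refine Set.Subset.trans ?_ hQ
    exact_mod_cast subcell_subset (x := x) (y := y) hd (N := 64) (by norm_num) h1 h2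
  scratch_sub := by
    rw [gridLayout_scratch]
    refine Set.Subset.trans ?_ hQ
    exact_mod_cast subcell_subset (x := x) (y := y) hd (N := 4) (by norm_num) hA hB
  disj := by
    intro z hz
    rw [gridLayout_piece] at hz
    rw [gridLayout_scratch]
    exact cell_disjoint (q := (A, B)) (by positivity) hp (cell_div_subset hd hz)

theorem exists_fill_pieces {ι : Type*} {l : ι → Ln} (hl : ∀ i, (l i).Nondeg) {P : Set Plane}
    {s : Finset ι} {x y d : ℝ} (hd : 0 < d) (hQ : cell x y d ⊆ UnitSq)
    (hP : DetOn l P s (cell x y d)) {A B : ℕ} (hA : A < 4) (hB : B < 4) {W : Set Plane}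
    (hW : W ⊆ UnitSq) (F : Finset (ℕ × ℕ)) :
    (∀ p ∈ F, p.1 < 64 ∧ p.2 < 64 ∧ (p.1 / 16, p.2 / 16) ≠ (A, B)) →
      ∃ W' ⊆ UnitSq, WReach (F.card * (16155 * (s.card + 1))) W W' ∧
        ∀ᶠ z : Plane in residual Plane,
          (∀ p ∈ F, z ∈ cell (x + p.1 * (d / 64)) (y + p.2 * (d / 64)) (d / 64) →
            (z ∈ W' ↔ z ∈ P)) ∧ (z ∉ cell x y d → (z ∈ W' ↔ z ∈ W)) := by
  induction F using Finset.induction_on with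
  | empty => exact fun _ => ⟨W, hW, (WReach.refl W).mono (by simp), by simp⟩
  | insert q F hq ih =>
    intro hF
    obtain ⟨W₁, h1, h2, h3⟩ := ih fun p hp => hF p (Finset.mem_insert_of_mem hp)
    obtain ⟨q1, q2, q3⟩ := hF q (Finset.mem_insert_self _ _)
    have hsub := subcell_subset (x := x) (y := y) hd (N := 64) (by norm_num) q1 q2
    have hsub' := subcell_subset (x := x) (y := y) hd (N := 4) (by norm_num) hA hB
    push_cast at hsub hsub'
    obtain ⟨W₂, g1, g2, g3, g4⟩ := exists_fill_piece hl (gridLayout_fits hd hQ hA hB q1 q2 q3)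
      (hP.mono (by rw [gridLayout_piece]; exact hsub)) h1
    rw [gridLayout_piece] at g3 g4
    rw [gridLayout_scratch] at g4
    refine ⟨W₂, g1, (h2.trans g2).mono (by rw [Finset.card_insert_of_notMem hq]; linarith), ?_⟩
    filter_upwards [h3, g3] with z hz hz'
    refine ⟨fun p hp hzp => ?_, fun hzQ => ?_⟩
    · rcases Finset.mem_insert.1 hp with rfl | hpF
      · exact hz' hzp
      · have hpq : p ≠ q := fun h => hq (h ▸ hpF)
        have hpp := hF p hp
        rw [g4 z (cell_disjoint (by positivity) hpq hzp)
          (cell_disjoint (q := (A, B)) (by positivity) hpp.2.2 (cell_div_subset hd hzp))]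
        exact hz.1 p hpF hzp
    · rw [g4 z (fun h => hzQ (hsub h)) fun h => hzQ (hsub' h)]
      exact hz.2 hzQ

/-- Everything except one of the `4 × 4` cells of a square can be filled. -/
theorem exists_fill_compl {ι : Type*} {l : ι → Ln} (hl : ∀ i, (l i).Nondeg) {P : Set Plane}
    {s : Finset ι} {x y d : ℝ} (hd : 0 < d) (hQ : cell x y d ⊆ UnitSq)
    (hP : DetOn l P s (cell x y d)) {A B : ℕ} (hA : A < 4) (hB : B < 4) {W : Set Plane}
    (hW : W ⊆ UnitSq) : ∃ W' ⊆ UnitSq, WReach (66170880 * (s.card + 1)) W W' ∧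
      ∀ᶠ z : Plane in residual Plane,
        (z ∈ cell x y d → z ∉ cell (x + A * (d / 4)) (y + B * (d / 4)) (d / 4) →
          (z ∈ W' ↔ z ∈ P)) ∧ (z ∉ cell x y d → (z ∈ W' ↔ z ∈ W)) := by
  obtain ⟨F, hF, hF'⟩ : ∃ F : Finset (ℕ × ℕ), F.card ≤ 4096 ∧
      ∀ p, p ∈ F ↔ p.1 < 64 ∧ p.2 < 64 ∧ (p.1 / 16, p.2 / 16) ≠ (A, B) :=
    ⟨(Finset.range 64 ×ˢ Finset.range 64).filter fun p => (p.1 / 16, p.2 / 16) ≠ (A, B),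
      (Finset.card_filter_le _ _).trans (by simp), by simp [and_assoc]⟩
  obtain ⟨W', h1, h2, h3⟩ := exists_fill_pieces hl hd hQ hP hA hB hW F fun p => (hF' p).1
  refine ⟨W', h1, h2.mono ((Nat.mul_le_mul_right _ hF).trans (by linarith)), ?_⟩
  filter_upwards [h3, residual_not_grid x y (d / 64)] with z hz hg
  refine ⟨fun hzQ hzA => ?_, hz.2⟩
  have hzQ' := mem_cell.1 hzQ
  obtain ⟨a, ha, ha1, ha2⟩ := exists_cell (t := z.1) (u := x) (h := d / 64) (N := 64)
    (by positivity) hzQ'.1.1 (by push_cast; linarith [hzQ'.1.2]) fun k => (hg k).1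
  obtain ⟨b, hb, hb1, hb2⟩ := exists_cell (t := z.2) (u := y) (h := d / 64) (N := 64)
    (by positivity) hzQ'.2.1 (by push_cast; linarith [hzQ'.2.2]) fun k => (hg k).2
  have hzp : z ∈ cell (x + ((a, b) : ℕ × ℕ).1 * (d / 64)) (y + ((a, b) : ℕ × ℕ).2 * (d / 64))
      (d / 64) := mem_cell.2 ⟨⟨ha1, ha2⟩, hb1, hb2⟩
  refine hz.1 (a, b) ((hF' _).2 ⟨ha, hb, fun he => hzA ?_⟩) hzp
  have := cell_div_subset hd hzp
  obtain ⟨rfl, rfl⟩ := Prod.ext_iff.1 he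
  exact this

theorem exists_fill_of_const {P : Set Plane} {x y d : ℝ} (hQ : cell x y d ⊆ UnitSq)
    (hP : ∀ z ∈ cell x y d, ∀ w ∈ cell x y d, (z ∈ P ↔ w ∈ P)) {W : Set Plane}
    (hW : W ⊆ UnitSq) : ∃ W' ⊆ UnitSq, WReach 24 W W' ∧
      ∀ z, (z ∈ cell x y d → (z ∈ W' ↔ z ∈ P)) ∧ (z ∉ cell x y d → (z ∈ W' ↔ z ∈ W)) := by
  by_cases h : ∃ w ∈ cell x y d, w ∈ P
  · obtain ⟨w, hw, hwP⟩ := h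
    refine ⟨W ∪ UnitSq ∩ cell x y d, Set.union_subset hW Set.inter_subset_left,
      (wreach_union_poly (nondeg_rectLines _ _ _ _) hW).mono (by simp [rectLines]),
      fun z => ⟨fun hz => ?_, fun hz => ?_⟩⟩
    · exact iff_of_true (Or.inr ⟨hQ hz, hz⟩) ((hP z hz w hw).2 hwP)
    · simp [hz]
  · refine ⟨W \ cell x y d, Set.sdiff_subset.trans hW,
      (wreach_diff_poly (nondeg_rectLines _ _ _ _) hW).mono (by simp [rectLines]),
      fun z => ⟨fun hz => ?_, fun hz => ?_⟩⟩
    · exact iff_of_false (fun hc => hc.2 hz) fun hc => h ⟨z, hz, hc⟩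
    · simp [hz]

/-- A square in which membership in `P` is determined by the sides of finitely many lines can be
filled with `P` by linearly many operations. -/
theorem exists_fill {ι : Type*} {l : ι → Ln} (hl : ∀ i, (l i).Nondeg) {P : Set Plane} (n : ℕ) :
    ∀ {s : Finset ι}, s.card = n → ∀ {x y d : ℝ}, 0 < d → cell x y d ⊆ UnitSq →
      DetOn l P s (cell x y d) → ∀ {W : Set Plane}, W ⊆ UnitSq →
      ∃ W' ⊆ UnitSq, WReach (264683520 * (n + 1)) W W' ∧ ∀ᶠ z : Plane in residual Plane,
        (z ∈ cell x y d → (z ∈ W' ↔ z ∈ P)) ∧ (z ∉ cell x y d → (z ∈ W' ↔ z ∈ W)) := by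
  induction n using Nat.strong_induction_on with
  | _ n ih =>
  intro s hs x y d hd hQ hP W hW
  rcases Nat.eq_zero_or_pos n with rfl | hn
  · rw [Finset.card_eq_zero] at hs
    subst hs
    obtain ⟨W', h1, h2, h3⟩ := exists_fill_of_const hQ
      (fun z hz w hw => hP z hz w hw (by simp) (by simp) (by simp)) hW
    exact ⟨W', h1, h2.mono (by omega), Filter.Eventually.of_forall h3⟩
  · obtain ⟨A, hA, B, hB, hAB⟩ := exists_sparse_cell hl s x y (h := d / 4) (by positivity)
    have hsub : cell (x + A * (d / 4)) (y + B * (d / 4)) (d / 4) ⊆ cell x y d := by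
      exact_mod_cast subcell_subset (x := x) (y := y) hd (N := 4) (by norm_num) hA hB
    obtain ⟨W₁, h1, h2, h3⟩ := exists_fill_compl hl hd hQ hP hA hB hW
    obtain ⟨s', hs', hP'⟩ : ∃ s' : Finset ι, 2 * s'.card ≤ s.card ∧
        DetOn l P s' (cell (x + A * (d / 4)) (y + B * (d / 4)) (d / 4)) :=
      ⟨_, hAB, DetOn.filter_meets (hP.mono hsub)⟩
    obtain ⟨W₂, g1, g2, g3⟩ := ih _ (by omega) rfl (by positivity) (hsub.trans hQ) hP' h1
    refine ⟨W₂, g1, (h2.trans g2).mono ?_, ?_⟩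
    · omega
    · filter_upwards [h3, g3] with z hz hz'
      refine ⟨fun hzQ => ?_, fun hzQ => ?_⟩
      · by_cases hzA : z ∈ cell (x + A * (d / 4)) (y + B * (d / 4)) (d / 4)
        · exact hz'.1 hzA
        · rw [hz'.2 hzA, hz.1 hzQ hzA]
      · rw [hz'.2 fun h => hzQ (hsub h), hz.2 hzQ]

/-! ### Polygonal domains -/

/-- A line through two points. -/
theorem exists_ln (p q : Plane) : ∃ l : Ln, l.Nondeg ∧ ∀ z ∈ segment ℝ p q, l.ev z = 0 := by
  obtain ⟨l, hl, hp, hq⟩ : ∃ l : Ln, l.Nondeg ∧ l.ev p = 0 ∧ l.ev q = 0 := by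
    by_cases h : p = q
    · subst h
      exact ⟨(1, 0, -p.1), Or.inl one_ne_zero, by simp [Ln.ev], by simp [Ln.ev]⟩
    · refine ⟨(q.2 - p.2, p.1 - q.1, q.1 * p.2 - p.1 * q.2), ?_, by simp only [Ln.ev]; ring,
        by simp only [Ln.ev]; ring⟩
      by_contra! hc
      simp only [Ln.Nondeg, not_or, not_not] at hc
      exact h (Prod.ext (by linarith [hc.2]) (by linarith [hc.1]))
  refine ⟨l, hl, ?_⟩
  rintro z ⟨a, b, -, -, hab, rfl⟩
  simp only [Ln.ev, Prod.fst_add, Prod.snd_add, Prod.smul_fst, Prod.smul_snd, smul_eq_mul] at *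
  linear_combination a * hp + b * hq - l.2.2 * hab

theorem exists_mem_segment_frontier {P : Set Plane} {x y : Plane} (hx : x ∈ P) (hy : y ∉ P) :
    ∃ z ∈ segment ℝ x y, z ∈ frontier P := by
  by_contra! hc
  obtain ⟨z, -, hz, hz'⟩ := (convex_segment (𝕜 := ℝ) x y).isPreconnected (interior P)
    (closure P)ᶜ isOpen_interior isClosed_closure.isOpen_compl
    (fun z hz => by
      by_cases h : z ∈ closure P
      · exact Or.inl (by_contra fun h' => hc z hz ⟨h, h'⟩)
      · exact Or.inr h)
    ⟨x, left_mem_segment ℝ x y, by_contra fun h' => hc x (left_mem_segment ℝ x y)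
      ⟨subset_closure hx, h'⟩⟩
    ⟨y, right_mem_segment ℝ x y, fun h' => hc y (right_mem_segment ℝ x y)
      ⟨h', fun h => hy (interior_subset h)⟩⟩
  exact hz' (subset_closure (interior_subset hz))

theorem detOn_of_frontier {n : ℕ} {P : Set Plane} {s : Fin n → Plane × Plane} {l : Fin n → Ln}
    (hP : frontier P ⊆ ⋃ i, segment ℝ (s i).1 (s i).2)
    (hl : ∀ i, ∀ z ∈ segment ℝ (s i).1 (s i).2, (l i).ev z = 0) (Q : Set Plane) :
    DetOn l P Finset.univ Q := by
  have key : ∀ x y, (∀ i, (l i).ev x ≠ 0) → (∀ i, (l i).ev y ≠ 0) →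
      (∀ i, (0 < (l i).ev x ↔ 0 < (l i).ev y)) → x ∈ P → y ∈ P := by
    intro x y hx hy hxy hxP
    by_contra hyP
    obtain ⟨z, hz, hzP⟩ := exists_mem_segment_frontier hxP hyP
    obtain ⟨i, hi⟩ := Set.mem_iUnion.1 (hP hzP)
    have h0 := hl i z hi
    obtain ⟨a, b, ha, hb, hab, rfl⟩ := hz
    have e : (l i).ev (a • x + b • y) = a * (l i).ev x + b * (l i).ev y := by
      simp only [Ln.ev, Prod.fst_add, Prod.snd_add, Prod.smul_fst, Prod.smul_snd, smul_eq_mul]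
      linear_combination -(l i).2.2 * hab
    rw [e] at h0
    have hxy := hxy i
    rcases lt_or_gt_of_ne (hx i) with h1 | h1
    · have h2 : (l i).ev y < 0 := lt_of_le_of_ne (not_lt.1 fun h => h1.not_gt (hxy.2 h)) (hy i)
      rcases ha.eq_or_lt with h | h
      · subst h; nlinarith
      · nlinarith [mul_nonneg hb (neg_nonneg.2 h2.le), mul_pos h (neg_pos.2 h1)]
    · have h2 := hxy.1 h1
      rcases ha.eq_or_lt with h | h
      · subst h; nlinarith
      · nlinarith [mul_nonneg hb h2.le, mul_pos h h1]
  intro x _ y _ hx hy hxy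
  simp only [Finset.mem_univ, forall_true_left] at hx hy hxy
  exact ⟨key x y hx hy hxy, key y x hy hx fun i => (hxy i).symm⟩

theorem cell_zero_one : cell 0 0 1 = UnitSq := by
  ext p
  rw [mem_cell, mem_unitSq]
  simp

theorem stmt11 :
    ∃ C : ℕ, ∀ n : ℕ, 1 ≤ n → ∀ P : Set Plane,
      IsPolygonalDomain P n → P ⊆ UnitSq →
      ∃ s ≤ C * n, ∃ c : UConfig,
        DUReach 1 s ⟨UnitSq, [], UnitSq, []⟩ c ∧ Realizes c.T₁ P := by
  refine ⟨529367040, fun n hn P hP hPU => ?_⟩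
  obtain ⟨-, -, hreg, s, hs⟩ := hP
  choose l hl hls using fun i => exists_ln (s i).1 (s i).2
  obtain ⟨W, hWU, hW, hWP⟩ := exists_fill hl (P := P) n (Finset.card_fin n) one_pos
    cell_zero_one.le (detOn_of_frontier hs hls _) (Set.Subset.refl UnitSq)
  obtain ⟨m, hm, c, hc, hcr, hcW⟩ := hW ⟨UnitSq, [], UnitSq, []⟩ regOpen_unitSq (Meq.refl _)
  refine ⟨m, by omega, c, hc, id, ⟨0, 0, by simp⟩, ?_⟩
  rw [Set.image_id]
  refine hcr.eq_of_meq hreg.symm (hcW.trans ?_)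
  filter_upwards [hWP] with z hz
  rw [cell_zero_one] at hz
  by_cases hzU : z ∈ UnitSq
  · exact hz.1 hzU
  · exact iff_of_false (fun h => hzU (hWU h)) fun h => hzU (hPU h)
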